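/- (Remmert–Stein extension for cones) Let A be a nonempty analytic subset of ℂⁿ ∖ {0} that is invariant under scalar multiplication: for every λ ∈ ℂ ∖ {0} and a ∈ A, λ·a ∈ A. Then the closure Ā = A ∪ {0} of A in ℂⁿ is an analytic subset of ℂⁿ, and moreover there exist finitely many homogeneous polynomials p₁, …, p_k in n complex variables such that A ∪ {0} = {z ∈ ℂⁿ : p₁(z) = ⋯ = p_k(z) = 0}. -/

import Mathlib

/-- `A` is an analytic subset of the open set `U ⊆ ℂⁿ`: it is contained in `U`, closed in `U`,
and every point of `A` has an open neighborhood `W ⊆ U` on which `A` is the common zero set of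
finitely many holomorphic functions. -/
def IsAnalyticSubset {n : ℕ} (U A : Set (EuclideanSpace ℂ (Fin n))) : Prop :=
  A ⊆ U ∧ (∀ z ∈ U, z ∈ closure A → z ∈ A) ∧
  ∀ a ∈ A, ∃ W : Set (EuclideanSpace ℂ (Fin n)), IsOpen W ∧ a ∈ W ∧ W ⊆ U ∧
    ∃ (k : ℕ) (f : Fin k → EuclideanSpace ℂ (Fin n) → ℂ),
      (∀ i, DifferentiableOn ℂ (f i) W) ∧
      A ∩ W = {z ∈ W | ∀ i, f i z = 0}

section RemmertStein

open Filter Topology Metric Set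

/-- `f` is complex differentiable on a neighborhood of `x`. -/
def HolAt {E G : Type*} [NormedAddCommGroup E] [NormedSpace ℂ E]
    [NormedAddCommGroup G] [NormedSpace ℂ G] (f : E → G) (x : E) : Prop :=
  ∀ᶠ y in 𝓝 x, DifferentiableAt ℂ f y

namespace HolAt

variable {E E' G G' : Type*} [NormedAddCommGroup E] [NormedSpace ℂ E]
  [NormedAddCommGroup E'] [NormedSpace ℂ E']
  [NormedAddCommGroup G] [NormedSpace ℂ G] [NormedAddCommGroup G'] [NormedSpace ℂ G']
  {f g : E → G} {x : E}

theorem differentiableAt (h : HolAt f x) : DifferentiableAt ℂ f x := h.self_of_nhds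

theorem continuousAt (h : HolAt f x) : ContinuousAt f x := h.differentiableAt.continuousAt

theorem eventually (h : HolAt f x) : ∀ᶠ y in 𝓝 x, HolAt f y :=
  eventually_eventually_nhds.2 h

theorem of_differentiable (h : Differentiable ℂ f) : HolAt f x :=
  Eventually.of_forall fun y => h y

theorem of_differentiableOn {U : Set E} (h : DifferentiableOn ℂ f U) (hU : IsOpen U)
    (hx : x ∈ U) : HolAt f x := by
  filter_upwards [hU.mem_nhds hx] with y hy
  exact (h y hy).differentiableAt (hU.mem_nhds hy)

theorem congr (h : HolAt f x) (hfg : f =ᶠ[𝓝 x] g) : HolAt g x := by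
  filter_upwards [HolAt.eventually h, hfg.eventually_nhds] with y hy hy'
  exact hy.differentiableAt.congr_of_eventuallyEq (EventuallyEq.symm hy')

theorem const (c : G) : HolAt (fun _ : E => c) x := of_differentiable (differentiable_const c)

theorem add (hf : HolAt f x) (hg : HolAt g x) : HolAt (fun y => f y + g y) x := by
  filter_upwards [hf, hg] with y h1 h2 using h1.add h2

theorem sub (hf : HolAt f x) (hg : HolAt g x) : HolAt (fun y => f y - g y) x := by
  filter_upwards [hf, hg] with y h1 h2 using h1.sub h2

theorem mul {f g : E → ℂ} (hf : HolAt f x) (hg : HolAt g x) : HolAt (fun y => f y * g y) x := by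
  filter_upwards [hf, hg] with y h1 h2 using h1.mul h2

theorem pow {f : E → ℂ} (hf : HolAt f x) (k : ℕ) : HolAt (fun y => f y ^ k) x := by
  filter_upwards [hf] with y h1 using h1.pow k

theorem inv {f : E → ℂ} (hf : HolAt f x) (h0 : f x ≠ 0) : HolAt (fun y => (f y)⁻¹) x := by
  filter_upwards [hf, hf.continuousAt.eventually_ne h0] with y h1 h2 using h1.inv h2

theorem sum {ι : Type*} {s : Finset ι} {f : ι → E → G} (h : ∀ i ∈ s, HolAt (f i) x) :
    HolAt (fun y => ∑ i ∈ s, f i y) x := by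
  filter_upwards [(Finset.eventually_all s).2 h] with y hy
  exact DifferentiableAt.fun_sum hy

theorem prod {ι : Type*} {s : Finset ι} {f : ι → E → ℂ} (h : ∀ i ∈ s, HolAt (f i) x) :
    HolAt (fun y => ∏ i ∈ s, f i y) x := by
  classical
  induction s using Finset.induction_on with
  | empty => simpa using HolAt.const (1 : ℂ)
  | insert a s ha ih =>
    simp only [Finset.prod_insert ha]
    exact (h a (by simp)).mul (ih fun i hi => h i (by simp [hi]))

theorem comp {f : E → G} {u : E' → E} {x : E'} (hf : HolAt f (u x)) (hu : HolAt u x) :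
    HolAt (fun y => f (u y)) x := by
  filter_upwards [hu.continuousAt.eventually hf, hu] with y h1 h2
  exact DifferentiableAt.comp y h1 h2

theorem prodMk {f : E → G} {g : E → G'} (hf : HolAt f x) (hg : HolAt g x) :
    HolAt (fun y => (f y, g y)) x := by
  filter_upwards [hf, hg] with y h1 h2 using h1.prodMk h2

theorem pi {ι : Type*} [Fintype ι] {f : ι → E → G} (h : ∀ i, HolAt (f i) x) :
    HolAt (fun y i => f i y) x := by
  filter_upwards [eventually_all.2 h] with y hy using differentiableAt_pi.2 hy

end HolAt

section CauchyEstimates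

variable {E G : Type*} [NormedAddCommGroup E] [NormedSpace ℂ E]
  [NormedAddCommGroup G] [NormedSpace ℂ G]

theorem norm_fderiv_le_of_bound_ball {f : E → G} {x y : E} {R C : ℝ} (hR : 0 < R)
    (hf : DifferentiableOn ℂ f (ball x (2 * R))) (hC : ∀ z ∈ ball x (2 * R), ‖f z‖ ≤ C)
    (hy : y ∈ ball x R) : ‖fderiv ℂ f y‖ ≤ 2 * C / R := by
  have hsub : ball y R ⊆ ball x (2 * R) := by
    apply ball_subset_ball'
    have := mem_ball.1 hy
    linarith
  refine Complex.norm_fderiv_le_div_of_mapsTo_ball (hf.mono hsub) ?_ hR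
  intro z hz
  have h1 := hC z (hsub hz)
  have h2 := hC y (hsub (mem_ball_self hR))
  rw [mem_closedBall, dist_eq_norm]
  calc ‖f z - f y‖ ≤ ‖f z‖ + ‖f y‖ := norm_sub_le _ _
    _ ≤ 2 * C := by linarith

theorem HolAt.continuousAt_fderiv {f : E → G} {x : E} (hf : HolAt f x) :
    ContinuousAt (fderiv ℂ f) x := by
  have hb : ∀ᶠ y in 𝓝 x, ‖f y‖ ≤ ‖f x‖ + 1 := by
    have : Tendsto (fun y => ‖f y‖) (𝓝 x) (𝓝 ‖f x‖) := hf.continuousAt.norm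
    exact (this.eventually (gt_mem_nhds (lt_add_one _))).mono fun y hy => le_of_lt hy
  obtain ⟨R', hR', hball⟩ := Metric.eventually_nhds_iff_ball.1 (hf.and hb)
  obtain ⟨R, rfl⟩ : ∃ R, R' = 2 * R := ⟨R' / 2, by ring⟩
  have hR : 0 < R := by linarith
  set C := ‖f x‖ + 1 with hCdef
  have hC0 : 0 < C := by positivity
  have hd : DifferentiableOn ℂ f (ball x (2 * R)) :=
    fun y hy => (hball y hy).1.differentiableWithinAt
  have hL : ∀ y ∈ ball x R, ∀ z ∈ ball x R, ‖f z - f y‖ ≤ 2 * C / R * ‖z - y‖ := by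
    intro y hy z hz
    refine Convex.norm_image_sub_le_of_norm_fderiv_le (𝕜 := ℂ) (s := ball x R) ?_ ?_
      (convex_ball x R) hy hz
    · intro w hw
      exact (hball w (ball_subset_ball (by linarith) hw)).1
    · intro w hw
      exact norm_fderiv_le_of_bound_ball hR hd (fun w hw => (hball w hw).2) hw
  have hlim : ∀ᶠ y in 𝓝 x, ‖fderiv ℂ f y - fderiv ℂ f x‖
      ≤ 2 * (2 * C / R * ‖y - x‖) / (R / 4) := by
    filter_upwards [ball_mem_nhds x (half_pos hR)] with y hy
    rw [mem_ball, dist_eq_norm] at hy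
    set h := y - x with hh
    have hmem : ∀ z ∈ ball x (2 * (R / 4)), z ∈ ball x R ∧ z + h ∈ ball x R := by
      intro z hz
      rw [mem_ball, dist_eq_norm] at hz
      refine ⟨by rw [mem_ball, dist_eq_norm]; linarith, ?_⟩
      rw [mem_ball, dist_eq_norm]
      calc ‖z + h - x‖ = ‖(z - x) + h‖ := by congr 1; abel
        _ ≤ ‖z - x‖ + ‖h‖ := norm_add_le _ _
        _ < R := by linarith
    have hdz : ∀ z ∈ ball x R, DifferentiableAt ℂ f z :=
      fun w hw => (hball w (ball_subset_ball (by linarith) hw)).1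
    have hadd : ∀ z ∈ ball x (2 * (R / 4)),
        HasFDerivAt (fun z => f (z + h) - f z) (fderiv ℂ f (z + h) - fderiv ℂ f z) z := by
      intro z hz
      have h1 := (hdz _ (hmem z hz).2).hasFDerivAt
      have h2 := (hdz _ (hmem z hz).1).hasFDerivAt
      exact ((hasFDerivAt_comp_add_right h).2 h1).sub h2
    have key := norm_fderiv_le_of_bound_ball (f := fun z => f (z + h) - f z) (x := x) (y := x)
      (R := R / 4) (C := 2 * C / R * ‖h‖) (by linarith)
      (fun z hz => (hadd z hz).differentiableAt.differentiableWithinAt)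
      (fun z hz => by simpa using hL z (hmem z hz).1 (z + h) (hmem z hz).2)
      (mem_ball_self (by linarith))
    rw [(hadd x (mem_ball_self (by linarith))).fderiv] at key
    have : x + h = y := by rw [hh]; abel
    rwa [this] at key
  rw [ContinuousAt, tendsto_iff_norm_sub_tendsto_zero]
  refine squeeze_zero' (Eventually.of_forall fun _ => norm_nonneg _) hlim ?_
  have : ContinuousAt (fun y => 2 * (2 * C / R * ‖y - x‖) / (R / 4)) x := by fun_prop
  simpa [ContinuousAt] using this

end CauchyEstimates

section ParametricCircleIntegral

variable {E G : Type*} [NormedAddCommGroup E] [NormedSpace ℂ E]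
  [NormedAddCommGroup G] [NormedSpace ℂ G]

theorem HolAt.slice_right {F : E × ℂ → G} {x : E} {t : ℂ} (h : HolAt F (x, t)) :
    HolAt (fun s => F (x, s)) t :=
  HolAt.comp (u := fun y => (x, y)) h (.of_differentiable (by fun_prop))

theorem HolAt.eventually_forall_compact {F : E × ℂ → G} {x : E} {K : Set ℂ} (hK : IsCompact K)
    (h : ∀ t ∈ K, HolAt F (x, t)) : ∀ᶠ y in 𝓝 x, ∀ t ∈ K, HolAt F (y, t) :=
  hK.eventually_forall_of_forall_eventually fun t ht => (h t ht).eventually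

theorem differentiableAt_circleIntegral [CompleteSpace G] {F : E × ℂ → G} {x₀ : E} {c : ℂ}
    {r : ℝ} (hr : 0 ≤ r)
    (h : ∀ t ∈ sphere c r, HolAt F (x₀, t)) :
    DifferentiableAt ℂ (fun x => ∮ t in C(c, r), F (x, t)) x₀ := by
  have hsph : IsCompact (sphere c r) := isCompact_sphere c r
  have hm : ∀ θ, circleMap c r θ ∈ sphere c r := fun θ => circleMap_mem_sphere c hr θ
  let F' : E → ℝ → E →L[ℂ] G := fun x θ => deriv (circleMap c r) θ •
    (fderiv ℂ F (x, circleMap c r θ)).comp (ContinuousLinearMap.inl ℂ E ℂ)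
  have hcont : ∀ x, (∀ t ∈ sphere c r, HolAt F (x, t)) →
      Continuous fun θ => F (x, circleMap c r θ) := by
    intro x hx
    rw [continuous_iff_continuousAt]
    intro θ
    exact ContinuousAt.comp (f := fun θ => (x, circleMap c r θ)) (hx _ (hm θ)).continuousAt
      (by fun_prop)
  have hder : Continuous (deriv (circleMap c r)) := by
    have : deriv (circleMap c r) = fun θ => circleMap 0 r θ * Complex.I := by
      ext θ; simp
    rw [this]; fun_prop
  have hcont' : Continuous (F' x₀) := by
    rw [continuous_iff_continuousAt]
    intro θ
    refine hder.continuousAt.smul (ContinuousAt.clm_comp ?_ continuousAt_const)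
    exact ContinuousAt.comp (f := fun θ => (x₀, circleMap c r θ))
      (h _ (hm θ)).continuousAt_fderiv (by fun_prop)
  have hev := HolAt.eventually_forall_compact hsph h
  obtain ⟨C, hC⟩ : ∃ C, ∀ᶠ x in 𝓝 x₀, ∀ t ∈ sphere c r, ‖fderiv ℂ F (x, t)‖ < C := by
    obtain ⟨C, hC⟩ := hsph.exists_bound_of_continuousOn (f := fun t => fderiv ℂ F (x₀, t))
      (fun t ht => ContinuousAt.continuousWithinAt
        (ContinuousAt.comp (f := fun t => (x₀, t)) (h t ht).continuousAt_fderiv (by fun_prop)))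
    refine ⟨C + 1, hsph.eventually_forall_of_forall_eventually fun t ht => ?_⟩
    have := (h t ht).continuousAt_fderiv.norm
    exact this.eventually (gt_mem_nhds (lt_of_le_of_lt (hC t ht) (lt_add_one C)))
  have key := intervalIntegral.hasFDerivAt_integral_of_dominated_of_fderiv_le (𝕜 := ℂ)
    (μ := MeasureTheory.volume) (a := 0) (b := 2 * Real.pi) (x₀ := x₀)
    (s := {x | (∀ t ∈ sphere c r, HolAt F (x, t)) ∧ ∀ t ∈ sphere c r, ‖fderiv ℂ F (x, t)‖ < C})
    (F := fun x θ => deriv (circleMap c r) θ • F (x, circleMap c r θ)) (F' := F')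
    (bound := fun _ => |r| * (C * ‖ContinuousLinearMap.inl ℂ E ℂ‖)) (hev.and hC) ?_ ?_ ?_ ?_ ?_ ?_
  · exact key.differentiableAt
  · filter_upwards [hev] with x hx
    exact (hder.smul (hcont x hx)).aestronglyMeasurable
  · exact (hder.smul (hcont x₀ h)).intervalIntegrable _ _
  · exact hcont'.aestronglyMeasurable
  · refine Eventually.of_forall fun θ _ x hx => ?_
    rw [norm_smul]
    gcongr
    · simp
    · refine (ContinuousLinearMap.opNorm_comp_le _ _).trans ?_
      gcongr
      exact (hx.2 _ (hm θ)).le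
  · exact intervalIntegrable_const
  · refine Eventually.of_forall fun θ _ x hx => ?_
    have h1 := (hx.1 _ (hm θ)).differentiableAt.hasFDerivAt
    have h2 : HasFDerivAt (fun x : E => (x, circleMap c r θ)) (ContinuousLinearMap.inl ℂ E ℂ) x :=
      hasFDerivAt_prodMk_left x _
    exact (h1.comp x h2).const_smul _

theorem HolAt.circleIntegral [CompleteSpace G] {F : E × ℂ → G} {x₀ : E} {c : ℂ}
    {r : ℝ} (hr : 0 ≤ r)
    (h : ∀ t ∈ sphere c r, HolAt F (x₀, t)) :
    HolAt (fun x => ∮ t in C(c, r), F (x, t)) x₀ := by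
  filter_upwards [HolAt.eventually_forall_compact (isCompact_sphere c r) h] with x hx
  exact differentiableAt_circleIntegral hr hx

end ParametricCircleIntegral

section Lines

variable {E G : Type*} [NormedAddCommGroup E] [NormedSpace ℂ E]
  [NormedAddCommGroup G] [NormedSpace ℂ G]

theorem HolAt.analyticAt [CompleteSpace G] {f : ℂ → G} {z : ℂ} (h : HolAt f z) : AnalyticAt ℂ f z :=
  Complex.analyticAt_iff_eventually_differentiableAt.2 h

theorem HolAt.line {f : E → G} {x v : E} {s : ℂ} (h : HolAt f (x + s • v)) :
    HolAt (fun t : ℂ => f (x + t • v)) s :=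
  HolAt.comp (u := fun t : ℂ => x + t • v) h (.of_differentiable (by fun_prop))

theorem HolAt.fderiv_apply [CompleteSpace G] {f : E → G} {x : E} (h : HolAt f x) (v : E) :
    HolAt (fun y => fderiv ℂ f y v) x := by
  obtain ⟨r, hr, hball⟩ : ∃ r > 0, ∀ s ∈ closedBall (0 : ℂ) r, HolAt f (x + s • v) := by
    have : ∀ᶠ s in 𝓝 (0 : ℂ), HolAt f (x + s • v) := by
      have hc : ContinuousAt (fun s : ℂ => x + s • v) 0 := by fun_prop
      apply hc.eventually
      simpa using h.eventually
    exact Metric.nhds_basis_closedBall.eventually_iff.1 this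
  have hs : ∀ s ∈ sphere (0 : ℂ) r,
      HolAt (fun p : E × ℂ => (1 / (p.2 - 0) ^ 2) • f (p.1 + p.2 • v)) (x, s) := by
    intro s hs
    have h0 : s ≠ 0 := by
      rintro rfl
      simp at hs
      linarith
    have h1 : HolAt (fun p : E × ℂ => f (p.1 + p.2 • v)) (x, s) :=
      HolAt.comp (u := fun p : E × ℂ => p.1 + p.2 • v) (hball s (sphere_subset_closedBall hs))
        (.of_differentiable (by fun_prop))
    have h2 : ∀ᶠ p : E × ℂ in 𝓝 (x, s), p.2 ≠ 0 :=
      (continuousAt_snd (p := (x, s))).eventually_ne h0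
    filter_upwards [h1, h2] with p hp hp2
    refine DifferentiableAt.smul ?_ hp
    have : (p.2 - 0) ^ 2 ≠ 0 := by simpa using hp2
    fun_prop (disch := assumption)
  have h_int := HolAt.circleIntegral hr.le hs
  have hev : ∀ᶠ y in 𝓝 x, ∀ s ∈ closedBall (0 : ℂ) r, HolAt f (y + s • v) := by
    apply (isCompact_closedBall (0 : ℂ) r).eventually_forall_of_forall_eventually
    intro s hs
    have hc : ContinuousAt (fun p : E × ℂ => p.1 + p.2 • v) (x, s) := by fun_prop
    exact hc.eventually (hball s hs).eventually
  have hfin : HolAt (fun y => (2 * Real.pi * Complex.I : ℂ)⁻¹ •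
      ∮ s in C(0, r), (1 / (s - 0) ^ 2) • f (y + s • v)) x := by
    filter_upwards [h_int] with y hy using hy.const_smul _
  refine hfin.congr ?_
  filter_upwards [hev] with y hy
  have hd : DiffContOnCl ℂ (fun s : ℂ => f (y + s • v)) (ball 0 r) := by
    apply DifferentiableOn.diffContOnCl
    rw [closure_ball _ hr.ne']
    exact fun s hs => (hy s hs).line.differentiableAt.differentiableWithinAt
  have key := hd.deriv_eq_smul_circleIntegral hr
  rw [key, inv_smul_smul₀ Complex.two_pi_I_ne_zero]
  have h0 := (hy 0 (by simp [hr.le])).differentiableAt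
  have hl : HasDerivAt (fun s : ℂ => y + s • v) v 0 := by
    simpa using ((hasDerivAt_id (0 : ℂ)).smul_const v).const_add y
  have := h0.hasFDerivAt.comp_hasDerivAt (0 : ℂ) hl
  simp only [zero_smul, add_zero] at this
  exact this.deriv

theorem eq_zero_of_convex_of_eventuallyEq {f : E → ℂ} {U : Set E} {a : E}
    (hc : Convex ℝ U) (hf : ∀ x ∈ U, HolAt f x) (ha : a ∈ U) (h0 : ∀ᶠ x in 𝓝 a, f x = 0) :
    ∀ x ∈ U, f x = 0 := by
  intro b hb
  let S : Set ℂ := {s | a + s • (b - a) ∈ U}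
  have hS : Convex ℝ S := by
    intro s hs t ht p q hp hq hpq
    have := hc hs ht hp hq hpq
    simp only [S, mem_ofPred_eq]
    convert this using 1
    have hq' : q = 1 - p := by linarith
    subst hq'
    rw [smul_add, smul_add, add_smul, add_add_add_comm, ← add_smul p, smul_assoc, smul_assoc]
    simp
  have han : AnalyticOnNhd ℂ (fun s : ℂ => f (a + s • (b - a))) S :=
    fun s hs => (hf _ hs).line.analyticAt
  have hlim : ContinuousAt (fun s : ℂ => a + s • (b - a)) 0 := by fun_prop
  have hz : ∀ᶠ s : ℂ in 𝓝 0, f (a + s • (b - a)) = 0 := hlim.eventually (by simpa using h0)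
  have := han.eqOn_zero_of_preconnected_of_eventuallyEq_zero hS.isPreconnected
    (z₀ := 0) (by simpa [S] using ha) hz
  have h1 := this (show (1 : ℂ) ∈ S by simpa [S] using hb)
  simpa using h1

theorem HolAt.exists_ball {f : E → G} {a : E} (hf : HolAt f a) :
    ∃ r > 0, ∀ x ∈ ball a r, HolAt f x :=
  Metric.eventually_nhds_iff_ball.1 hf.eventually

theorem HolAt.eventually_frequently_ne {f : E → ℂ} {a : E} (hf : HolAt f a)
    (h : ∃ᶠ x in 𝓝 a, f x ≠ 0) : ∀ᶠ b in 𝓝 a, ∃ᶠ x in 𝓝 b, f x ≠ 0 := by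
  obtain ⟨r, hr, hball⟩ := hf.exists_ball
  filter_upwards [ball_mem_nhds a hr] with b hb hcon
  simp only [not_not] at hcon
  have := eq_zero_of_convex_of_eventuallyEq (convex_ball a r) hball hb hcon
  refine h ?_
  filter_upwards [ball_mem_nhds a hr] with x hx
  simpa using this x hx

theorem HolAt.frequently_mul_ne {f g : E → ℂ} {a : E} (hf : HolAt f a) (hg : HolAt g a)
    (hf0 : ∃ᶠ x in 𝓝 a, f x ≠ 0) (hg0 : ∃ᶠ x in 𝓝 a, g x ≠ 0) :
    ∃ᶠ x in 𝓝 a, f x * g x ≠ 0 := by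
  obtain ⟨b, hb0, hb, hb2⟩ := (hf0.and_eventually
    (hf.eventually.and (hg.eventually_frequently_ne hg0).eventually_nhds)).exists
  rw [Filter.frequently_iff]
  intro U hU
  obtain ⟨b, hb0, hb, hb2, hbU⟩ := (hf0.and_eventually
    (hf.eventually.and ((hg.eventually_frequently_ne hg0).and
      (eventually_mem_nhds_iff.2 hU)))).exists
  obtain ⟨x, hx, hx1, hx2⟩ := (hb2.and_eventually
    ((hb.continuousAt.eventually_ne hb0).and hbU)).exists
  exact ⟨x, hx2, mul_ne_zero hx1 hx⟩

theorem HolAt.frequently_prod_ne {ι : Type*} {s : Finset ι} {f : ι → E → ℂ} {a : E}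
    (hf : ∀ i ∈ s, HolAt (f i) a) (h0 : ∀ i ∈ s, ∃ᶠ x in 𝓝 a, f i x ≠ 0) :
    ∃ᶠ x in 𝓝 a, ∏ i ∈ s, f i x ≠ 0 := by
  classical
  induction s using Finset.induction_on with
  | empty => simp
  | insert i s hi ih =>
    simp only [Finset.prod_insert hi]
    exact HolAt.frequently_mul_ne (hf i (by simp))
      (HolAt.prod fun j hj => hf j (by simp [hj])) (h0 i (by simp))
      (ih (fun j hj => hf j (by simp [hj])) fun j hj => h0 j (by simp [hj]))

end Lines

section ArgumentPrinciple

theorem argument_principle_aux {c : ℂ} {r : ℝ} (hr : 0 < r) (s : Finset ℂ) :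
    ∀ φ : ℂ → ℂ, (∀ z ∈ closedBall c r, AnalyticAt ℂ φ z) → (∀ z ∈ sphere c r, φ z ≠ 0) →
      (∀ z ∈ closedBall c r, φ z = 0 → z ∈ s) →
      ∃ m : Multiset ℂ, (∀ a ∈ m, a ∈ ball c r) ∧ (∀ z ∈ closedBall c r, φ z = 0 ↔ z ∈ m) ∧
        ∀ g : ℂ → ℂ, (∀ z ∈ closedBall c r, AnalyticAt ℂ g z) →
          ∮ z in C(c, r), g z * (deriv φ z / φ z) = (2 * Real.pi * Complex.I) * (m.map g).sum := by
  classical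
  induction s using Finset.induction_on with
  | empty =>
    intro φ hφ _ hz
    refine ⟨0, by simp, by simpa using hz, fun g hg => ?_⟩
    have hd : ∀ z ∈ closedBall c r, AnalyticAt ℂ (fun z => g z * (deriv φ z / φ z)) z :=
      fun z hzz => (hg z hzz).mul ((hφ z hzz).deriv.div (hφ z hzz) fun h => by
        simpa using hz z hzz h)
    rw [Complex.circleIntegral_eq_zero_of_differentiable_on_off_countable hr.le countable_empty
      (fun z hz => (hd z hz).continuousAt.continuousWithinAt)
      (fun z hz => (hd z (ball_subset_closedBall hz.1)).differentiableAt)]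
    simp
  | insert a s ha ih =>
    intro φ hφ hsph hz
    by_cases hab : a ∈ ball c r; swap
    · refine ih φ hφ hsph fun z hzz h0 => ?_
      rcases Finset.mem_insert.1 (hz z hzz h0) with rfl | h
      · exact absurd h0 (hsph z (by
          simp only [mem_ball, not_lt, mem_closedBall, mem_sphere] at *
          exact le_antisymm hzz hab))
      · exact h
    have hacb := ball_subset_closedBall hab
    have hfin : analyticOrderAt φ a ≠ ⊤ := by
      intro htop
      rw [analyticOrderAt_eq_top] at htop
      have := AnalyticOnNhd.eqOn_zero_of_preconnected_of_eventuallyEq_zero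
        (U := closedBall c r) (f := φ) hφ (convex_closedBall c r).isPreconnected hacb htop
      have hmem : c + r ∈ sphere c r := by simp [hr.le]
      exact hsph _ hmem (this (sphere_subset_closedBall hmem))
    obtain ⟨n, hn⟩ := ENat.ne_top_iff_exists.1 hfin
    obtain ⟨g₀, hg₀, hg₀a, hev⟩ := (hφ a hacb).analyticOrderAt_eq_natCast.1 hn.symm
    set ψ : ℂ → ℂ := fun z => if z = a then g₀ a else φ z / (z - a) ^ n with hψ
    have hmul : ∀ z, φ z = (z - a) ^ n * ψ z := by
      intro z
      by_cases hza : z = a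
      · subst hza
        simpa [hψ] using hev.self_of_nhds
      · have : (z - a) ^ n ≠ 0 := pow_ne_zero _ (sub_ne_zero.2 hza)
        simp [hψ, hza, mul_div_cancel₀ _ this]
    have hψan : ∀ z ∈ closedBall c r, AnalyticAt ℂ ψ z := by
      intro z hzz
      by_cases hza : z = a
      · subst hza
        refine hg₀.congr ?_
        filter_upwards [hev] with w hw
        by_cases hwz : w = z
        · simp [hψ, hwz]
        · have : (w - z) ^ n ≠ 0 := pow_ne_zero _ (sub_ne_zero.2 hwz)
          simp [hψ, hwz, hw, mul_div_cancel_left₀ _ this]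
      · have h1 : AnalyticAt ℂ (fun z => φ z / (z - a) ^ n) z :=
          (hφ z hzz).div (by fun_prop) (pow_ne_zero _ (sub_ne_zero.2 hza))
        refine h1.congr ?_
        filter_upwards [isOpen_ne.mem_nhds hza] with w hw
        have hw' : w ≠ a := hw
        simp [hψ, hw']
    have hψs : ∀ z ∈ sphere c r, ψ z ≠ 0 := by
      intro z hzz h0
      exact hsph z hzz (by rw [hmul, h0, mul_zero])
    have hψz : ∀ z ∈ closedBall c r, ψ z = 0 → z ∈ s := by
      intro z hzz h0
      have h1 : φ z = 0 := by rw [hmul, h0, mul_zero]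
      rcases Finset.mem_insert.1 (hz z hzz h1) with rfl | h
      · simp [hψ, hg₀a] at h0
      · exact h
    obtain ⟨m, hm1, hm2, hm3⟩ := ih ψ hψan hψs hψz
    refine ⟨Multiset.replicate n a + m, ?_, ?_, ?_⟩
    · intro b hb
      rcases Multiset.mem_add.1 hb with h | h
      · rw [Multiset.eq_of_mem_replicate h]; exact hab
      · exact hm1 b h
    · intro z hzz
      rw [hmul, mul_eq_zero, hm2 z hzz, Multiset.mem_add, Multiset.mem_replicate, pow_eq_zero_iff',
        sub_eq_zero, and_comm]
    · intro g hg
      have hne : ∀ z ∈ sphere c r, z - a ≠ 0 := by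
        rintro z hzz h0
        rw [sub_eq_zero] at h0
        subst h0
        exact absurd (mem_sphere.1 hzz) (mem_ball.1 hab).ne
      have heq : EqOn (fun z => g z * (deriv φ z / φ z))
          (fun z => n * ((z - a)⁻¹ • g z) + g z * (deriv ψ z / ψ z)) (sphere c r) := by
        intro z hzz
        have h1 : φ = fun z => (z - a) ^ n * ψ z := funext hmul
        have h2 : logDeriv φ z = n * (z - a)⁻¹ + logDeriv ψ z := by
          rw [h1, logDeriv_mul (f := fun z => (z - a) ^ n) (g := ψ) z (pow_ne_zero _ (hne z hzz))
            (hψs z hzz) (by fun_prop)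
            (hψan z (sphere_subset_closedBall hzz)).differentiableAt,
            logDeriv_fun_pow (by fun_prop)]
          simp [logDeriv_apply]
        simp only [logDeriv_apply] at h2
        simp only [h2, smul_eq_mul]
        ring
      have hg' := fun z hz => hg z (sphere_subset_closedBall hz)
      have hi1 : ContinuousOn (fun z => (n : ℂ) * ((z - a)⁻¹ • g z)) (sphere c r) := by
        intro z hzz
        refine ContinuousAt.continuousWithinAt ?_
        have := (hg' z hzz).continuousAt
        have := hne z hzz
        fun_prop (disch := assumption)
      have hi2 : ContinuousOn (fun z => g z * (deriv ψ z / ψ z)) (sphere c r) := by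
        intro z hzz
        have hp := hψan z (sphere_subset_closedBall hzz)
        exact ((hg' z hzz).mul (hp.deriv.div hp (hψs z hzz))).continuousAt.continuousWithinAt
      rw [circleIntegral.integral_congr hr.le heq, circleIntegral.integral_add
        (hi1.circleIntegrable hr.le) (hi2.circleIntegrable hr.le), hm3 g hg,
        circleIntegral.integral_const_mul,
        Complex.circleIntegral_sub_inv_smul_of_differentiable_on_off_countable countable_empty hab
          (fun z hz => (hg z hz).continuousAt.continuousWithinAt)
          (fun z hz => (hg z (ball_subset_closedBall hz.1)).differentiableAt)]
      simp only [Multiset.map_add, Multiset.sum_add, Multiset.map_replicate, Multiset.sum_replicate,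
        nsmul_eq_mul, smul_eq_mul]
      ring

theorem argument_principle {c : ℂ} {r : ℝ} (hr : 0 < r) {φ : ℂ → ℂ}
    (hφ : ∀ z ∈ closedBall c r, AnalyticAt ℂ φ z) (hs : ∀ z ∈ sphere c r, φ z ≠ 0) :
    ∃ m : Multiset ℂ, (∀ a ∈ m, a ∈ ball c r) ∧ (∀ z ∈ closedBall c r, φ z = 0 ↔ z ∈ m) ∧
      ∀ g : ℂ → ℂ, (∀ z ∈ closedBall c r, AnalyticAt ℂ g z) →
        ∮ z in C(c, r), g z * (deriv φ z / φ z) = (2 * Real.pi * Complex.I) * (m.map g).sum := by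
  have hmem : c + r ∈ sphere c r := by simp [hr.le]
  have hfin : (closedBall c r ∩ {z | φ z = 0}).Finite := by
    by_contra hinf
    obtain ⟨x, hx, hacc⟩ := Set.Infinite.exists_accPt_of_subset_isCompact hinf
      (isCompact_closedBall c r) inter_subset_left
    have hfr : ∃ᶠ z in 𝓝[≠] x, φ z = 0 :=
      (accPt_iff_frequently_nhdsNE.1 hacc).mono fun z hz => hz.2
    exact hs _ hmem (AnalyticOnNhd.eqOn_zero_of_preconnected_of_frequently_eq_zero
      (U := closedBall c r) hφ (convex_closedBall c r).isPreconnected hx hfr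
        (sphere_subset_closedBall hmem))
  exact argument_principle_aux hr hfin.toFinset φ hφ hs fun z hz h0 => by simpa using ⟨hz, h0⟩

end ArgumentPrinciple

section Roots

variable {E : Type*} [NormedAddCommGroup E] [NormedSpace ℂ E]

/-- `a w` enumerates, with multiplicity, the zeros of `f₀ (w, ·)` in the closed disc; the power
sums over these zeros of holomorphic functions are holomorphic. -/
structure RootSystem (f₀ : E × ℂ → ℂ) (c : ℂ) (r : ℝ) (N : ℕ) (a : E → Fin N → ℂ) (w₀ : E) :
    Prop where
  mem_ball : ∀ i, a w₀ i ∈ ball c r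
  zero_iff : ∀ t ∈ closedBall c r, f₀ (w₀, t) = 0 ↔ ∃ i, a w₀ i = t
  holAt_sum : ∀ g : E × ℂ → ℂ, (∀ t ∈ closedBall c r, HolAt g (w₀, t)) →
    HolAt (fun w => ∑ i, g (w, a w i)) w₀

theorem exists_rootSystem {f₀ : E × ℂ → ℂ} {c : ℂ} {r : ℝ} (hr : 0 < r) {w₀ : E}
    (hf : ∀ t ∈ closedBall c r, HolAt f₀ (w₀, t)) (hs : ∀ t ∈ sphere c r, f₀ (w₀, t) ≠ 0) :
    ∃ (N : ℕ) (a : E → Fin N → ℂ), ∀ᶠ w in 𝓝 w₀, RootSystem f₀ c r N a w := by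
  have hev1 := HolAt.eventually_forall_compact (isCompact_closedBall c r) hf
  have hev2 : ∀ᶠ w in 𝓝 w₀, ∀ t ∈ sphere c r, f₀ (w, t) ≠ 0 :=
    (isCompact_sphere c r).eventually_forall_of_forall_eventually fun t ht =>
      (hf t (sphere_subset_closedBall ht)).continuousAt.eventually_ne (hs t ht)
  have hpt : ∀ w, (∀ t ∈ closedBall c r, HolAt f₀ (w, t)) → (∀ t ∈ sphere c r, f₀ (w, t) ≠ 0) →
      ∃ m : Multiset ℂ, (∀ a ∈ m, a ∈ ball c r) ∧
        (∀ z ∈ closedBall c r, f₀ (w, z) = 0 ↔ z ∈ m) ∧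
      ∀ g : ℂ → ℂ, (∀ z ∈ closedBall c r, AnalyticAt ℂ g z) →
        ∮ z in C(c, r), g z * (deriv (fun t => f₀ (w, t)) z / f₀ (w, z)) =
          (2 * Real.pi * Complex.I) * (m.map g).sum := fun w h1 h2 =>
    argument_principle hr (fun z hz => (h1 z hz).slice_right.analyticAt) h2
  have hder : ∀ w, ∀ t, HolAt f₀ (w, t) →
      deriv (fun t => f₀ (w, t)) t = fderiv ℂ f₀ (w, t) (0, 1) := by
    intro w t h
    have h1 : HasDerivAt (fun t : ℂ => (w, t)) ((0 : E), (1 : ℂ)) t :=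
      (hasDerivAt_const t w).prodMk (hasDerivAt_id t)
    exact (h.differentiableAt.hasFDerivAt.comp_hasDerivAt t h1).deriv
  have h_int : ∀ w, (∀ t ∈ closedBall c r, HolAt f₀ (w, t)) → (∀ t ∈ sphere c r, f₀ (w, t) ≠ 0) →
      ∀ g : E × ℂ → ℂ, (∀ t ∈ closedBall c r, HolAt g (w, t)) →
      HolAt (fun w => ∮ z in C(c, r), g (w, z) * (deriv (fun t => f₀ (w, t)) z / f₀ (w, z))) w := by
    intro w h1 h2 g hg
    have h3 : HolAt (fun w => ∮ z in C(c, r),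
        g (w, z) * (fderiv ℂ f₀ (w, z) (0, 1) * (f₀ (w, z))⁻¹)) w := by
      apply HolAt.circleIntegral (F := fun p => g p * (fderiv ℂ f₀ p (0, 1) * (f₀ p)⁻¹)) hr.le
      intro t ht
      have ht' := sphere_subset_closedBall ht
      exact (hg t ht').mul (((h1 t ht').fderiv_apply _).mul ((h1 t ht').inv (h2 t ht)))
    refine h3.congr ?_
    filter_upwards [HolAt.eventually_forall_compact (isCompact_closedBall c r) h1] with y hy
    refine circleIntegral.integral_congr hr.le fun t ht => ?_
    rw [hder y t (hy t (sphere_subset_closedBall ht)), div_eq_mul_inv]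
  classical
  choose! m hm1 hm2 hm3 using hpt
  set I := (2 * Real.pi * Complex.I : ℂ)
  have hI : I ≠ 0 := Complex.two_pi_I_ne_zero
  clear_value I
  have hcard : ∀ᶠ w in 𝓝 w₀, (m w).card = (m w₀).card := by
    have hN := h_int w₀ hf hs (fun _ => 1) (fun _ _ => HolAt.const 1)
    have hsum : ∀ w, (∀ t ∈ closedBall c r, HolAt f₀ (w, t)) → (∀ t ∈ sphere c r, f₀ (w, t) ≠ 0) →
        I⁻¹ * ∮ z in C(c, r), 1 * (deriv (fun t => f₀ (w, t)) z / f₀ (w, z)) = (m w).card := by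
      intro w h1 h2
      rw [hm3 w h1 h2 (fun _ => 1) (fun _ _ => analyticAt_const)]
      simp [hI]
    have hcont := ((HolAt.const I⁻¹).mul hN).continuousAt
    have h1 := hcont.eventually (ball_mem_nhds _ one_pos)
    filter_upwards [h1, hev1, hev2] with w hw h1 h2
    rw [hsum w h1 h2, hsum w₀ hf hs, dist_eq_norm] at hw
    by_contra hne
    have h3 : (1 : ℝ) ≤ ‖(((m w).card - (m w₀).card : ℤ) : ℂ)‖ := by
      rw [Complex.norm_intCast]
      have : (((m w).card : ℤ) - (m w₀).card) ≠ 0 := by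
        rw [sub_ne_zero]; exact_mod_cast hne
      exact_mod_cast Int.one_le_abs this
    push_cast at h3
    exact absurd hw (not_lt.2 h3)
  have hex : ∀ w, ∃ b : Fin (m w₀).card → ℂ, (m w).card = (m w₀).card →
      m w = Finset.univ.val.map b := by
    intro w
    by_cases h : (m w).card = (m w₀).card
    · have hl : (m w).toList.length = (m w₀).card := by simpa using h
      refine ⟨fun i => (m w).toList.get (i.cast hl.symm), fun _ => ?_⟩
      conv_lhs => rw [← Multiset.coe_toList (m w), ← List.ofFn_get (m w).toList]
      rw [Fin.univ_val_map]
      congr 1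
      exact List.ofFn_congr hl _
    · exact ⟨0, fun h' => absurd h' h⟩
  choose a ha using hex
  refine ⟨(m w₀).card, a, ?_⟩
  filter_upwards [hev1.eventually_nhds, hev2.eventually_nhds, hcard.eventually_nhds]
    with w h1 h2 h3
  have hw1 := h1.self_of_nhds
  have hw2 := h2.self_of_nhds
  have hmw := ha w h3.self_of_nhds
  refine ⟨fun i => hm1 w hw1 hw2 _ ?_, fun t ht => ?_, fun g hg => ?_⟩
  · rw [hmw]; simp
  · rw [hm2 w hw1 hw2 t ht, hmw]; simp
  · have h4 : HolAt (fun w => I⁻¹ * ∮ z in C(c, r),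
        g (w, z) * (deriv (fun t => f₀ (w, t)) z / f₀ (w, z))) w :=
      (HolAt.const _).mul (h_int w hw1 hw2 g hg)
    refine h4.congr ?_
    filter_upwards [h1, h2, h3, HolAt.eventually_forall_compact (isCompact_closedBall c r) hg]
      with y hy1 hy2 hy3 hyg
    rw [hm3 y hy1 hy2 (fun z => g (y, z)) fun z hz => (hyg z hz).slice_right.analyticAt,
      inv_mul_cancel_left₀ hI, ha y hy3, Multiset.map_map]
    rfl

theorem RootSystem.holAt_symmetric {f₀ : E × ℂ → ℂ} {c : ℂ} {r : ℝ} {N : ℕ} {a : E → Fin N → ℂ}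
    {w₀ : E} (h : RootSystem f₀ c r N a w₀) {g : E × ℂ → ℂ}
    (hg : ∀ t ∈ closedBall c r, HolAt g (w₀, t)) {P : MvPolynomial (Fin N) ℂ}
    (hP : P.IsSymmetric) :
    HolAt (fun w => MvPolynomial.eval (fun i => g (w, a w i)) P) w₀ := by
  classical
  have hpsum : ∀ k, HolAt (fun w => MvPolynomial.eval (fun i => g (w, a w i))
      (MvPolynomial.psum (Fin N) ℂ k)) w₀ := by
    intro k
    have := h.holAt_sum (fun p => g p ^ k) (fun t ht => (hg t ht).pow k)
    simpa [MvPolynomial.psum] using this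
  have hesymm : ∀ k, HolAt (fun w => MvPolynomial.eval (fun i => g (w, a w i))
      (MvPolynomial.esymm (Fin N) ℂ k)) w₀ := by
    intro k
    induction k using Nat.strong_induction_on with
    | _ k ih =>
      rcases Nat.eq_zero_or_pos k with rfl | hk
      · simpa using HolAt.const (1 : ℂ)
      · have hk' : (k : ℂ) ≠ 0 := by exact_mod_cast hk.ne'
        have hsum : HolAt (fun w => (k : ℂ)⁻¹ * ((-1) ^ (k + 1) *
            ∑ b ∈ Finset.HasAntidiagonal.antidiagonal k with b.1 < k, (-1) ^ b.1 *
              MvPolynomial.eval (fun i => g (w, a w i)) (MvPolynomial.esymm (Fin N) ℂ b.1) *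
              MvPolynomial.eval (fun i => g (w, a w i)) (MvPolynomial.psum (Fin N) ℂ b.2))) w₀ := by
          refine (HolAt.const _).mul ((HolAt.const _).mul (HolAt.sum fun b hb => ?_))
          exact ((HolAt.const _).mul (ih _ (Finset.mem_filter.1 hb).2)).mul (hpsum _)
        refine hsum.congr (Eventually.of_forall fun w => ?_)
        have := congrArg (MvPolynomial.eval (fun i => g (w, a w i)))
          (MvPolynomial.mul_esymm_eq_sum (Fin N) ℂ k)
        simp only [map_mul, map_natCast, map_pow, map_neg, map_one, map_sum] at this
        simp only
        rw [← this, inv_mul_cancel_left₀ hk']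
  obtain ⟨Q, hQ⟩ := MvPolynomial.esymmAlgHom_surjective (σ := Fin N) (n := N) ℂ (by simp)
    ⟨P, hP⟩
  have hQ' : P = MvPolynomial.aeval (fun i : Fin N => MvPolynomial.esymm (Fin N) ℂ (i + 1)) Q := by
    rw [← MvPolynomial.esymmAlgHom_apply, hQ]
  have hgen : ∀ Q : MvPolynomial (Fin N) ℂ,
      HolAt (fun w => MvPolynomial.eval (fun i => g (w, a w i))
      (MvPolynomial.aeval (fun i : Fin N => MvPolynomial.esymm (Fin N) ℂ (i + 1)) Q)) w₀ := by
    intro Q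
    induction Q using MvPolynomial.induction_on with
    | C z => simpa using HolAt.const z
    | add p q hp hq => simpa using hp.add hq
    | mul_X p i hp => simpa using hp.mul (hesymm (i + 1))
  rw [hQ']
  exact hgen Q

theorem RootSystem.holAt_prod {f₀ : E × ℂ → ℂ} {c : ℂ} {r : ℝ} {N : ℕ} {a : E → Fin N → ℂ}
    {w₀ : E} (h : RootSystem f₀ c r N a w₀) {g : E × ℂ → ℂ}
    (hg : ∀ t ∈ closedBall c r, HolAt g (w₀, t)) : HolAt (fun w => ∏ i, g (w, a w i)) w₀ := by
  have hP : (∏ i : Fin N, (MvPolynomial.X i : MvPolynomial (Fin N) ℂ)).IsSymmetric := by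
    intro e
    simp only [map_prod, MvPolynomial.rename_X]
    exact Equiv.prod_comp e fun i => (MvPolynomial.X i : MvPolynomial (Fin N) ℂ)
  simpa using h.holAt_symmetric hg hP

end Roots

theorem Submodule.exists_mem_forall_notMem {V ι : Type*} [AddCommGroup V] [Module ℂ V] [Finite ι]
    (I : Submodule ℂ V) (K : ι → Submodule ℂ V) (h : ∀ i, ∃ f ∈ I, f ∉ K i) :
    ∃ f ∈ I, ∀ i, f ∉ K i := by
  classical
  have := Fintype.ofFinite ι
  let s : Finset (Subspace ℂ I) := Finset.univ.image fun i => (K i).comap I.subtype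
  have hs : (⊤ : Subspace ℂ I) ∉ s := by
    simp only [s, Finset.mem_image, Finset.mem_univ, true_and, not_exists]
    intro i hi
    obtain ⟨f, hf, hfK⟩ := h i
    have : (⟨f, hf⟩ : I) ∈ (K i).comap I.subtype := by rw [hi]; trivial
    exact hfK this
  have := Subspace.biUnion_ne_univ_of_top_notMem hs
  rw [Set.ne_univ_iff_exists_notMem] at this
  obtain ⟨x, hx⟩ := this
  refine ⟨x, x.2, fun i hi => hx ?_⟩
  simp only [mem_iUnion]
  exact ⟨(K i).comap I.subtype, by simp [s], hi⟩

section Riemann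

variable {E : Type*} [NormedAddCommGroup E] [NormedSpace ℂ E]

/-- Near `w₀`, the set `S` is contained in the zero set of a holomorphic function which does not
vanish identically near `w₀`. -/
def ThinAt (S : Set E) (w₀ : E) : Prop :=
  ∃ γ : E → ℂ, HolAt γ w₀ ∧ (∃ᶠ w in 𝓝 w₀, γ w ≠ 0) ∧ ∀ᶠ w in 𝓝 w₀, w ∈ S → γ w = 0

theorem ThinAt.mono' {S T : Set E} {w₀ : E} (h : ThinAt T w₀) (hST : ∀ᶠ w in 𝓝 w₀, w ∈ S → w ∈ T) :
    ThinAt S w₀ := by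
  obtain ⟨γ, h1, h2, h3⟩ := h
  refine ⟨γ, h1, h2, ?_⟩
  filter_upwards [h3, hST] with w a b c using a (b c)

theorem ThinAt.iUnion {ι : Type*} [Finite ι] {S : ι → Set E} {w₀ : E}
    (h : ∀ i, ThinAt (S i) w₀) : ThinAt (⋃ i, S i) w₀ := by
  have := Fintype.ofFinite ι
  choose γ h1 h2 h3 using h
  refine ⟨fun w => ∏ i, γ i w, HolAt.prod fun i _ => h1 i,
    HolAt.frequently_prod_ne (fun i _ => h1 i) (fun i _ => h2 i), ?_⟩
  filter_upwards [eventually_all.2 h3] with w hw hwS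
  obtain ⟨i, hi⟩ := mem_iUnion.1 hwS
  exact Finset.prod_eq_zero (Finset.mem_univ i) (hw i hi)

theorem ThinAt.frequently_notMem {S : Set E} {w₀ : E} (h : ThinAt S w₀) : ∃ᶠ w in 𝓝 w₀, w ∉ S := by
  obtain ⟨γ, h1, h2, h3⟩ := h
  exact (h2.and_eventually h3).mono fun w hw hS => hw.1 (hw.2 hS)

theorem ThinAt.eventually {S : Set E} {w₀ : E} (h : ThinAt S w₀) : ∀ᶠ w in 𝓝 w₀, ThinAt S w := by
  obtain ⟨γ, h1, h2, h3⟩ := h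
  filter_upwards [h1.eventually, h1.eventually_frequently_ne h2, h3.eventually_nhds] with w a b c
  exact ⟨γ, a, b, c⟩

theorem ThinAt.fst {F : Type*} [NormedAddCommGroup F] [NormedSpace ℂ F] {S : Set E} {p : E × F}
    (h : ThinAt S p.1) : ThinAt (Prod.fst ⁻¹' S) p := by
  obtain ⟨γ, h1, h2, h3⟩ := h
  refine ⟨fun q => γ q.1, HolAt.comp (u := Prod.fst) h1 (.of_differentiable differentiable_fst), ?_,
    continuousAt_fst.eventually h3⟩
  have : Tendsto (fun w => (w, p.2)) (𝓝 p.1) (𝓝 p) := by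
    have : ContinuousAt (fun w => (w, p.2)) p.1 := by fun_prop
    exact this
  exact this.frequently h2

theorem removable_slice {g k : ℂ → ℂ} {r C : ℝ} (hr : 0 < r)
    (hk : ∀ s ∈ closedBall (0 : ℂ) r, HolAt k s) (hk0 : ∀ s ∈ sphere (0 : ℂ) r, k s ≠ 0)
    (hg : ∀ s ∈ closedBall (0 : ℂ) r, k s ≠ 0 → HolAt g s)
    (hC : ∀ s ∈ closedBall (0 : ℂ) r, k s ≠ 0 → ‖g s‖ ≤ C) (h0 : k 0 ≠ 0) :
    (2 * Real.pi * Complex.I : ℂ)⁻¹ * ∮ s in C(0, r), (s - 0)⁻¹ • g s = g 0 := by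
  set G : ℂ → ℂ := fun s => limUnder (𝓝[≠] s) g with hG
  have hGg : ∀ s ∈ closedBall (0 : ℂ) r, k s ≠ 0 → G s = g s := fun s hs hks =>
    ((hg s hs hks).continuousAt.tendsto.mono_left nhdsWithin_le_nhds).limUnder_eq
  have hisol : ∀ s ∈ closedBall (0 : ℂ) r, ∀ᶠ t in 𝓝[≠] s, k t ≠ 0 := by
    intro s hs
    by_contra hcon
    have := AnalyticOnNhd.eqOn_zero_of_preconnected_of_frequently_eq_zero
      (U := closedBall (0 : ℂ) r) (f := k) (fun s hs => (hk s hs).analyticAt)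
      (convex_closedBall _ _).isPreconnected hs
      ((not_eventually.1 hcon).mono fun _ h => not_not.1 h)
    exact h0 (this (by simp [hr.le]))
  have hGs : EqOn (fun s => (s - 0)⁻¹ • g s) (fun s => (s - 0)⁻¹ • G s) (sphere 0 r) := by
    intro s hs
    simp only [hGg s (sphere_subset_closedBall hs) (hk0 s hs)]
  have hsph : ∀ s ∈ sphere (0 : ℂ) r, ContinuousWithinAt G (closedBall 0 r) s := by
    intro s hs
    have hs' := sphere_subset_closedBall hs
    have hc : ContinuousWithinAt g (closedBall 0 r) s :=
      (hg s hs' (hk0 s hs)).continuousAt.continuousWithinAt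
    refine hc.congr_of_eventuallyEq ?_ (hGg s hs' (hk0 s hs))
    have := (hk s hs').continuousAt.eventually_ne (hk0 s hs)
    filter_upwards [self_mem_nhdsWithin, mem_nhdsWithin_of_mem_nhds this] with t ht hkt
    exact hGg t ht hkt
  have hball : ∀ s ∈ ball (0 : ℂ) r, DifferentiableAt ℂ G s := by
    intro s hs
    have h1 := eventually_nhdsWithin_iff.1 (hisol s (ball_subset_closedBall hs))
    obtain ⟨ε, hε, hεb⟩ := Metric.eventually_nhds_iff_ball.1
      (h1.and (isOpen_ball.mem_nhds hs))
    have hd : DifferentiableOn ℂ g (ball s ε \ {s}) := fun t ht =>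
      (hg t (ball_subset_closedBall (hεb t ht.1).2)
        ((hεb t ht.1).1 ht.2)).differentiableAt.differentiableWithinAt
    have hb : BddAbove (norm ∘ g '' (ball s ε \ {s})) := by
      refine ⟨C, ?_⟩
      rintro _ ⟨t, ht, rfl⟩
      exact hC t (ball_subset_closedBall (hεb t ht.1).2) ((hεb t ht.1).1 ht.2)
    have := Complex.differentiableOn_update_limUnder_of_bddAbove (ball_mem_nhds s hε) hd hb
    refine (this.differentiableAt (ball_mem_nhds s hε)).congr_of_eventuallyEq ?_
    filter_upwards [ball_mem_nhds s hε] with t ht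
    by_cases hts : t = s
    · subst hts; simp [hG]
    · rw [Function.update_of_ne hts]
      exact hGg t (ball_subset_closedBall (hεb t ht).2) ((hεb t ht).1 hts)
  rw [circleIntegral.integral_congr hr.le hGs,
    Complex.circleIntegral_sub_inv_smul_of_differentiable_on_off_countable countable_empty
      (mem_ball_self hr), smul_eq_mul, inv_mul_cancel_left₀ Complex.two_pi_I_ne_zero,
    hGg 0 (by simp [hr.le]) h0]
  · intro s hs
    rcases (mem_closedBall.1 hs).lt_or_eq with h | h
    · exact (hball s h).continuousAt.continuousWithinAt
    · exact hsph s h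
  · exact fun s hs => hball s hs.1

/-- **Riemann extension theorem**, with a neighborhood independent of the function. -/
theorem riemann_extension {S : Set E} {x₀ : E} (hS : ThinAt S x₀) {W₀ : Set E} (hW₀ : W₀ ∈ 𝓝 x₀) :
    ∃ W ⊆ W₀, IsOpen W ∧ x₀ ∈ W ∧ ∀ f : E → ℂ, (∀ x ∈ W₀, x ∉ S → HolAt f x) →
      (∃ C, ∀ x ∈ W₀, x ∉ S → ‖f x‖ ≤ C) →
      ∃ g : E → ℂ, (∀ x ∈ W, HolAt g x) ∧ ∀ x ∈ W, x ∉ S → g x = f x := by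
  obtain ⟨γ, hγ, hγ0, hγS⟩ := hS
  obtain ⟨R, hR, hball⟩ := Metric.eventually_nhds_iff_ball.1
    (hγ.eventually.and (hγS.and ((hγ.eventually_frequently_ne hγ0).and
      (eventually_mem_nhds_iff.2 hW₀))))
  have hRW : ball x₀ R ⊆ W₀ := fun x hx => mem_of_mem_nhds (hball x hx).2.2.2
  obtain ⟨x₁, hx₁, hx₁b⟩ := (hγ0.and_eventually (ball_mem_nhds x₀ hR)).exists
  set v := x₁ - x₀
  have hcont : Continuous fun p : E × ℂ => p.1 + p.2 • v := by fun_prop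
  let T : Set ℂ := {s | x₀ + s • v ∈ ball x₀ R}
  have hTball : T = (fun s => s • v) ⁻¹' ball 0 R := by
    ext s; simp [T, dist_eq_norm]
  have hT : Convex ℝ T := by
    have h1 : Convex ℝ (ball (0 : E) R) := convex_ball _ _
    rw [hTball]
    intro s hs t ht a b ha hb hab
    have := h1 hs ht ha hb hab
    simp only [mem_preimage, add_smul, smul_assoc] at this ⊢
    exact this
  have h0T : (0 : ℂ) ∈ T := by simp [T, hR]
  have h1T : (1 : ℂ) ∈ T := by simpa [T, v, dist_eq_norm] using hx₁b
  have hpunct : ∀ᶠ s : ℂ in 𝓝[≠] 0, γ (x₀ + s • v) ≠ 0 := by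
    by_contra hcon
    have := AnalyticOnNhd.eqOn_zero_of_preconnected_of_frequently_eq_zero
      (U := T) (f := fun s : ℂ => γ (x₀ + s • v)) (fun s hs => (hball _ hs).1.line.analyticAt)
      hT.isPreconnected h0T ((not_eventually.1 hcon).mono fun _ h => not_not.1 h)
    exact hx₁ (by simpa [v] using this h1T)
  have hTnhds : ∀ᶠ s : ℂ in 𝓝 0, s ∈ T := by
    have : IsOpen T := isOpen_ball.preimage (by fun_prop)
    exact this.mem_nhds h0T
  obtain ⟨r, hr, hrb⟩ := Metric.nhds_basis_closedBall.eventually_iff.1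
    ((eventually_nhdsWithin_iff.1 hpunct).and hTnhds)
  have hsphne : ∀ s ∈ sphere (0 : ℂ) r, s ≠ 0 := by
    rintro s hs rfl
    simp at hs
    linarith
  have hev1 : ∀ᶠ x in 𝓝 x₀, ∀ s ∈ sphere (0 : ℂ) r, γ (x + s • v) ≠ 0 := by
    refine (isCompact_sphere _ _).eventually_forall_of_forall_eventually fun s hs => ?_
    have h1 := hrb (sphere_subset_closedBall hs)
    have h2 : ContinuousAt (fun p : E × ℂ => γ (p.1 + p.2 • v)) (x₀, s) :=
      ContinuousAt.comp (f := fun p : E × ℂ => p.1 + p.2 • v) (hball _ h1.2).1.continuousAt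
        hcont.continuousAt
    exact h2.eventually_ne (h1.1 (hsphne s hs))
  have hev2 : ∀ᶠ x in 𝓝 x₀, ∀ s ∈ closedBall (0 : ℂ) r, x + s • v ∈ ball x₀ R := by
    refine (isCompact_closedBall _ _).eventually_forall_of_forall_eventually fun s hs => ?_
    exact hcont.continuousAt.eventually (isOpen_ball.mem_nhds (hrb hs).2)
  obtain ⟨ρ, hρ, hρb⟩ := Metric.eventually_nhds_iff_ball.1 (hev1.and hev2)
  have hWR : ball x₀ ρ ⊆ ball x₀ R := fun x hx => by
    simpa using (hρb x hx).2 0 (by simp [hr.le])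
  refine ⟨ball x₀ ρ, hWR.trans hRW, isOpen_ball, mem_ball_self hρ, ?_⟩
  rintro f hf ⟨C, hC⟩
  have hf' : ∀ x ∈ ball x₀ R, γ x ≠ 0 → HolAt f x := fun x hx hγx =>
    hf x (hRW hx) fun hxS => hγx ((hball x hx).2.1 hxS)
  set g : E → ℂ := fun x => (2 * Real.pi * Complex.I : ℂ)⁻¹ *
    ∮ s in C(0, r), (s - 0)⁻¹ • f (x + s • v) with hg
  have hghol : ∀ x ∈ ball x₀ ρ, HolAt g x := by
    intro x hx
    refine (HolAt.const _).mul (HolAt.circleIntegral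
      (F := fun p : E × ℂ => (p.2 - 0)⁻¹ • f (p.1 + p.2 • v)) hr.le fun s hs => ?_)
    have h1 : HolAt f (x + s • v) := hf' _ ((hρb x hx).2 s (sphere_subset_closedBall hs))
      ((hρb x hx).1 s hs)
    have h2 : HolAt (fun p : E × ℂ => p.2 - 0) (x, s) := .of_differentiable (by fun_prop)
    exact (h2.inv (by simpa using hsphne s hs)).mul
      (HolAt.comp (u := fun p : E × ℂ => p.1 + p.2 • v) h1 (.of_differentiable (by fun_prop)))
  have hgf : ∀ x ∈ ball x₀ ρ, γ x ≠ 0 → g x = f x := by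
    intro x hx hγx
    have := removable_slice (g := fun s => f (x + s • v)) (k := fun s => γ (x + s • v)) (C := C) hr
      (fun s hs => (hball _ ((hρb x hx).2 s hs)).1.line) (hρb x hx).1
      (fun s hs hks => (hf' _ ((hρb x hx).2 s hs) hks).line)
      (fun s hs hks => hC _ (hRW ((hρb x hx).2 s hs))
        fun hxS => hks ((hball _ ((hρb x hx).2 s hs)).2.1 hxS)) (by simpa using hγx)
    simpa [hg] using this
  refine ⟨g, hghol, fun x hx hxS => ?_⟩
  by_contra hne
  have hsub : HolAt (fun x => g x - f x) x := (hghol x hx).sub (hf x (hRW (hWR hx)) hxS)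
  have h1 := hsub.continuousAt.eventually_ne (sub_ne_zero.2 hne)
  obtain ⟨y, hy, hy1, hy2⟩ := ((hball x (hWR hx)).2.2.1.and_eventually
    (h1.and (isOpen_ball.mem_nhds hx))).exists
  exact hy1 (sub_eq_zero.2 (hgf y hy2 hy))

end Riemann

section LocallyAnalytic

variable {E E₁ : Type*} [NormedAddCommGroup E] [NormedSpace ℂ E]
  [NormedAddCommGroup E₁] [NormedSpace ℂ E₁]

/-- The space of functions holomorphic on `W` which vanish on `A ∩ W`. -/
def vanishingSpace (A W : Set E) : Submodule ℂ (E → ℂ) where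
  carrier := {f | (∀ x ∈ W, HolAt f x) ∧ ∀ x ∈ A ∩ W, f x = 0}
  add_mem' {f g} hf hg := ⟨fun x hx => (hf.1 x hx).add (hg.1 x hx), fun x hx => by
    simp [hf.2 x hx, hg.2 x hx]⟩
  zero_mem' := ⟨fun _ _ => HolAt.const 0, fun _ _ => rfl⟩
  smul_mem' c f hf := ⟨fun x hx => (HolAt.const c).mul (hf.1 x hx), fun x hx => by
    simp [hf.2 x hx]⟩

/-- `A` is, on some neighborhood of `a`, the set of common zeros of a family of holomorphic
functions. -/
def LocAnalyticAt (A : Set E) (a : E) : Prop :=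
  ∃ W : Set E, IsOpen W ∧ a ∈ W ∧ ∀ z ∈ W, z ∉ A → ∃ f ∈ vanishingSpace A W, f z ≠ 0

theorem vanishingSpace_anti {A A' W W' : Set E} (hW : W' ⊆ W) (hA : A' ∩ W' ⊆ A ) :
    vanishingSpace A W ≤ vanishingSpace A' W' := fun _ hf =>
  ⟨fun x hx => hf.1 x (hW hx), fun x hx => hf.2 x ⟨hA hx, hW hx.2⟩⟩

namespace LocAnalyticAt

variable {A B : Set E} {a : E}

theorem exists_subset (h : LocAnalyticAt A a) {U : Set E} (hU : U ∈ 𝓝 a) :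
    ∃ W ⊆ U, IsOpen W ∧ a ∈ W ∧ ∀ z ∈ W, z ∉ A → ∃ f ∈ vanishingSpace A W, f z ≠ 0 := by
  obtain ⟨W, hWo, haW, hW⟩ := h
  refine ⟨W ∩ interior U, inter_subset_right.trans interior_subset, hWo.inter isOpen_interior,
    ⟨haW, mem_interior_iff_mem_nhds.2 hU⟩, fun z hz hzA => ?_⟩
  obtain ⟨f, hf, hfz⟩ := hW z hz.1 hzA
  exact ⟨f, vanishingSpace_anti inter_subset_left inter_subset_left hf, hfz⟩

theorem exists_radius (h : LocAnalyticAt A a) : ∃ R > 0, ∀ r ≤ R, ∀ z ∈ ball a r, z ∉ A →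
    ∃ f ∈ vanishingSpace A (ball a r), f z ≠ 0 := by
  obtain ⟨W, hWo, haW, hW⟩ := h
  obtain ⟨R, hR, hRW⟩ := Metric.isOpen_iff.1 hWo a haW
  refine ⟨R, hR, fun r hr z hz hzA => ?_⟩
  have hsub := (ball_subset_ball hr).trans hRW
  obtain ⟨f, hf, hfz⟩ := hW z (hsub hz) hzA
  exact ⟨f, vanishingSpace_anti hsub inter_subset_left hf, hfz⟩

theorem eventually (h : LocAnalyticAt A a) : ∀ᶠ b in 𝓝 a, LocAnalyticAt A b := by
  obtain ⟨W, hWo, haW, hW⟩ := h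
  filter_upwards [hWo.mem_nhds haW] with b hb using ⟨W, hWo, hb, hW⟩

theorem congr (h : LocAnalyticAt A a) (hAB : ∀ᶠ x in 𝓝 a, x ∈ A ↔ x ∈ B) :
    LocAnalyticAt B a := by
  obtain ⟨W, hWU, hWo, haW, hW⟩ := h.exists_subset hAB
  refine ⟨W, hWo, haW, fun z hz hzB => ?_⟩
  obtain ⟨f, hf, hfz⟩ := hW z hz fun hzA => hzB ((hWU hz).1 hzA)
  exact ⟨f, vanishingSpace_anti subset_rfl (fun x hx => (hWU hx.2).2 hx.1) hf, hfz⟩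

theorem eventually_notMem (h : LocAnalyticAt A a) :
    ∀ᶠ z in 𝓝 a, z ∉ A → ∀ᶠ y in 𝓝 z, y ∉ A := by
  obtain ⟨W, hWo, haW, hW⟩ := h
  filter_upwards [hWo.mem_nhds haW] with z hz hzA
  obtain ⟨f, hf, hfz⟩ := hW z hz hzA
  filter_upwards [(hf.1 z hz).continuousAt.eventually_ne hfz, hWo.mem_nhds hz] with y hy hyW hyA
  exact hy (hf.2 y ⟨hyA, hyW⟩)

theorem mem_of_frequently (h : LocAnalyticAt A a) (hf : ∃ᶠ z in 𝓝 a, z ∈ A) : a ∈ A := by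
  by_contra ha
  exact hf (h.eventually_notMem.self_of_nhds ha)

theorem union (hA : LocAnalyticAt A a) (hB : LocAnalyticAt B a) : LocAnalyticAt (A ∪ B) a := by
  obtain ⟨V, hVo, haV, hV⟩ := hB
  obtain ⟨W, hWV, hWo, haW, hW⟩ := hA.exists_subset (hVo.mem_nhds haV)
  refine ⟨W, hWo, haW, fun z hz hzAB => ?_⟩
  rw [mem_union, not_or] at hzAB
  obtain ⟨f, hf, hfz⟩ := hW z hz hzAB.1
  obtain ⟨g, hg, hgz⟩ := hV z (hWV hz) hzAB.2
  refine ⟨fun x => f x * g x, ⟨fun x hx => (hf.1 x hx).mul (hg.1 x (hWV hx)), ?_⟩,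
    mul_ne_zero hfz hgz⟩
  rintro x ⟨hx | hx, hxW⟩
  · simp [hf.2 x ⟨hx, hxW⟩]
  · simp [hg.2 x ⟨hx, hWV hxW⟩]

theorem inter (hA : LocAnalyticAt A a) (hB : LocAnalyticAt B a) : LocAnalyticAt (A ∩ B) a := by
  obtain ⟨V, hVo, haV, hV⟩ := hB
  obtain ⟨W, hWV, hWo, haW, hW⟩ := hA.exists_subset (hVo.mem_nhds haV)
  refine ⟨W, hWo, haW, fun z hz hzAB => ?_⟩
  by_cases hzA : z ∈ A
  · obtain ⟨g, hg, hgz⟩ := hV z (hWV hz) fun hzB => hzAB ⟨hzA, hzB⟩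
    exact ⟨g, vanishingSpace_anti hWV (inter_subset_left.trans inter_subset_right) hg, hgz⟩
  · obtain ⟨f, hf, hfz⟩ := hW z hz hzA
    exact ⟨f, vanishingSpace_anti subset_rfl (inter_subset_left.trans inter_subset_left) hf, hfz⟩

theorem preimage {u : E₁ → E} {x : E₁} (hA : LocAnalyticAt A (u x)) (hu : HolAt u x) :
    LocAnalyticAt (u ⁻¹' A) x := by
  obtain ⟨W, hWo, haW, hW⟩ := hA
  obtain ⟨V, hV, hVo, hxV⟩ := _root_.eventually_nhds_iff.1
    (hu.eventually.and (hu.continuousAt.eventually (hWo.mem_nhds haW)))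
  refine ⟨V, hVo, hxV, fun z hz hzA => ?_⟩
  obtain ⟨f, hf, hfz⟩ := hW (u z) (hV z hz).2 hzA
  exact ⟨fun y => f (u y), ⟨fun y hy => (hf.1 _ (hV y hy).2).comp (hV y hy).1,
    fun y hy => hf.2 _ ⟨hy.1, (hV y hy.2).2⟩⟩, hfz⟩

theorem zeroSet {f : E → ℂ} (hf : HolAt f a) : LocAnalyticAt {x | f x = 0} a := by
  obtain ⟨W, hW, hWo, haW⟩ := _root_.eventually_nhds_iff.1 hf.eventually
  exact ⟨W, hWo, haW, fun z _ hz => ⟨f, ⟨hW, fun x hx => hx.1⟩, hz⟩⟩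

theorem of_eventually_notMem (h : ∀ᶠ x in 𝓝 a, x ∉ A) : LocAnalyticAt A a := by
  refine (zeroSet (f := fun _ : E => (1 : ℂ)) (HolAt.const 1)).congr ?_
  filter_upwards [h] with x hx
  simp [hx]

theorem of_eventually_mem (h : ∀ᶠ x in 𝓝 a, x ∈ A) : LocAnalyticAt A a := by
  refine (zeroSet (f := fun _ : E => (0 : ℂ)) (HolAt.const 0)).congr ?_
  filter_upwards [h] with x hx
  simp [hx]

theorem iInter {ι : Type*} [Finite ι] {A : ι → Set E} (h : ∀ i, LocAnalyticAt (A i) a) :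
    LocAnalyticAt (⋂ i, A i) a := by
  classical
  have := Fintype.ofFinite ι
  suffices ∀ s : Finset ι, LocAnalyticAt (⋂ i ∈ s, A i) a by
    simpa using this Finset.univ
  intro s
  induction s using Finset.induction_on with
  | empty => exact of_eventually_mem (by simp)
  | insert i s _ ih => simpa using (h i).inter ih

end LocAnalyticAt

theorem LocAnalyticAt.singleton_zero {ι : Type*} [Fintype ι] (x : ι → ℂ) :
    LocAnalyticAt ({0} : Set (ι → ℂ)) x := by
  have h : ∀ i : ι, LocAnalyticAt {y : ι → ℂ | y i = 0} x := fun i =>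
    .zeroSet (.of_differentiable (by fun_prop))
  refine (LocAnalyticAt.iInter h).congr (Eventually.of_forall fun y => ?_)
  simp [funext_iff]

end LocallyAnalytic

section FiniteProjection

variable {E F : Type*} [NormedAddCommGroup E] [NormedSpace ℂ E]
  [NormedAddCommGroup F] [NormedSpace ℂ F]

theorem eventually_nhds_fst {X Y : Type*} [TopologicalSpace X] [TopologicalSpace Y] {x : X} (y : Y)
    {P : X → Prop} (h : ∀ᶠ x' in 𝓝 x, P x') : ∀ᶠ p in 𝓝 (x, y), P p.1 :=
  (continuousAt_fst (p := (x, y))).eventually h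

/-- `Z` is locally analytic along the fibre over `w₀`, and bounded over a neighborhood of `w₀`. -/
structure ProperAt (Z : Set (E × F)) (w₀ : E) : Prop where
  locAnalyticAt : ∀ l, LocAnalyticAt Z (w₀, l)
  bounded : ∃ C : ℝ, ∀ᶠ w in 𝓝 w₀, ∀ l, (w, l) ∈ Z → ‖l‖ ≤ C

namespace ProperAt

variable {Z : Set (E × F)} {w₀ : E}

theorem eventually_fibre_subset [ProperSpace F] (h : ProperAt Z w₀) {U : Set F} (hU : IsOpen U)
    (hZU : ∀ l, (w₀, l) ∈ Z → l ∈ U) : ∀ᶠ w in 𝓝 w₀, ∀ l, (w, l) ∈ Z → l ∈ U := by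
  obtain ⟨C, hC⟩ := h.bounded
  have hK : IsCompact (closedBall (0 : F) C \ U) := (isCompact_closedBall 0 C).diff hU
  have := hK.eventually_forall_of_forall_eventually (x₀ := w₀) (P := fun w l => (w, l) ∉ Z)
    fun l hl => (h.locAnalyticAt l).eventually_notMem.self_of_nhds fun hlZ => hl.2 (hZU l hlZ)
  filter_upwards [this, hC] with w hw hwC l hl
  by_contra hlU
  exact hw l ⟨mem_closedBall_zero_iff.2 (hwC l hl), hlU⟩ hl

/-- The slices of the functions vanishing on `Z` isolate each point of a one-dimensional fibre. -/
theorem exists_slice_ne {Z : Set (E × ℂ)} (h : ProperAt Z w₀) (t₀ : ℂ) :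
    ∃ f : E × ℂ → ℂ, HolAt f (w₀, t₀) ∧ (∀ᶠ p in 𝓝 (w₀, t₀), p ∈ Z → f p = 0) ∧
      ∃ᶠ t in 𝓝 t₀, f (w₀, t) ≠ 0 := by
  set K : Set ℂ := {t | (w₀, t) ∈ Z} with hK
  have key : ∀ t, ∃ R > 0, (∀ s ∈ ball t R, K ∈ 𝓝 s) ∨
      ∃ f ∈ vanishingSpace Z (ball (w₀, t) R), ∀ s ∈ ball t R, ∃ᶠ s' in 𝓝 s, f (w₀, s') ≠ 0 := by
    intro t
    obtain ⟨R, hR, hRZ⟩ := (h.locAnalyticAt t).exists_radius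
    refine ⟨R, hR, ?_⟩
    have hmem : ∀ s ∈ ball t R, (w₀, s) ∈ ball (w₀, t) R := fun s hs => by
      rw [← ball_prod_same]
      exact ⟨mem_ball_self hR, hs⟩
    by_contra! hcon
    obtain ⟨⟨s, hs, hsK⟩, hf⟩ := hcon
    refine hsK (mem_of_superset (isOpen_ball.mem_nhds hs) fun s' hs' => ?_)
    by_contra hs'K
    obtain ⟨f, hfI, hfs⟩ := hRZ R le_rfl _ (hmem s' hs') hs'K
    obtain ⟨u, hu, hu0⟩ := hf f hfI
    exact hfs (eq_zero_of_convex_of_eventuallyEq (convex_ball t R)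
      (fun x hx => (hfI.1 _ (hmem x hx)).slice_right) hu hu0 s' hs')
  have hclopen : IsClopen {t | K ∈ 𝓝 t} := by
    refine ⟨⟨?_⟩, isOpen_iff_mem_nhds.2 fun t ht => eventually_mem_nhds_iff.2 ht⟩
    rw [Metric.isOpen_iff]
    intro t ht
    obtain ⟨R, hR, hc | ⟨f, hf, hfs⟩⟩ := key t
    · exact absurd (hc t (mem_ball_self hR)) ht
    · refine ⟨R, hR, fun s hs hsK => hfs s hs ?_⟩
      filter_upwards [hsK, isOpen_ball.mem_nhds hs] with x hx hxR hne
      refine hne (hf.2 _ ⟨hx, ?_⟩)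
      rw [← ball_prod_same]
      exact ⟨mem_ball_self hR, hxR⟩
  obtain ⟨R, hR, hc | ⟨f, hf, hfs⟩⟩ := key t₀
  · exfalso
    have huniv := hclopen.eq_univ ⟨t₀, hc t₀ (mem_ball_self hR)⟩
    obtain ⟨C, hC⟩ := h.bounded
    have h1 : ((|C| + 1 : ℝ) : ℂ) ∈ {t | K ∈ 𝓝 t} := huniv ▸ mem_univ _
    have h2 := hC.self_of_nhds _ (mem_of_mem_nhds (s := K) h1)
    rw [Complex.norm_real, Real.norm_of_nonneg (by positivity)] at h2
    linarith [le_abs_self C]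
  · refine ⟨f, hf.1 _ (mem_ball_self hR), ?_, hfs t₀ (mem_ball_self hR)⟩
    filter_upwards [isOpen_ball.mem_nhds (mem_ball_self hR)] with p hp hpZ using hf.2 p ⟨hpZ, hp⟩

theorem isClosed_fibre (h : ProperAt Z w₀) : IsClosed {l | (w₀, l) ∈ Z} := by
  refine ⟨isOpen_iff_mem_nhds.2 fun l hl => ?_⟩
  have : ContinuousAt (fun x : F => (w₀, x)) l := by fun_prop
  exact this.eventually ((h.locAnalyticAt l).eventually_notMem.self_of_nhds hl)

theorem isCompact_fibre [ProperSpace F] (h : ProperAt Z w₀) : IsCompact {l | (w₀, l) ∈ Z} := by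
  obtain ⟨C, hC⟩ := h.bounded
  exact (isCompact_closedBall (0 : F) C).of_isClosed_subset h.isClosed_fibre fun l hl =>
    mem_closedBall_zero_iff.2 (hC.self_of_nhds l hl)

theorem eventually_slice_ne {f : E × ℂ → ℂ} {t₀ : ℂ} (hf : HolAt f (w₀, t₀))
    (h : ∃ᶠ t in 𝓝 t₀, f (w₀, t) ≠ 0) : ∀ᶠ t in 𝓝[≠] t₀, f (w₀, t) ≠ 0 := by
  rcases hf.slice_right.analyticAt.eventually_eq_zero_or_eventually_ne_zero with h0 | h0
  · exact absurd h0 fun h0 => h (h0.mono fun _ h1 h2 => h2 h1)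
  · exact h0

theorem finite_fibre_one {Z : Set (E × ℂ)} (h : ProperAt Z w₀) : {t | (w₀, t) ∈ Z}.Finite := by
  refine h.isCompact_fibre.finite (isDiscrete_iff_forall_mem_exists_isOpen.2 fun t ht => ?_)
  obtain ⟨f, hf, hfZ, hf0⟩ := h.exists_slice_ne t
  have hc : ContinuousAt (fun x : ℂ => (w₀, x)) t := by fun_prop
  have h1 : ∀ᶠ s in 𝓝 t, s ≠ t → (w₀, s) ∉ Z := by
    have := eventually_nhdsWithin_iff.1 (eventually_slice_ne hf hf0)
    filter_upwards [this, hc.eventually hfZ] with s hs hsZ hst hsZ'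
    exact hs hst (hsZ hsZ')
  obtain ⟨V, hV, hVo, htV⟩ := _root_.eventually_nhds_iff.1 h1
  refine ⟨V, hVo, Set.ext fun s => ⟨fun hs => ?_, fun hs => ?_⟩⟩
  · by_contra hst
    exact hV s hs.1 hst hs.2
  · rw [mem_singleton_iff.1 hs]
    exact ⟨htV, ht⟩

end ProperAt

/-- Finite mapping theorem for a one-dimensional fibre. -/
theorem ProperAt.locAnalyticAt_image_one {Z : Set (E × ℂ)} {w₀ : E} (h : ProperAt Z w₀) :
    LocAnalyticAt (Prod.fst '' Z) w₀ := by
  classical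
  have : Fintype {t | (w₀, t) ∈ Z} := h.finite_fibre_one.fintype
  have key : ∀ t₀ : ℂ, ∃ R > 0, ∃ r > 0, r < R ∧ ∃ f₀ : E × ℂ → ℂ,
      (∀ z ∈ ball (w₀, t₀) R, z ∉ Z → ∃ f ∈ vanishingSpace Z (ball (w₀, t₀) R), f z ≠ 0) ∧
      f₀ ∈ vanishingSpace Z (ball (w₀, t₀) R) ∧ ∀ t ∈ sphere t₀ r, f₀ (w₀, t) ≠ 0 := by
    intro t₀
    obtain ⟨R₁, hR₁, hR₁Z⟩ := (h.locAnalyticAt t₀).exists_radius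
    obtain ⟨f, hf, hfZ, hf0⟩ := h.exists_slice_ne t₀
    obtain ⟨R₂, hR₂, hR₂f⟩ := Metric.eventually_nhds_iff_ball.1 (hf.eventually.and hfZ)
    obtain ⟨R₃, hR₃, hR₃f⟩ := Metric.eventually_nhds_iff_ball.1
      (eventually_nhdsWithin_iff.1 (ProperAt.eventually_slice_ne hf hf0))
    set R := min R₁ (min R₂ R₃) with hRdef
    have hR : 0 < R := by positivity
    have h1 : R ≤ R₁ := min_le_left _ _
    have h2 : R ≤ R₂ := (min_le_right _ _).trans (min_le_left _ _)
    have h3 : R ≤ R₃ := (min_le_right _ _).trans (min_le_right _ _)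
    refine ⟨R, hR, R / 2, by positivity, by linarith, f, hR₁Z R h1,
      ⟨fun x hx => (hR₂f x (ball_subset_ball h2 hx)).1,
        fun x hx => (hR₂f x (ball_subset_ball h2 hx.2)).2 hx.1⟩, fun t ht => hR₃f t ?_ ?_⟩
    · rw [mem_sphere] at ht
      rw [mem_ball, ht]
      linarith
    · rintro rfl
      simp at ht
      linarith
  choose R hR r hr hrR f₀ hsep hf₀ hsph using key
  have hslice : ∀ t₀, ∀ t ∈ closedBall t₀ (r t₀), ∀ f ∈ vanishingSpace Z (ball (w₀, t₀) (R t₀)),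
      ∀ w ∈ ball w₀ (R t₀), HolAt f (w, t) := fun t₀ t ht f hf w hw => by
    refine hf.1 _ ?_
    rw [← ball_prod_same]
    exact ⟨hw, closedBall_subset_ball (hrR t₀) ht⟩
  have hroot : ∀ t₀, _ := fun t₀ => exists_rootSystem (hr t₀)
    (fun t ht => hslice t₀ t ht (f₀ t₀) (hf₀ t₀) w₀ (mem_ball_self (hR t₀))) (hsph t₀)
  choose N a ha using hroot
  have hcov := h.eventually_fibre_subset (U := ⋃ t₀ : {t | (w₀, t) ∈ Z}, ball t₀.1 (r t₀.1))
    (isOpen_iUnion fun _ => isOpen_ball) fun l hl => mem_iUnion.2 ⟨⟨l, hl⟩, mem_ball_self (hr l)⟩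
  have hev := (eventually_all.2 fun t₀ : {t | (w₀, t) ∈ Z} =>
    (ha t₀.1).and (isOpen_ball.mem_nhds (mem_ball_self (hR t₀.1)))).and hcov
  obtain ⟨W, hW, hWo, hw₀⟩ := _root_.eventually_nhds_iff.1 hev
  refine ⟨W, hWo, hw₀, fun w₁ hw₁ hw₁Z => ?_⟩
  have hg : ∀ t₀ : {t | (w₀, t) ∈ Z}, ∃ f ∈ vanishingSpace Z (ball (w₀, t₀.1) (R t₀.1)),
      ∀ i, f (w₁, a t₀.1 w₁ i) ≠ 0 := by
    intro t₀
    obtain ⟨f, hf, hfK⟩ := Submodule.exists_mem_forall_notMem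
      (vanishingSpace Z (ball (w₀, t₀.1) (R t₀.1)))
      (fun i => LinearMap.ker (LinearMap.proj (R := ℂ) (φ := fun _ : E × ℂ => ℂ)
        (w₁, a t₀.1 w₁ i))) (fun i => by
        obtain ⟨f, hf, hfz⟩ := hsep t₀.1 (w₁, a t₀.1 w₁ i) (by
          rw [← ball_prod_same]
          exact ⟨((hW w₁ hw₁).1 t₀).2,
            ball_subset_ball (hrR _).le (((hW w₁ hw₁).1 t₀).1.mem_ball i)⟩)
          fun hz => hw₁Z ⟨_, hz, rfl⟩
        exact ⟨f, hf, by simpa using hfz⟩)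
    exact ⟨f, hf, fun i => by simpa using hfK i⟩
  choose g hgI hg0 using hg
  refine ⟨fun w => ∏ t₀ : {t | (w₀, t) ∈ Z}, ∏ i, g t₀ (w, a t₀.1 w i), ⟨fun w hw => ?_, ?_⟩,
    Finset.prod_ne_zero_iff.2 fun t₀ _ => Finset.prod_ne_zero_iff.2 fun i _ => hg0 t₀ i⟩
  · exact HolAt.prod fun t₀ _ => ((hW w hw).1 t₀).1.holAt_prod fun t ht =>
      hslice t₀.1 t ht (g t₀) (hgI t₀) w ((hW w hw).1 t₀).2
  · rintro _ ⟨⟨⟨w, l⟩, hlZ, rfl⟩, hw⟩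
    obtain ⟨t₀, hl⟩ := mem_iUnion.1 ((hW _ hw).2 l hlZ)
    have hmem : (w, l) ∈ ball (w₀, t₀.1) (R t₀.1) := by
      rw [← ball_prod_same]
      exact ⟨((hW _ hw).1 t₀).2, ball_subset_ball (hrR _).le hl⟩
    obtain ⟨i, hi⟩ := (((hW _ hw).1 t₀).1.zero_iff l (ball_subset_closedBall hl)).1
      ((hf₀ t₀.1).2 _ ⟨hlZ, hmem⟩)
    refine Finset.prod_eq_zero (Finset.mem_univ t₀) (Finset.prod_eq_zero (Finset.mem_univ i) ?_)
    dsimp only at hi ⊢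
    rw [hi]
    exact (hgI t₀).2 _ ⟨hlZ, hmem⟩

end FiniteProjection

section FiniteMapping

theorem HolAt.of_clm {E G : Type*} [NormedAddCommGroup E] [NormedSpace ℂ E] [NormedAddCommGroup G]
    [NormedSpace ℂ G] (L : E →L[ℂ] G) (x : E) : HolAt L x :=
  .of_differentiable L.differentiable

/-- **Finite mapping theorem**. -/
theorem ProperAt.locAnalyticAt_image {k : ℕ} : ∀ {E : Type*} [NormedAddCommGroup E]
    [NormedSpace ℂ E] {Z : Set (E × (Fin k → ℂ))} {w₀ : E}, ProperAt Z w₀ →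
    LocAnalyticAt (Prod.fst '' Z) w₀ := by
  induction k with
  | zero =>
    intro E _ _ Z w₀ h
    have h1 : LocAnalyticAt ((fun w : E => (w, (0 : Fin 0 → ℂ))) ⁻¹' Z) w₀ :=
      LocAnalyticAt.preimage (u := fun w : E => (w, (0 : Fin 0 → ℂ))) (h.locAnalyticAt 0)
        (.of_differentiable (by fun_prop))
    refine h1.congr (Eventually.of_forall fun w => ⟨fun hw => ⟨_, hw, rfl⟩, ?_⟩)
    rintro ⟨⟨w, l⟩, hl, rfl⟩
    rwa [Subsingleton.elim l 0] at hl
  | succ k ih =>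
    intro E _ _ Z w₀ h
    set u : (E × ℂ) × (Fin k → ℂ) → E × (Fin (k + 1) → ℂ) := fun p => (p.1.1, Fin.cons p.1.2 p.2)
      with hu
    have hud : Differentiable ℂ u := by
      refine Differentiable.prodMk (by fun_prop) (differentiable_pi.2 fun i => ?_)
      refine Fin.cases ?_ (fun i => ?_) i
      · simp only [Fin.cons_zero]; fun_prop
      · simp only [Fin.cons_succ]; fun_prop
    obtain ⟨C, hC⟩ := h.bounded
    have h1 : ∀ t, ProperAt (u ⁻¹' Z) (w₀, t) := fun t => by
      refine ⟨fun l => (h.locAnalyticAt _).preimage (u := u) (.of_differentiable hud), C, ?_⟩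
      filter_upwards [eventually_nhds_fst t hC] with p hp l hl
      refine le_trans ?_ (hp _ hl)
      refine (pi_norm_le_iff_of_nonneg (norm_nonneg _)).2 fun i => ?_
      exact norm_le_pi_norm (Fin.cons p.2 l : Fin (k + 1) → ℂ) i.succ
    have h2 : ProperAt (Prod.fst '' (u ⁻¹' Z)) w₀ := by
      refine ⟨fun t => ih (h1 t), C, ?_⟩
      filter_upwards [hC] with w hw t ht
      obtain ⟨⟨⟨w, t⟩, l⟩, hl, h3⟩ := ht
      obtain ⟨rfl, rfl⟩ := Prod.mk.inj h3
      exact (norm_le_pi_norm (Fin.cons t l : Fin (k + 1) → ℂ) 0).trans (hw _ hl)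
    refine h2.locAnalyticAt_image_one.congr (Eventually.of_forall fun w => ⟨?_, ?_⟩)
    · rintro ⟨_, ⟨⟨⟨w, t⟩, l⟩, hl, rfl⟩, rfl⟩
      exact ⟨_, hl, rfl⟩
    · rintro ⟨⟨w, l⟩, hl, rfl⟩
      refine ⟨(w, l 0), ⟨((w, l 0), Fin.tail l), ?_, rfl⟩, rfl⟩
      simpa [hu] using hl

variable {E : Type*} [NormedAddCommGroup E] [NormedSpace ℂ E] {k : ℕ}
  {Z : Set (E × (Fin k → ℂ))} {w₀ : E}

/-- The projection of `Z` to the coordinate `j` of the fibre. -/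
def coordImage (Z : Set (E × (Fin k → ℂ))) (j : Fin k) : Set (E × ℂ) :=
  (fun p => (p.1, p.2 j)) '' Z

theorem ProperAt.coordImage (h : ProperAt Z w₀) (j : Fin k) : ProperAt (coordImage Z j) w₀ := by
  obtain ⟨C, hC⟩ := h.bounded
  refine ⟨fun t => ?_, C, ?_⟩
  · have h1 : ProperAt {p : (E × ℂ) × (Fin k → ℂ) | (p.1.1, p.2) ∈ Z ∧ p.2 j - p.1.2 = 0}
        (w₀, t) := by
      refine ⟨fun l => LocAnalyticAt.inter ((h.locAnalyticAt l).preimage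
        (u := fun p : (E × ℂ) × (Fin k → ℂ) => (p.1.1, p.2)) (x := ((w₀, t), l))
        (.of_differentiable (by fun_prop))) (.zeroSet (.of_differentiable (by fun_prop))), C, ?_⟩
      filter_upwards [eventually_nhds_fst t hC] with p hp l hl using hp l hl.1
    refine h1.locAnalyticAt_image.congr (Eventually.of_forall fun q => ⟨?_, ?_⟩)
    · rintro ⟨⟨⟨w, s⟩, l⟩, ⟨hl, hs⟩, rfl⟩
      exact ⟨(w, l), hl, by rw [sub_eq_zero] at hs; simpa using hs⟩
    · rintro ⟨⟨w, l⟩, hl, rfl⟩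
      exact ⟨((w, l j), l), ⟨hl, sub_self _⟩, rfl⟩
  · filter_upwards [hC] with w hw t ht
    obtain ⟨⟨w, l⟩, hl, h3⟩ := ht
    obtain ⟨rfl, rfl⟩ := Prod.mk.inj h3
    exact (norm_le_pi_norm l j).trans (hw l hl)

theorem ProperAt.finite_fibre (h : ProperAt Z w₀) : {l | (w₀, l) ∈ Z}.Finite :=
  (Set.Finite.pi' fun j => (h.coordImage j).finite_fibre_one).subset fun _ hl _ => ⟨_, hl, rfl⟩

end FiniteMapping

section PartialDiscriminant

/-- The sum, over the sets of `d` indices, of the discriminants of the corresponding variables. -/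
noncomputable def partialDisc (N d : ℕ) : MvPolynomial (Fin N) ℂ :=
  ∑ S ∈ Finset.powersetCard d Finset.univ, ∏ p ∈ S.offDiag,
    (MvPolynomial.X p.1 - MvPolynomial.X p.2)

theorem partialDisc_isSymmetric (N d : ℕ) : (partialDisc N d).IsSymmetric := by
  intro e
  simp only [partialDisc, map_sum, map_prod, map_sub, MvPolynomial.rename_X]
  refine Finset.sum_equiv e.finsetCongr (by simp [Finset.mem_powersetCard]) fun S _ => ?_
  refine Finset.prod_equiv (e.prodCongr e) (fun p => ?_) fun p _ => rfl
  simp [Finset.mem_offDiag]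

theorem eval_partialDisc (N d : ℕ) (a : Fin N → ℂ) :
    MvPolynomial.eval a (partialDisc N d) =
      ∑ S ∈ Finset.powersetCard d Finset.univ, ∏ p ∈ S.offDiag, (a p.1 - a p.2) := by
  simp [partialDisc]

theorem card_image_ge_of_eval_partialDisc_ne {N d : ℕ} {a : Fin N → ℂ}
    (h : MvPolynomial.eval a (partialDisc N d) ≠ 0) : d ≤ (Finset.univ.image a).card := by
  rw [eval_partialDisc] at h
  obtain ⟨S, hS, hS0⟩ := Finset.exists_ne_zero_of_sum_ne_zero h
  rw [Finset.prod_ne_zero_iff] at hS0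
  have hinj : Set.InjOn a S := fun i hi j hj hij => by
    by_contra hne
    exact hS0 (i, j) (Finset.mem_offDiag.2 ⟨hi, hj, hne⟩) (sub_eq_zero.2 hij)
  rw [← (Finset.mem_powersetCard.1 hS).2, ← Finset.card_image_of_injOn hinj]
  exact Finset.card_le_card (Finset.image_subset_image (Finset.subset_univ S))

theorem eval_partialDisc_card_ne {N : ℕ} (a : Fin N → ℂ) :
    MvPolynomial.eval a (partialDisc N (Finset.univ.image a).card) ≠ 0 := by
  classical
  set T := Finset.univ.image a with hT
  have hterm : ∀ S ∈ Finset.powersetCard T.card (Finset.univ : Finset (Fin N)),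
      ∏ p ∈ S.offDiag, (a p.1 - a p.2) =
        if Set.InjOn a S then ∏ p ∈ T.offDiag, (p.1 - p.2) else 0 := by
    intro S hS
    split_ifs with hinj
    · have himg : S.image a = T := Finset.eq_of_subset_of_card_le
        (Finset.image_subset_image (Finset.subset_univ S)) (by
          rw [Finset.card_image_of_injOn hinj, (Finset.mem_powersetCard.1 hS).2])
      rw [← himg]
      refine Finset.prod_bij (fun p _ => (a p.1, a p.2)) ?_ ?_ ?_ ?_
      · intro p hp
        rw [Finset.mem_offDiag] at hp ⊢
        exact ⟨Finset.mem_image_of_mem a hp.1, Finset.mem_image_of_mem a hp.2.1,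
          fun h => hp.2.2 (hinj hp.1 hp.2.1 h)⟩
      · intro p hp q hq hpq
        rw [Finset.mem_offDiag] at hp hq
        exact Prod.ext (hinj hp.1 hq.1 (Prod.mk.inj hpq).1) (hinj hp.2.1 hq.2.1 (Prod.mk.inj hpq).2)
      · rintro ⟨x, y⟩ hxy
        rw [Finset.mem_offDiag] at hxy
        obtain ⟨i, hi, rfl⟩ := Finset.mem_image.1 hxy.1
        obtain ⟨j, hj, rfl⟩ := Finset.mem_image.1 hxy.2.1
        exact ⟨(i, j), Finset.mem_offDiag.2 ⟨hi, hj, fun h => hxy.2.2 (congrArg a h)⟩, rfl⟩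
      · intro p _
        rfl
    · simp only [Set.InjOn, not_forall] at hinj
      obtain ⟨i, hi, j, hj, hij, hne⟩ := hinj
      exact Finset.prod_eq_zero (i := (i, j)) (Finset.mem_offDiag.2 ⟨hi, hj, hne⟩)
        (sub_eq_zero.2 hij)
  rw [eval_partialDisc, Finset.sum_congr rfl hterm, ← Finset.sum_filter, Finset.sum_const,
    nsmul_eq_mul]
  obtain ⟨S, hSinj, hS⟩ : ∃ S : Finset (Fin N), Set.InjOn a S ∧ S.image a = T := by
    obtain ⟨S, _, h1, h2⟩ := Finset.exists_subset_injOn_image_eq_of_surjOn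
      (Finset.univ : Finset (Fin N)) T (f := a) (by intro x hx; simpa [hT] using hx)
    exact ⟨S, h1, h2⟩
  refine mul_ne_zero (Nat.cast_ne_zero.2 (Finset.card_pos.2 ⟨S, ?_⟩).ne')
    (Finset.prod_ne_zero_iff.2 fun p hp => sub_ne_zero.2 (Finset.mem_offDiag.1 hp).2.2)
  rw [Finset.mem_filter, Finset.mem_powersetCard]
  exact ⟨⟨Finset.subset_univ _, by rw [← hS, Finset.card_image_of_injOn hSinj]⟩, hSinj⟩

end PartialDiscriminant

section Sheets

variable {E F : Type*} [NormedAddCommGroup E] [NormedSpace ℂ E]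
  [NormedAddCommGroup F] [NormedSpace ℂ F]

theorem LocAnalyticAt.eventually_mem_or_thinAt {A : Set E} {a : E} (h : LocAnalyticAt A a) :
    (∀ᶠ x in 𝓝 a, x ∈ A) ∨ ThinAt A a := by
  obtain ⟨R, hR, hRA⟩ := h.exists_radius
  by_cases hcon : ∀ x ∈ ball a R, x ∈ A
  · exact .inl (mem_of_superset (ball_mem_nhds a hR) hcon)
  · push Not at hcon
    obtain ⟨z, hz, hzA⟩ := hcon
    obtain ⟨f, hf, hfz⟩ := hRA R le_rfl z hz hzA
    refine .inr ⟨f, hf.1 a (mem_ball_self hR), fun h0 => hfz ?_, ?_⟩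
    · exact eq_zero_of_convex_of_eventuallyEq (convex_ball a R) hf.1 (mem_ball_self hR)
        (h0.mono fun _ h => not_not.1 h) z hz
    · filter_upwards [ball_mem_nhds a hR] with x hx hxA using hf.2 x ⟨hxA, hx⟩

/-- Near `w₀`, the set `Y` is a finite disjoint union of graphs of holomorphic functions `s i`. -/
structure IsSheets {ι : Type*} (s : ι → E → F) (Y : Set (E × F)) (w₀ : E) : Prop where
  holAt : ∀ i, HolAt (s i) w₀
  injective : ∀ᶠ w in 𝓝 w₀, Function.Injective fun i => s i w
  mem_iff : ∀ᶠ w in 𝓝 w₀, ∀ l, (w, l) ∈ Y ↔ ∃ i, s i w = l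

/-- Near `w₀`, the set `Y` is a finite disjoint union of graphs of holomorphic functions. -/
def SheetedAt (Y : Set (E × F)) (w₀ : E) : Prop :=
  ∃ (ι : Type) (_ : Finite ι) (s : ι → E → F), IsSheets s Y w₀

namespace IsSheets

variable {ι : Type*} {s : ι → E → F} {Y : Set (E × F)} {w₀ : E}

theorem eventually [Finite ι] (h : IsSheets s Y w₀) : ∀ᶠ w in 𝓝 w₀, IsSheets s Y w := by
  filter_upwards [eventually_all.2 fun i => (h.holAt i).eventually, h.injective.eventually_nhds,
    h.mem_iff.eventually_nhds] with w h1 h2 h3 using ⟨h1, h2, h3⟩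

theorem sheetedAt [Finite ι] (h : IsSheets s Y w₀) : SheetedAt Y w₀ := by
  obtain ⟨n, ⟨e⟩⟩ := Finite.exists_equiv_fin ι
  refine ⟨Fin n, inferInstance, fun i => s (e.symm i), fun i => h.holAt _, ?_, ?_⟩
  · filter_upwards [h.injective] with w hw using hw.comp e.symm.injective
  · filter_upwards [h.mem_iff] with w hw l
    rw [hw, e.symm.surjective.exists]

theorem fibre_eq (h : IsSheets s Y w₀) : {l | (w₀, l) ∈ Y} = range fun i => s i w₀ :=
  Set.ext fun l => h.mem_iff.self_of_nhds l

theorem congr {Y' : Set (E × F)} (h : IsSheets s Y w₀)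
    (hY : ∀ᶠ w in 𝓝 w₀, ∀ l, (w, l) ∈ Y ↔ (w, l) ∈ Y') : IsSheets s Y' w₀ := by
  refine ⟨h.holAt, h.injective, ?_⟩
  filter_upwards [h.mem_iff, hY] with w hw hwY l
  rw [← hwY, hw]

theorem holAt_finprod [Finite ι] (h : IsSheets s Y w₀) {g : E × F → ℂ}
    (hg : ∀ l, (w₀, l) ∈ Y → HolAt g (w₀, l)) :
    HolAt (fun w => ∏ᶠ l ∈ {l | (w, l) ∈ Y}, g (w, l)) w₀ := by
  have := Fintype.ofFinite ι
  have h1 : HolAt (fun w => ∏ i, g (w, s i w)) w₀ := HolAt.prod fun i _ =>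
    HolAt.comp (u := fun w => (w, s i w)) (hg _ ((h.mem_iff.self_of_nhds _).2 ⟨i, rfl⟩))
      ((HolAt.of_differentiable differentiable_id).prodMk (h.holAt i))
  refine h1.congr ?_
  filter_upwards [h.eventually, h.injective] with w hw hwi
  exact ((finprod_mem_congr (g := fun l => g (w, l)) hw.fibre_eq fun _ _ => rfl).trans
    ((finprod_mem_range hwi).trans (finprod_eq_prod_of_fintype _))).symm

/-- A subset of `Y` containing locally at each point all or nothing of it is sheeted. -/
theorem subset (h : IsSheets s Y w₀) {Y' : Set (E × F)} (hYR : Y' ⊆ Y)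
    (hY : ∀ᶠ w in 𝓝 w₀, ∀ i, (w, s i w) ∈ Y' ↔ (w₀, s i w₀) ∈ Y') :
    IsSheets (fun i : {i // (w₀, s i w₀) ∈ Y'} => s i.1) Y' w₀ := by
  refine ⟨fun i => h.holAt _, ?_, ?_⟩
  · filter_upwards [h.injective] with w hw using hw.comp Subtype.val_injective
  · filter_upwards [h.mem_iff, hY] with w hw hwY l
    refine ⟨fun hl => ?_, ?_⟩
    · obtain ⟨i, rfl⟩ := (hw l).1 (hYR hl)
      exact ⟨⟨i, (hwY i).1 hl⟩, rfl⟩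
    · rintro ⟨⟨i, hi⟩, rfl⟩
      exact (hwY i).2 hi

end IsSheets

/-- The points of `R` near which `R` is contained in `Q`. -/
def relInterior {X : Type*} [TopologicalSpace X] (R Q : Set X) : Set X :=
  {p | p ∈ R ∧ ∀ᶠ q in 𝓝 p, q ∈ R → q ∈ Q}

theorem relInterior_subset {X : Type*} [TopologicalSpace X] (R Q : Set X) : relInterior R Q ⊆ Q :=
  fun _ hp => hp.2.self_of_nhds hp.1

namespace IsSheets

variable {ι : Type*} [Finite ι] {s : ι → E → F} {R Q Y : Set (E × F)} {w₀ : E}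

theorem eventually_eq (h : IsSheets s R w₀) (i : ι) :
    ∀ᶠ p in 𝓝 (w₀, s i w₀), p ∈ R → s i p.1 = p.2 := by
  have h1 := eventually_nhds_fst (s i w₀) h.mem_iff
  have h2 : ∀ᶠ p in 𝓝 (w₀, s i w₀), ∀ j, j ≠ i → s j p.1 ≠ p.2 := by
    refine eventually_all.2 fun j => ?_
    by_cases hji : j = i
    · simp [hji]
    · have hc1 : ContinuousAt (fun p : E × F => s j p.1) (w₀, s i w₀) :=
        (h.holAt j).continuousAt.comp_of_eq continuousAt_fst rfl
      filter_upwards [(hc1.ne_iff_eventually_ne continuousAt_snd).1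
        fun h1 => hji (h.injective.self_of_nhds h1)] with p hp _ using hp
  filter_upwards [h1, h2] with p hp1 hp2 hpR
  obtain ⟨j, hj⟩ := (hp1 p.2).1 hpR
  by_cases hji : j = i
  · rwa [← hji]
  · exact absurd hj (hp2 j hji)

theorem mem_relInterior_iff (h : IsSheets s R w₀) (i : ι) :
    (w₀, s i w₀) ∈ relInterior R Q ↔ ∀ᶠ w in 𝓝 w₀, (w, s i w) ∈ Q := by
  have hc : ContinuousAt (fun w => (w, s i w)) w₀ :=
    continuousAt_id.prodMk (h.holAt i).continuousAt
  have hmem : ∀ᶠ w in 𝓝 w₀, (w, s i w) ∈ R := by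
    filter_upwards [h.mem_iff] with w hw using (hw _).2 ⟨i, rfl⟩
  refine ⟨fun hp => ?_, fun hQ => ⟨hmem.self_of_nhds, ?_⟩⟩
  · filter_upwards [hc.eventually hp.2, hmem] with w h1 h2 using h1 h2
  · filter_upwards [eventually_nhds_fst _ hQ, h.eventually_eq i] with p hp1 hp2 hpR
    have := hp2 hpR
    rw [this] at hp1
    exact hp1

theorem thinAt_sheet (h : IsSheets s R w₀) (i : ι) (hQ : LocAnalyticAt Q (w₀, s i w₀))
    (hi : (w₀, s i w₀) ∉ relInterior R Q) : ThinAt {w | (w, s i w) ∈ Q} w₀ := by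
  have h1 : LocAnalyticAt ((fun w => (w, s i w)) ⁻¹' Q) w₀ := LocAnalyticAt.preimage
    (u := fun w => (w, s i w)) hQ
    ((HolAt.of_differentiable differentiable_id).prodMk (h.holAt i))
  exact h1.eventually_mem_or_thinAt.resolve_left fun h2 => hi ((h.mem_relInterior_iff i).2 h2)

theorem eventually_mem_relInterior_iff (h : IsSheets s R w₀)
    (hQ : ∀ i, LocAnalyticAt Q (w₀, s i w₀)) :
    ∀ᶠ w in 𝓝 w₀, ∀ i, (w, s i w) ∈ relInterior R Q ↔ (w₀, s i w₀) ∈ relInterior R Q := by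
  refine eventually_all.2 fun i => ?_
  by_cases hi : (w₀, s i w₀) ∈ relInterior R Q
  · filter_upwards [h.eventually, ((h.mem_relInterior_iff i).1 hi).eventually_nhds] with w h1 h2
    exact iff_of_true ((h1.mem_relInterior_iff i).2 h2) hi
  · filter_upwards [h.eventually, (h.thinAt_sheet i (hQ i) hi).eventually] with w h1 h2
    refine iff_of_false (fun h3 => ?_) hi
    exact h2.frequently_notMem (((h1.mem_relInterior_iff i).1 h3).mono fun _ h4 h5 => h5 h4)

end IsSheets

theorem SheetedAt.eventually {Y : Set (E × F)} {w₀ : E} (h : SheetedAt Y w₀) :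
    ∀ᶠ w in 𝓝 w₀, SheetedAt Y w := by
  obtain ⟨ι, _, s, hs⟩ := h
  exact hs.eventually.mono fun w hw => hw.sheetedAt

theorem SheetedAt.congr {Y Y' : Set (E × F)} {w₀ : E} (h : SheetedAt Y w₀)
    (hY : ∀ᶠ w in 𝓝 w₀, ∀ l, (w, l) ∈ Y ↔ (w, l) ∈ Y') : SheetedAt Y' w₀ := by
  obtain ⟨ι, _, s, hs⟩ := h
  exact (hs.congr hY).sheetedAt

theorem SheetedAt.finite_fibre {Y : Set (E × F)} {w₀ : E} (h : SheetedAt Y w₀) :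
    {l | (w₀, l) ∈ Y}.Finite := by
  obtain ⟨ι, _, s, hs⟩ := h
  rw [hs.fibre_eq]
  exact finite_range _

theorem SheetedAt.iUnion {κ : Type*} [Finite κ] {Y : κ → Set (E × F)} {w₀ : E}
    (h : ∀ k, SheetedAt (Y k) w₀)
    (hd : ∀ᶠ w in 𝓝 w₀, ∀ j k l, (w, l) ∈ Y j → (w, l) ∈ Y k → j = k) :
    SheetedAt (⋃ k, Y k) w₀ := by
  choose ι _ s hs using h
  refine IsSheets.sheetedAt (ι := Σ k, ι k) (s := fun i => s i.1 i.2)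
    ⟨fun i => (hs _).holAt _, ?_, ?_⟩
  · filter_upwards [eventually_all.2 fun k => (hs k).mem_iff,
      eventually_all.2 fun k => (hs k).injective, hd] with w hw hi hdw
    rintro ⟨j, i⟩ ⟨j', i'⟩ hii
    obtain rfl := hdw j j' _ ((hw j _).2 ⟨i, rfl⟩) ((hw j' _).2 ⟨i', hii.symm⟩)
    obtain rfl := hi j hii
    rfl
  · filter_upwards [eventually_all.2 fun k => (hs k).mem_iff] with w hw l
    simp [hw]

theorem SheetedAt.pi {k : ℕ} {R : Fin k → Set (E × ℂ)} {w₀ : E} (h : ∀ j, SheetedAt (R j) w₀) :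
    SheetedAt {p : E × (Fin k → ℂ) | ∀ j, (p.1, p.2 j) ∈ R j} w₀ := by
  choose ι _ s hs using h
  refine IsSheets.sheetedAt (ι := ∀ j, ι j) (s := fun i w j => s j (i j) w)
    ⟨fun i => HolAt.pi fun j => (hs j).holAt _, ?_, ?_⟩
  · filter_upwards [eventually_all.2 fun k => (hs k).injective] with w hw i i' hii
    funext j
    exact hw j (congrFun hii j)
  · filter_upwards [eventually_all.2 fun k => (hs k).mem_iff] with w hw l
    simp only [hw, Classical.skolem]
    exact exists_congr fun i => funext_iff.symm

end Sheets

section Roots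

variable {E : Type*} [NormedAddCommGroup E] [NormedSpace ℂ E]

theorem Finset.exists_radius_separated (B : Finset ℂ) {U : Set ℂ} (hU : IsOpen U)
    (hB : ∀ b ∈ B, b ∈ U) : ∃ ρ > 0, (∀ b ∈ B, closedBall b ρ ⊆ U) ∧
      ∀ b ∈ B, ∀ b' ∈ B, ∀ t, t ∈ closedBall b ρ → t ∈ closedBall b' ρ → b = b' := by
  have h1 : ∀ b ∈ B, ∀ᶠ ρ in 𝓝[>] (0 : ℝ), closedBall b ρ ⊆ U := fun b hb => by
    obtain ⟨ε, hε, h⟩ := Metric.isOpen_iff.1 hU b (hB b hb)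
    filter_upwards [Ioo_mem_nhdsGT hε] with ρ hρ
    exact (closedBall_subset_ball hρ.2).trans h
  have h2 : ∀ b ∈ B, ∀ b' ∈ B, ∀ᶠ ρ in 𝓝[>] (0 : ℝ),
      ∀ t, t ∈ closedBall b ρ → t ∈ closedBall b' ρ → b = b' := fun b _ b' _ => by
    by_cases hbb : b = b'
    · simp [hbb]
    · have : 0 < dist b b' / 2 := by have := dist_pos.2 hbb; positivity
      filter_upwards [Ioo_mem_nhdsGT this] with ρ hρ t ht ht'
      have h3 := dist_triangle_left b b' t
      rw [mem_closedBall] at ht ht'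
      linarith [hρ.2]
  have h3 : ∀ᶠ ρ in 𝓝[>] (0 : ℝ), (0 < ρ ∧ ∀ b ∈ B, closedBall b ρ ⊆ U) ∧
      ∀ b ∈ B, ∀ b' ∈ B, ∀ t, t ∈ closedBall b ρ → t ∈ closedBall b' ρ → b = b' := by
    refine (eventually_mem_nhdsWithin.and ((Finset.eventually_all B).2 h1)).and
      ((Finset.eventually_all B).2 fun b hb => (Finset.eventually_all B).2 (h2 b hb))
  obtain ⟨ρ, ⟨h4, h5⟩, h6⟩ := h3.exists
  exact ⟨ρ, h4, h5, h6⟩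

theorem RootSystem.sheetedAt {f₀ : E × ℂ → ℂ} {c : ℂ} {r : ℝ} {N : ℕ} {a : E → Fin N → ℂ} {w₁ : E}
    (ha : ∀ᶠ w in 𝓝 w₁, RootSystem f₀ c r N a w)
    (hf : ∀ t ∈ ball c r, HolAt f₀ (w₁, t))
    (hcard : ∀ᶠ w in 𝓝 w₁, (Finset.univ.image (a w)).card = (Finset.univ.image (a w₁)).card) :
    SheetedAt {p : E × ℂ | p.2 ∈ ball c r ∧ f₀ p = 0} w₁ := by
  classical
  set B := Finset.univ.image (a w₁) with hBdef
  have ha₁ := ha.self_of_nhds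
  have hB : ∀ b ∈ B, b ∈ ball c r ∧ f₀ (w₁, b) = 0 := by
    intro b hb
    obtain ⟨i, _, rfl⟩ := Finset.mem_image.1 hb
    exact ⟨ha₁.mem_ball i, (ha₁.zero_iff _ (ball_subset_closedBall (ha₁.mem_ball i))).2 ⟨i, rfl⟩⟩
  obtain ⟨ρ, hρ, hρU, hρd⟩ := B.exists_radius_separated isOpen_ball fun b hb => (hB b hb).1
  have hsph : ∀ b ∈ B, ∀ t ∈ sphere b ρ, f₀ (w₁, t) ≠ 0 := by
    intro b hb t ht h0
    obtain ⟨i, hi⟩ := (ha₁.zero_iff t (ball_subset_closedBall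
      (hρU b hb (sphere_subset_closedBall ht)))).1 h0
    have htB : t ∈ B := hi ▸ Finset.mem_image_of_mem _ (Finset.mem_univ i)
    have := hρd b hb t htB t (sphere_subset_closedBall ht) (mem_closedBall_self hρ.le)
    subst this
    simp [hρ.ne] at ht
  have hroot : ∀ b : B, _ := fun b => exists_rootSystem hρ
    (fun t ht => hf t (hρU b.1 b.2 ht)) (hsph b.1 b.2)
  choose M α hα using hroot
  have hM : ∀ b, 0 < M b := fun b => by
    obtain ⟨i, _⟩ := ((hα b).self_of_nhds.zero_iff b.1 (mem_closedBall_self hρ.le)).1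
      (hB b.1 b.2).2
    exact i.pos
  have hmain : ∀ᶠ w in 𝓝 w₁, (∀ b i, α b w i = α b w ⟨0, hM b⟩) ∧
      (Function.Injective fun b => α b w ⟨0, hM b⟩) ∧
      ∀ l, (l ∈ ball c r ∧ f₀ (w, l) = 0) ↔ ∃ b, α b w ⟨0, hM b⟩ = l := by
    filter_upwards [ha, hcard, eventually_all.2 hα] with w hw hwc hwα
    have hin : ∀ b i, α b w i ∈ ball c r ∧ f₀ (w, α b w i) = 0 := fun b i =>
      ⟨hρU b.1 b.2 (ball_subset_closedBall ((hwα b).mem_ball i)),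
        ((hwα b).zero_iff _ (ball_subset_closedBall ((hwα b).mem_ball i))).2 ⟨i, rfl⟩⟩
    have hroots : ∀ l, (l ∈ ball c r ∧ f₀ (w, l) = 0) ↔ l ∈ Finset.univ.image (a w) := by
      intro l
      rw [Finset.mem_image]
      constructor
      · rintro ⟨h1, h2⟩
        obtain ⟨i, hi⟩ := (hw.zero_iff l (ball_subset_closedBall h1)).1 h2
        exact ⟨i, Finset.mem_univ i, hi⟩
      · rintro ⟨i, _, rfl⟩
        exact ⟨hw.mem_ball i, (hw.zero_iff _ (ball_subset_closedBall (hw.mem_ball i))).2 ⟨i, rfl⟩⟩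
    have hsep : ∀ b i b' i', α b w i = α b' w i' → b = b' := fun b i b' i' h =>
      Subtype.ext (hρd b.1 b.2 b'.1 b'.2 _ (ball_subset_closedBall ((hwα b).mem_ball i))
        (h ▸ ball_subset_closedBall ((hwα b').mem_ball i')))
    have hinj : Function.Injective fun b => α b w ⟨0, hM b⟩ := fun b b' h => hsep _ _ _ _ h
    have himg : Finset.univ.image (fun b => α b w ⟨0, hM b⟩) = Finset.univ.image (a w) := by
      refine Finset.eq_of_subset_of_card_le (fun x hx => ?_) ?_
      · obtain ⟨b, _, rfl⟩ := Finset.mem_image.1 hx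
        exact (hroots _).1 (hin _ _)
      · rw [Finset.card_image_of_injective _ hinj, hwc, Finset.card_univ, Fintype.card_coe]
    have hex : ∀ l, (l ∈ ball c r ∧ f₀ (w, l) = 0) ↔ ∃ b, α b w ⟨0, hM b⟩ = l := fun l => by
      rw [hroots, ← himg]
      simp
    refine ⟨fun b i => ?_, hinj, hex⟩
    obtain ⟨b', hb'⟩ := (hex _).1 (hin b i)
    obtain rfl := hsep _ _ _ _ hb'
    exact hb'.symm
  have havg : ∀ᶠ w in 𝓝 w₁, ∀ b, (M b : ℂ)⁻¹ * ∑ i, α b w i = α b w ⟨0, hM b⟩ := by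
    filter_upwards [hmain] with w hw b
    simp only [hw.1 b, Finset.sum_const, Finset.card_univ, Fintype.card_fin, nsmul_eq_mul]
    rw [← hw.1 b ⟨0, hM b⟩, inv_mul_cancel_left₀ (Nat.cast_ne_zero.2 (hM b).ne')]
  refine IsSheets.sheetedAt (ι := B) (s := fun b w => (M b : ℂ)⁻¹ * ∑ i, α b w i)
    ⟨fun b => ?_, ?_, ?_⟩
  · exact (HolAt.const _).mul ((hα b).self_of_nhds.holAt_sum Prod.snd fun t _ =>
      .of_differentiable differentiable_snd)
  · filter_upwards [hmain, havg] with w hw hwa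
    simpa only [hwa] using hw.2.1
  · filter_upwards [hmain, havg] with w hw hwa l
    simpa only [hwa] using hw.2.2 l

/-- The zeros of a holomorphic function in a small disc of the fibre are sheeted off a thin set. -/
theorem exists_roots_sheeted {f₀ : E × ℂ → ℂ} {w₀ : E} {t₀ : ℂ} (hf : HolAt f₀ (w₀, t₀))
    (hne : ∃ᶠ t in 𝓝 t₀, f₀ (w₀, t) ≠ 0) : ∃ r₀ > 0, ∀ r, 0 < r → r < r₀ →
      ThinAt {w | ¬ SheetedAt {p : E × ℂ | p.2 ∈ ball t₀ r ∧ f₀ p = 0} w} w₀ ∧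
      ∃ N : ℕ, ∀ᶠ w in 𝓝 w₀, {t | t ∈ ball t₀ r ∧ f₀ (w, t) = 0}.encard ≤ N := by
  classical
  obtain ⟨r₁, hr₁, hr₁f⟩ := Metric.eventually_nhds_iff_ball.1 hf.eventually
  obtain ⟨r₂, hr₂, hr₂f⟩ := Metric.eventually_nhds_iff_ball.1
    (eventually_nhdsWithin_iff.1 (ProperAt.eventually_slice_ne hf hne))
  refine ⟨min r₁ r₂, by positivity, fun r hr hr0 => ?_⟩
  obtain ⟨hrr₁, hrr₂⟩ := lt_min_iff.1 hr0
  have hhol : ∀ w ∈ ball w₀ r₁, ∀ t ∈ closedBall t₀ r, HolAt f₀ (w, t) := fun w hw t ht => by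
    refine hr₁f _ ?_
    rw [← ball_prod_same]
    exact ⟨hw, closedBall_subset_ball hrr₁ ht⟩
  obtain ⟨N, a, ha⟩ := exists_rootSystem hr (hhol w₀ (mem_ball_self hr₁)) fun t ht =>
    hr₂f t (by rw [mem_sphere] at ht; rw [mem_ball, ht]; exact hrr₂)
      (by rintro rfl; simp [hr.ne] at ht)
  obtain ⟨ρ, hρ, hρa⟩ := Metric.eventually_nhds_iff_ball.1 (ha.and (ball_mem_nhds w₀ hr₁))
  set n : E → ℕ := fun w => (Finset.univ.image (a w)).card with hn
  have hnN : ∀ w, n w ≤ N := fun w => Finset.card_image_le.trans (by simp)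
  obtain ⟨w', hw', hmax⟩ : ∃ w' ∈ ball w₀ ρ, ∀ w ∈ ball w₀ ρ, n w ≤ n w' := by
    have hfin : (n '' ball w₀ ρ).Finite := (Set.finite_Iic N).subset (by
      rintro _ ⟨w, _, rfl⟩
      exact hnN w)
    obtain ⟨_, ⟨w', hw', rfl⟩, h⟩ := Set.exists_max_image _ id hfin
      ⟨_, w₀, mem_ball_self hρ, rfl⟩
    exact ⟨w', hw', fun w hw => h _ ⟨w, hw, rfl⟩⟩
  have hδ : ∀ w ∈ ball w₀ ρ,
      HolAt (fun w => MvPolynomial.eval (a w) (partialDisc N (n w'))) w := fun w hw =>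
    (hρa w hw).1.holAt_symmetric (g := Prod.snd) (fun t _ => .of_differentiable differentiable_snd)
      (partialDisc_isSymmetric N _)
  refine ⟨⟨_, hδ w₀ (mem_ball_self hρ), fun h0 => ?_, ?_⟩, N, ?_⟩
  · exact eval_partialDisc_card_ne (a w') (eq_zero_of_convex_of_eventuallyEq (convex_ball w₀ ρ) hδ
      (mem_ball_self hρ) (h0.mono fun _ h => not_not.1 h) w' hw')
  · filter_upwards [ball_mem_nhds w₀ hρ] with w₁ hw₁ hns
    by_contra hδ₁
    refine hns (RootSystem.sheetedAt (a := a) ?_ (fun t ht => hhol w₁ (hρa w₁ hw₁).2 t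
      (ball_subset_closedBall ht)) ?_)
    · filter_upwards [isOpen_ball.mem_nhds hw₁] with w hw using (hρa w hw).1
    · have h1 : ∀ w ∈ ball w₀ ρ, MvPolynomial.eval (a w) (partialDisc N (n w')) ≠ 0 → n w = n w' :=
        fun w hw h => le_antisymm (hmax w hw) (card_image_ge_of_eval_partialDisc_ne h)
      filter_upwards [isOpen_ball.mem_nhds hw₁, (hδ w₁ hw₁).continuousAt.eventually_ne hδ₁]
        with w hw hδw
      exact (h1 w hw hδw).trans (h1 w₁ hw₁ hδ₁).symm
  · filter_upwards [ha] with w hw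
    have hsub : {t | t ∈ ball t₀ r ∧ f₀ (w, t) = 0} ⊆ Finset.univ.image (a w) := by
      rintro t ⟨ht, ht0⟩
      obtain ⟨i, hi⟩ := (hw.zero_iff t (ball_subset_closedBall ht)).1 ht0
      simp [← hi]
    refine (encard_le_encard hsub).trans ?_
    rw [encard_coe_eq_coe_finsetCard]
    exact_mod_cast hnN w

end Roots

section GenericSheets

theorem norm_finprod_mem_le {α : Type*} {T : Set α} {f : α → ℂ} {C : ℝ} (hC : 1 ≤ C) {N : ℕ}
    (hT : T.encard ≤ N) (h : ∀ l ∈ T, ‖f l‖ ≤ C) : ‖∏ᶠ l ∈ T, f l‖ ≤ C ^ N := by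
  have hfin : T.Finite := finite_of_encard_le_coe hT
  rw [finprod_mem_eq_finite_toFinset_prod f hfin, norm_prod]
  refine (Finset.prod_le_prod (g := fun _ => C) (fun _ _ => norm_nonneg _)
    fun l hl => h l (hfin.mem_toFinset.1 hl)).trans ?_
  rw [Finset.prod_const]
  refine pow_le_pow_right₀ hC ?_
  rw [hfin.encard_eq_coe_toFinset_card] at hT
  exact_mod_cast hT

theorem finprod_mem_ne_zero' {α : Type*} {T : Set α} {f : α → ℂ} (h : ∀ l ∈ T, f l ≠ 0) :
    ∏ᶠ l ∈ T, f l ≠ 0 :=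
  finprod_mem_induction (p := fun x => x ≠ 0) one_ne_zero (fun _ _ => mul_ne_zero) h

theorem finprod_mem_eq_zero' {α : Type*} {T : Set α} {f : α → ℂ} (hT : T.Finite) {l : α}
    (hl : l ∈ T) (h : f l = 0) : ∏ᶠ l ∈ T, f l = 0 := by
  rw [finprod_mem_eq_finite_toFinset_prod f hT]
  exact Finset.prod_eq_zero (hT.mem_toFinset.2 hl) h

variable {E F : Type*} [NormedAddCommGroup E] [NormedSpace ℂ E]
  [NormedAddCommGroup F] [NormedSpace ℂ F]

theorem ThinAt.closure {S : Set E} {w₀ : E} (h : ThinAt S w₀) : ThinAt (closure S) w₀ := by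
  obtain ⟨γ, h1, h2, h3⟩ := h
  refine ⟨γ, h1, h2, ?_⟩
  filter_upwards [h1.eventually, h3.eventually_nhds] with w hw hwS hcl
  by_contra h0
  have h4 := (mem_closure_iff_frequently.1 hcl).and_eventually
    (hwS.and (hw.continuousAt.eventually_ne h0))
  obtain ⟨x, hx, hx2, hx3⟩ := h4.exists
  exact hx3 (hx2 hx)

theorem ThinAt.union {S T : Set E} {w₀ : E} (hS : ThinAt S w₀) (hT : ThinAt T w₀) :
    ThinAt (S ∪ T) w₀ := by
  rw [union_eq_iUnion]
  exact ThinAt.iUnion fun b => by cases b <;> assumption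

/-- Off a thin set, each point of a sheeted set `R` lying in an analytic set `Q` is an interior
point of `R ∩ Q` relative to `R`. -/
theorem thinAt_relInterior [ProperSpace E] [ProperSpace F] {R Q : Set (E × F)} {w₀ : E} {p : F}
    {r ρ : ℝ} (hr : 0 < r) (hrρ : r < ρ)
    (hR : R ⊆ {q | q.2 ∈ ball p r}) (hS : ThinAt {w | ¬ SheetedAt R w} w₀)
    {N : ℕ} (hN : ∀ᶠ w in 𝓝 w₀, {l | (w, l) ∈ R}.encard ≤ N)
    (hQ : ∀ z ∈ ball (w₀, p) ρ, z ∉ Q → ∃ f ∈ vanishingSpace Q (ball (w₀, p) ρ), f z ≠ 0) :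
    ThinAt {w | ¬ (SheetedAt R w ∧ ∀ l, (w, l) ∈ R → (w, l) ∈ Q → (w, l) ∈ relInterior R Q)}
      w₀ := by
  have hQan : ∀ z ∈ ball (w₀, p) ρ, LocAnalyticAt Q z := fun z hz => ⟨_, isOpen_ball, hz, hQ⟩
  have hRball : ∀ w ∈ ball w₀ r, ∀ l, (w, l) ∈ R → (w, l) ∈ ball (w₀, p) r := fun w hw l hl => by
    rw [← ball_prod_same]
    exact ⟨hw, hR hl⟩
  obtain ⟨W, hWW₀, hWo, hw₀W, hext⟩ := riemann_extension hS
    (inter_mem (ball_mem_nhds w₀ hr) hN)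
  obtain ⟨ε, hε, hεW⟩ := Metric.isOpen_iff.1 hWo w₀ hw₀W
  have hbr : ∀ w ∈ ball w₀ ε, w ∈ ball w₀ r := fun w hw => (hWW₀ (hεW hw)).1
  have hbρ : ball (w₀, p) r ⊆ ball (w₀, p) ρ := ball_subset_ball hrρ.le
  obtain ⟨w₁, hw₁S, hw₁⟩ := (hS.frequently_notMem.and_eventually (ball_mem_nhds w₀ hε)).exists
  obtain ⟨ι, _, s, hs⟩ := not_not.1 hw₁S
  have hsQ : ∀ i, LocAnalyticAt Q (w₁, s i w₁) := fun i =>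
    hQan _ (hbρ (hRball w₁ (hbr w₁ hw₁) _ ((hs.mem_iff.self_of_nhds _).2 ⟨i, rfl⟩)))
  have hthin : ThinAt (⋃ i : {i // (w₁, s i w₁) ∉ relInterior R Q}, {w | (w, s i.1 w) ∈ Q}) w₁ :=
    ThinAt.iUnion fun i => hs.thinAt_sheet i.1 (hsQ i.1) i.2
  obtain ⟨w₂, hw₂Q, hw₂s, hw₂i, hw₂⟩ := (hthin.frequently_notMem.and_eventually
    (hs.eventually.and ((hs.eventually_mem_relInterior_iff hsQ).and
      (isOpen_ball.mem_nhds hw₁)))).exists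
  have hw₂R : ∀ i, (w₂, s i w₂) ∈ R := fun i => (hw₂s.mem_iff.self_of_nhds _).2 ⟨i, rfl⟩
  obtain ⟨f, hf, hf2⟩ := Submodule.exists_mem_forall_notMem
    (vanishingSpace Q (ball (w₀, p) ρ))
    (fun i : {i // (w₁, s i w₁) ∉ relInterior R Q} =>
      LinearMap.ker (LinearMap.proj (R := ℂ) (φ := fun _ : E × F => ℂ) (w₂, s i.1 w₂))) (fun i => by
      obtain ⟨f, hf, hfz⟩ := hQ (w₂, s i.1 w₂) (hbρ (hRball _ (hbr _ hw₂) _ (hw₂R i.1)))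
        fun hz => hw₂Q (mem_iUnion.2 ⟨i, hz⟩)
      exact ⟨f, hf, by simpa using hfz⟩)
  set g₀ : E → ℂ := fun w => ∏ᶠ l ∈ {l | (w, l) ∈ R \ relInterior R Q}, f (w, l) with hg₀
  obtain ⟨C, hC⟩ : ∃ C, ∀ z ∈ closedBall (w₀, p) r, ‖f z‖ ≤ C :=
    (isCompact_closedBall (w₀, p) r).exists_bound_of_continuousOn fun z hz =>
      (hf.1 z (closedBall_subset_ball hrρ hz)).continuousAt.continuousWithinAt
  obtain ⟨g, hg, hgg₀⟩ := hext g₀ (fun w hw hwS => by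
    obtain ⟨ι', _, s', hs'⟩ := not_not.1 hwS
    have hwR : ∀ l, (w, l) ∈ R → (w, l) ∈ ball (w₀, p) ρ := fun l hl => hbρ (hRball w hw.1 l hl)
    refine (hs'.subset (Y' := R \ relInterior R Q) sdiff_subset ?_).holAt_finprod fun l hl =>
      hf.1 _ (hwR l hl.1)
    filter_upwards [hs'.eventually_mem_relInterior_iff (Q := Q) fun i =>
      hQan _ (hwR _ ((hs'.mem_iff.self_of_nhds _).2 ⟨i, rfl⟩)), hs'.mem_iff] with x hx hxm i
    simp only [Set.mem_sdiff, hx i, (hxm _).2 ⟨i, rfl⟩, (hs'.mem_iff.self_of_nhds _).2 ⟨i, rfl⟩])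
    ⟨max C 1 ^ N, fun w hw _ => by
      refine norm_finprod_mem_le (le_max_right _ _)
        ((encard_le_encard fun l hl => ?_).trans hw.2) fun l hl => (hC _ ?_).trans (le_max_left _ _)
      · exact hl.1
      · exact ball_subset_closedBall (hRball w hw.1 l hl.1)⟩
  have hg2 : g w₂ ≠ 0 := by
    rw [hgg₀ w₂ (hεW hw₂) fun h => h hw₂s.sheetedAt]
    refine finprod_mem_ne_zero' fun l hl => ?_
    obtain ⟨i, rfl⟩ := (hw₂s.mem_iff.self_of_nhds l).1 hl.1
    simpa using hf2 ⟨i, fun h => hl.2 ((hw₂i i).2 h)⟩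
  have hgthin : ThinAt {w | g w = 0} w₀ := by
    refine ⟨g, hg w₀ hw₀W, fun h0 => hg2 ?_, Eventually.of_forall fun w hw => hw⟩
    exact eq_zero_of_convex_of_eventuallyEq (convex_ball w₀ ε) (fun x hx => hg x (hεW hx))
      (mem_ball_self hε) (h0.mono fun _ h => not_not.1 h) w₂ hw₂
  refine (hS.union hgthin).mono' ?_
  filter_upwards [ball_mem_nhds w₀ hε] with w hw hbad
  by_cases hwS : SheetedAt R w
  · right
    change ¬ (_ ∧ _) at hbad
    simp only [hwS, true_and, not_forall] at hbad
    obtain ⟨l, hlR, hlQ, hlI⟩ := hbad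
    change g w = 0
    rw [hgg₀ w (hεW hw) fun h => h hwS]
    refine finprod_mem_eq_zero' (hwS.finite_fibre.subset fun l hl => hl.1) (l := l) ⟨hlR, hlI⟩ ?_
    exact hf.2 _ ⟨hlQ, hbρ (hRball _ (hbr w hw) _ hlR)⟩
  · exact .inl hwS

end GenericSheets

section GenericSheets

variable {E : Type*} [NormedAddCommGroup E] [NormedSpace ℂ E] [ProperSpace E] {k : ℕ}

theorem encard_pi_le {T : Fin k → Set ℂ} {N : Fin k → ℕ} (h : ∀ j, (T j).encard ≤ N j) :
    {l : Fin k → ℂ | ∀ j, l j ∈ T j}.encard ≤ (∏ j, N j : ℕ) := by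
  classical
  have hfin : ∀ j, (T j).Finite := fun j => finite_of_encard_le_coe (h j)
  have hsub : {l : Fin k → ℂ | ∀ j, l j ∈ T j} ⊆
      Fintype.piFinset fun j => (hfin j).toFinset := fun l hl => by
    simpa using hl
  refine (encard_le_encard hsub).trans ?_
  rw [encard_coe_eq_coe_finsetCard, Fintype.card_piFinset]
  norm_cast
  refine Finset.prod_le_prod' fun j _ => ?_
  have := h j
  rw [(hfin j).encard_eq_coe_toFinset_card] at this
  exact_mod_cast this

theorem exists_roots_sheeted_eventually {E : Type*} [NormedAddCommGroup E] [NormedSpace ℂ E]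
    {Z : Set (E × ℂ)} {w₀ : E} (h : ProperAt Z w₀) (t₀ : ℂ) :
    ∃ f₀ : E × ℂ → ℂ, ∀ᶠ r in 𝓝[>] (0 : ℝ),
      ThinAt {w | ¬ SheetedAt {p : E × ℂ | p.2 ∈ ball t₀ r ∧ f₀ p = 0} w} w₀ ∧
      (∃ N : ℕ, ∀ᶠ w in 𝓝 w₀, {t | t ∈ ball t₀ r ∧ f₀ (w, t) = 0}.encard ≤ N) ∧
      ∀ᶠ w in 𝓝 w₀, ∀ t ∈ ball t₀ r, (w, t) ∈ Z → f₀ (w, t) = 0 := by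
  obtain ⟨f, hf, hfZ, hf0⟩ := h.exists_slice_ne t₀
  obtain ⟨r₀, hr₀, hr₀f⟩ := exists_roots_sheeted hf hf0
  obtain ⟨r₁, hr₁, hr₁f⟩ := Metric.eventually_nhds_iff_ball.1 hfZ
  refine ⟨f, ?_⟩
  filter_upwards [Ioo_mem_nhdsGT hr₀, Ioo_mem_nhdsGT hr₁] with r hr hr'
  obtain ⟨h1, h2⟩ := hr₀f r hr.1 hr.2
  refine ⟨h1, h2, ?_⟩
  filter_upwards [ball_mem_nhds w₀ hr₁] with w hw t ht hZ
  refine hr₁f _ ?_ hZ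
  rw [← ball_prod_same]
  exact ⟨hw, ball_subset_ball hr'.2.le ht⟩

theorem ProperAt.sheeted_local {Z X : Set (E × (Fin k → ℂ))} {w₀ : E} (h : ProperAt Z w₀)
    {p : Fin k → ℂ} (hX : LocAnalyticAt X (w₀, p)) : ∀ᶠ r in 𝓝[>] (0 : ℝ),
      ThinAt {w | ¬ SheetedAt {q | q ∈ Z \ X ∧ q.2 ∈ ball p r} w} w₀ ∧
      ∃ N : ℕ, ∀ᶠ w in 𝓝 w₀, {l | (w, l) ∈ Z ∧ l ∈ ball p r}.encard ≤ N := by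
  choose f hf using fun j => exists_roots_sheeted_eventually (h.coordImage j) (p j)
  obtain ⟨ρZ, hρZ, hZ⟩ := (h.locAnalyticAt p).exists_radius
  obtain ⟨ρX, hρX, hX⟩ := hX.exists_radius
  have hρ : 0 < min ρZ ρX := by positivity
  filter_upwards [eventually_all.2 hf, Ioo_mem_nhdsGT hρ] with r hr hrρ
  choose hthin hN hzero using hr
  choose N hN using hN
  set R : Set (E × (Fin k → ℂ)) := {q | ∀ j, (q.1, q.2 j) ∈
    {p' : E × ℂ | p'.2 ∈ ball (p j) r ∧ f j p' = 0}} with hR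
  have hRball : ∀ w l, (w, l) ∈ R → l ∈ ball p r := fun w l hl =>
    (dist_pi_lt_iff hrρ.1).2 fun j => (hl j).1
  have hRthin : ThinAt {w | ¬ SheetedAt R w} w₀ := by
    refine (ThinAt.iUnion hthin).mono' (Eventually.of_forall fun w hw => ?_)
    by_contra hcon
    simp only [mem_iUnion, not_exists] at hcon
    exact hw (SheetedAt.pi fun j => not_not.1 (hcon j))
  have hRN : ∀ᶠ w in 𝓝 w₀, {l | (w, l) ∈ R}.encard ≤ (∏ j, N j : ℕ) := by
    filter_upwards [eventually_all.2 hN] with w hw using encard_pi_le hw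
  have hZR : ∀ᶠ w in 𝓝 w₀, ∀ l ∈ ball p r, (w, l) ∈ Z → (w, l) ∈ R := by
    filter_upwards [eventually_all.2 hzero] with w hw l hl hlZ j
    have hlj : l j ∈ ball (p j) r := (dist_le_pi_dist l p j).trans_lt hl
    exact ⟨hlj, hw j _ hlj ⟨(w, l), hlZ, rfl⟩⟩
  refine ⟨?_, ∏ j, N j, ?_⟩
  · have tZ := thinAt_relInterior hrρ.1 hrρ.2 (fun q hq => hRball q.1 q.2 hq) hRthin hRN
      (hZ _ (min_le_left _ _))
    have tX := thinAt_relInterior hrρ.1 hrρ.2 (fun q hq => hRball q.1 q.2 hq) hRthin hRN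
      (hX _ (min_le_right _ _))
    refine (tZ.union tX).closure.mono' ?_
    filter_upwards [ball_mem_nhds w₀ hrρ.1, hZR.eventually_nhds] with w hwr hwZR hbad
    by_contra hcl
    have hgood : ∀ᶠ x in 𝓝 w, x ∉ _ := isClosed_closure.isOpen_compl.mem_nhds hcl
    refine hbad ?_
    have hgood' : ∀ᶠ x in 𝓝 w, SheetedAt R x ∧ ∀ l, (x, l) ∈ R →
        ((x, l) ∈ Z → (x, l) ∈ relInterior R Z) ∧ ((x, l) ∈ X → (x, l) ∈ relInterior R X) := by
      filter_upwards [hgood] with x hx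
      have h1 := fun h => hx (subset_closure (mem_union_left _ h))
      have h2 := fun h => hx (subset_closure (mem_union_right _ h))
      have h1 := not_not.1 h1
      have h2 := not_not.1 h2
      exact ⟨h1.1, fun l hl => ⟨h1.2 l hl, h2.2 l hl⟩⟩
    obtain ⟨ι, _, s, hs⟩ := hgood'.self_of_nhds.1
    have hmem : ∀ i, (w, s i w) ∈ ball (w₀, p) (min ρZ ρX) := fun i => by
      rw [← ball_prod_same]
      exact ⟨ball_subset_ball hrρ.2.le hwr, ball_subset_ball hrρ.2.le
        (hRball w _ ((hs.mem_iff.self_of_nhds _).2 ⟨i, rfl⟩))⟩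
    have hsub := (hs.subset (Y' := R ∩ (relInterior R Z \ relInterior R X)) inter_subset_left (by
      filter_upwards [hs.eventually_mem_relInterior_iff (Q := Z) fun i =>
        ⟨_, isOpen_ball, hmem i, hZ _ (min_le_left _ _)⟩,
        hs.eventually_mem_relInterior_iff (Q := X) fun i =>
        ⟨_, isOpen_ball, hmem i, hX _ (min_le_right _ _)⟩, hs.mem_iff] with x h1 h2 h3 i
      simp only [mem_inter_iff, Set.mem_sdiff, h1 i, h2 i, (h3 _).2 ⟨i, rfl⟩,
        (hs.mem_iff.self_of_nhds _).2 ⟨i, rfl⟩])).sheetedAt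
    refine hsub.congr ?_
    filter_upwards [hgood', hwZR] with x hx hxZ l
    constructor
    · rintro ⟨h1, h2, h3⟩
      exact ⟨⟨relInterior_subset _ _ h2, fun h4 => h3 ((hx.2 l h1).2 h4)⟩, hRball _ _ h1⟩
    · rintro ⟨⟨h1, h2⟩, h3⟩
      have h4 := hxZ l h3 h1
      exact ⟨h4, (hx.2 l h4).1 h1, fun h5 => h2 (relInterior_subset _ _ h5)⟩
  · filter_upwards [hRN, hZR] with w hw hwZ
    exact (encard_le_encard fun l hl => hwZ l hl.2 hl.1).trans hw

/-- The difference of two analytic sets, the first of which is proper over the base, is sheeted off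
a thin subset of the base. -/
theorem ProperAt.thinAt_not_sheetedAt {Z X : Set (E × (Fin k → ℂ))} {w₀ : E} (h : ProperAt Z w₀)
    (hX : ∀ l, (w₀, l) ∈ Z → LocAnalyticAt X (w₀, l)) :
    ThinAt {w | ¬ SheetedAt (Z \ X) w} w₀ ∧
      ∃ N : ℕ, ∀ᶠ w in 𝓝 w₀, {l | (w, l) ∈ Z}.encard ≤ N := by
  classical
  have hfin := h.finite_fibre.to_subtype
  have := Fintype.ofFinite {l | (w₀, l) ∈ Z}
  have hdisj : ∀ p q : {l | (w₀, l) ∈ Z}, ∀ᶠ r in 𝓝[>] (0 : ℝ),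
      ∀ l, l ∈ ball p.1 r → l ∈ ball q.1 r → p = q := fun p q => by
    by_cases hpq : p = q
    · simp [hpq]
    · have : 0 < dist p q / 2 := by have := dist_pos.2 hpq; positivity
      filter_upwards [Ioo_mem_nhdsGT this] with r hr l hl hl'
      have h3 := dist_triangle_left p.1 q.1 l
      rw [mem_ball] at hl hl'
      have h4 : dist p q = dist p.1 q.1 := rfl
      linarith [hr.2]
  obtain ⟨r, ⟨hr, hd⟩, hr0⟩ := (((eventually_all.2 fun p : {l | (w₀, l) ∈ Z} =>
    h.sheeted_local (hX p.1 p.2)).and (eventually_all.2 fun p => eventually_all.2 (hdisj p))).and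
      eventually_mem_nhdsWithin).exists
  choose hthin N hN using hr
  have hcov := h.eventually_fibre_subset (U := ⋃ p : {l | (w₀, l) ∈ Z}, ball p.1 r)
    (isOpen_iUnion fun _ => isOpen_ball) fun l hl => mem_iUnion.2 ⟨⟨l, hl⟩, mem_ball_self hr0⟩
  refine ⟨(ThinAt.iUnion hthin).mono' ?_, ∑ p, N p, ?_⟩
  · filter_upwards [hcov.eventually_nhds] with w hw hbad
    by_contra hcon
    simp only [mem_iUnion, not_exists] at hcon
    refine hbad ((SheetedAt.iUnion (fun p => not_not.1 (hcon p))
      (Eventually.of_forall fun x p q l h1 h2 => hd p q l h1.2 h2.2)).congr ?_)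
    filter_upwards [hw] with x hx l
    simp only [mem_iUnion]
    constructor
    · rintro ⟨p, h1, _⟩
      exact h1
    · intro h1
      obtain ⟨p, hp⟩ := mem_iUnion.1 (hx l h1.1)
      exact ⟨p, h1, hp⟩
  · filter_upwards [hcov, eventually_all.2 hN] with w hw hwN
    have hsub : {l | (w, l) ∈ Z} ⊆ ⋃ p ∈ (Finset.univ : Finset {l | (w₀, l) ∈ Z}),
        {l | (w, l) ∈ Z ∧ l ∈ ball p.1 r} := fun l hl => by
      obtain ⟨p, hp⟩ := mem_iUnion.1 (hw l hl)
      simpa using ⟨hl, p.1, p.2, hp⟩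
    refine (encard_le_encard hsub).trans ?_
    have : ∀ s : Finset {l | (w₀, l) ∈ Z},
        (⋃ p ∈ s, {l | (w, l) ∈ Z ∧ l ∈ ball p.1 r}).encard ≤ (∑ p ∈ s, N p : ℕ) := by
      intro s
      induction s using Finset.induction_on with
      | empty => simp
      | insert p s hp ih =>
        rw [Finset.set_biUnion_insert, Finset.sum_insert hp, Nat.cast_add]
        exact (encard_union_le _ _).trans (add_le_add (hwN p) ih)
    exact this _

end GenericSheets

section Removable

variable {E F : Type*} [NormedAddCommGroup E] [NormedSpace ℂ E]
  [NormedAddCommGroup F] [NormedSpace ℂ F]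

/-- Bounded holomorphic functions off `S` extend holomorphically across `S` near `x₀`, to a
neighborhood not depending on the function. -/
def RemovableAt (S : Set E) (x₀ : E) : Prop :=
  ∀ W₀ ∈ 𝓝 x₀, ∃ W ⊆ W₀, IsOpen W ∧ x₀ ∈ W ∧ ∀ f : E → ℂ, (∀ x ∈ W₀, x ∉ S → HolAt f x) →
    (∃ C, ∀ x ∈ W₀, x ∉ S → ‖f x‖ ≤ C) →
    ∃ g : E → ℂ, (∀ x ∈ W, HolAt g x) ∧ ∀ x ∈ W, x ∉ S → g x = f x

theorem ThinAt.removableAt {S : Set E} {x₀ : E} (hS : ThinAt S x₀) : RemovableAt S x₀ :=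
  fun _ hW₀ => riemann_extension hS hW₀

/-- Extension in two steps: across `S` off a closed thin set `T`, then across `T`. -/
theorem RemovableAt.of_thinAt {S T : Set E} {x₀ : E} (hT : IsClosed T) (hTS : T ⊆ S)
    (hTx : ThinAt T x₀) (hS : ∀ᶠ x in 𝓝 x₀, x ∉ T → ThinAt S x) : RemovableAt S x₀ := by
  intro W₀ hW₀
  obtain ⟨ρ, hρ, hball⟩ := Metric.eventually_nhds_iff_ball.1
    (hS.and (eventually_mem_set.2 hW₀))
  obtain ⟨W, hWρ, hWo, hx₀W, hW⟩ := riemann_extension hTx (ball_mem_nhds x₀ hρ)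
  refine ⟨W, fun x hx => (hball x (hWρ hx)).2, hWo, hx₀W, fun f hf ⟨C, hC⟩ => ?_⟩
  have hloc : ∀ x, x ∈ ball x₀ ρ → x ∉ T →
      ∃ g : E → ℂ, ∀ᶠ y in 𝓝 x, HolAt g y ∧ (y ∉ S → g y = f y) := by
    intro x hx hxT
    obtain ⟨V, -, hVo, hxV, hV⟩ := riemann_extension ((hball x hx).1 hxT)
      (isOpen_ball.mem_nhds hx)
    obtain ⟨g, hg, hgf⟩ := hV f (fun y hy => hf y (hball y hy).2)
      ⟨C, fun y hy => hC y (hball y hy).2⟩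
    refine ⟨g, ?_⟩
    filter_upwards [hVo.mem_nhds hxV] with y hy using ⟨hg y hy, hgf y hy⟩
  choose! g hg using hloc
  have hfreq : ∀ x ∈ ball x₀ ρ, x ∉ T → ∃ᶠ y in 𝓝 x, y ∉ S := fun x hx hxT =>
    ((hball x hx).1 hxT).frequently_notMem
  have hev : ∀ x ∈ ball x₀ ρ, x ∉ T → (fun y => g y y) =ᶠ[𝓝 x] g x := by
    intro x hx hxT
    filter_upwards [isOpen_ball.mem_nhds hx, hT.isOpen_compl.mem_nhds hxT,
      (hg x hx hxT).eventually_nhds] with y hy hyT hyg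
    by_contra hne
    have h1 : ContinuousAt (fun z => g y z - g x z) y :=
      (hg y hy hyT).self_of_nhds.1.continuousAt.sub hyg.self_of_nhds.1.continuousAt
    obtain ⟨z, hz, hz1, hz2, hz3⟩ := ((hfreq y hy hyT).and_eventually
      ((h1.eventually_ne (sub_ne_zero.2 hne)).and ((hg y hy hyT).and hyg))).exists
    exact hz1 (by rw [hz2.2 hz, hz3.2 hz, sub_self])
  have hnorm : ∀ x ∈ ball x₀ ρ, x ∉ T → ‖g x x‖ ≤ C := by
    intro x hx hxT
    by_contra hlt
    have h1 : ∀ᶠ y in 𝓝 x, C < ‖g x y‖ :=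
      ((hg x hx hxT).self_of_nhds.1.continuousAt.norm).eventually_const_lt (not_le.1 hlt)
    obtain ⟨z, hz, hz1, hz2, hz3⟩ := ((hfreq x hx hxT).and_eventually
      (h1.and ((hg x hx hxT).and (isOpen_ball.mem_nhds hx)))).exists
    rw [hz2.2 hz] at hz1
    exact absurd (hC z (hball z hz3).2 hz) (not_le.2 hz1)
  obtain ⟨G, hG, hGg⟩ := hW (fun y => g y y)
    (fun x hx hxT => (hg x hx hxT).self_of_nhds.1.congr (hev x hx hxT).symm)
    ⟨C, hnorm⟩
  refine ⟨G, hG, fun x hx hxS => ?_⟩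
  have hxT : x ∉ T := fun h => hxS (hTS h)
  rw [hGg x hx hxT]
  exact (hg x (hWρ hx) hxT).self_of_nhds.2 hxS

theorem le_norm_finprod_mem {α : Type*} {T : Set α} {f : α → ℂ} {c : ℝ} (hc : 0 < c) (hc1 : c ≤ 1)
    {N : ℕ} (hT : T.encard ≤ N) (h : ∀ l ∈ T, c ≤ ‖f l‖) : c ^ N ≤ ‖∏ᶠ l ∈ T, f l‖ := by
  have hfin : T.Finite := finite_of_encard_le_coe hT
  rw [finprod_mem_eq_finite_toFinset_prod f hfin, norm_prod]
  refine le_trans ?_ (Finset.prod_le_prod (f := fun _ => c) (fun _ _ => hc.le)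
    fun l hl => h l (hfin.mem_toFinset.1 hl))
  rw [Finset.prod_const]
  refine pow_le_pow_of_le_one hc.le hc1 ?_
  rw [hfin.encard_eq_coe_toFinset_card] at hT
  exact_mod_cast hT

theorem IsSheets.comp_fst {ι : Type*} {s : ι → E → F} {Y : Set (E × F)} {q : E × F}
    (h : IsSheets s Y q.1) :
    IsSheets (fun i (p : E × F) => s i p.1) {p : (E × F) × F | (p.1.1, p.2) ∈ Y} q where
  holAt i := HolAt.comp (u := Prod.fst) (h.holAt i) (.of_differentiable differentiable_fst)
  injective := continuousAt_fst.eventually h.injective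
  mem_iff := continuousAt_fst.eventually h.mem_iff

theorem exists_clm_forall_ne_zero {k : ℕ} {ι : Type*} [Finite ι] {v : ι → Fin k → ℂ}
    (hv : ∀ i, v i ≠ 0) : ∃ h : (Fin k → ℂ) →L[ℂ] ℂ, ∀ i, h (v i) ≠ 0 := by
  obtain ⟨h, -, hh⟩ := Submodule.exists_mem_forall_notMem (V := (Fin k → ℂ) →L[ℂ] ℂ) ⊤
    (fun i => LinearMap.ker (ContinuousLinearMap.apply ℂ ℂ (v i)).toLinearMap) (fun i => by
      obtain ⟨j, hj⟩ := Function.ne_iff.1 (hv i)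
      exact ⟨ContinuousLinearMap.proj j, trivial, fun h => hj (by simpa using h)⟩)
  exact ⟨h, fun i hi => hh i (by simpa using hi)⟩

/-- **Extension theorem for sheeted sets**: the closure of a bounded sheeted set over the complement
of a removable subset of the base is analytic. -/
theorem locAnalyticAt_closure_of_removableAt {k : ℕ} {Y : Set (E × (Fin k → ℂ))} {G : Set E}
    {w₀ : E} {l₀ : Fin k → ℂ} (hG : ∀ w ∈ G, SheetedAt Y w)
    (hdense : ∀ᶠ w in 𝓝 w₀, w ∈ closure G)
    (hrem : RemovableAt (Prod.fst ⁻¹' Gᶜ) (w₀, l₀))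
    (hbdd : ∃ C : ℝ, ∀ᶠ w in 𝓝 w₀, ∀ l, (w, l) ∈ Y → ‖l‖ ≤ C)
    (hcard : ∃ N : ℕ, ∀ᶠ w in 𝓝 w₀, {l | (w, l) ∈ Y}.encard ≤ N) :
    LocAnalyticAt (closure {q | q ∈ Y ∧ q.1 ∈ G}) (w₀, l₀) := by
  obtain ⟨C, hC⟩ := hbdd
  obtain ⟨N, hN⟩ := hcard
  set W₀ : Set (E × (Fin k → ℂ)) := {q | (q.1 ∈ closure G ∧ (∀ l, (q.1, l) ∈ Y → ‖l‖ ≤ C) ∧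
    {l | (q.1, l) ∈ Y}.encard ≤ N) ∧ ‖q.2‖ < ‖l₀‖ + 1} with hW₀def
  have hW₀ : W₀ ∈ 𝓝 (w₀, l₀) := by
    refine inter_mem (eventually_nhds_fst l₀ (hdense.and (hC.and hN))) ?_
    have : ContinuousAt (fun q : E × (Fin k → ℂ) => ‖q.2‖) (w₀, l₀) := by fun_prop
    exact this.eventually_lt_const (by simp)
  obtain ⟨W, hWW₀, hWo, hxW, hext⟩ := hrem W₀ hW₀
  have hgh : ∀ h : (Fin k → ℂ) →L[ℂ] ℂ, ∃ g : E × (Fin k → ℂ) → ℂ, (∀ x ∈ W, HolAt g x) ∧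
      ∀ x ∈ W, x.1 ∈ G → g x = ∏ᶠ a ∈ {a | (x.1, a) ∈ Y}, h (x.2 - a) := by
    intro h
    obtain ⟨g, hg, hgf⟩ := hext (fun x => ∏ᶠ a ∈ {a | (x.1, a) ∈ Y}, h (x.2 - a)) (by
      intro x hx hxG
      obtain ⟨ι, _, s, hs⟩ := hG x.1 (not_not.1 hxG)
      exact hs.comp_fst.holAt_finprod
        (g := fun p : (E × (Fin k → ℂ)) × (Fin k → ℂ) => h (p.1.2 - p.2))
        fun l _ => .of_differentiable (by fun_prop)) (by
      refine ⟨(max 1 (‖h‖ * (‖l₀‖ + 1 + C))) ^ N, fun x hx _ =>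
        norm_finprod_mem_le (le_max_left _ _) hx.1.2.2 fun a ha => le_max_of_le_right ?_⟩
      refine (h.le_opNorm _).trans ?_
      gcongr
      exact (norm_sub_le _ _).trans (add_le_add hx.2.le (hx.1.2.1 a ha)))
    exact ⟨g, hg, fun x hx hxG => hgf x hx (not_not.2 hxG)⟩
  choose g hg hgf using hgh
  have hvan : ∀ h, g h ∈ vanishingSpace (closure {q | q ∈ Y ∧ q.1 ∈ G}) W := by
    refine fun h => ⟨hg h, fun x hx => ?_⟩
    by_contra hne
    obtain ⟨y, ⟨hyY, hyG⟩, hy0, hyW⟩ := ((mem_closure_iff_frequently.1 hx.1).and_eventually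
      (((hg h x hx.2).continuousAt.eventually_ne hne).and (hWo.mem_nhds hx.2))).exists
    refine hy0 ?_
    rw [hgf h y hyW hyG]
    exact finprod_mem_eq_zero' (finite_of_encard_le_coe (hWW₀ hyW).1.2.2) (l := y.2) hyY (by simp)
  refine ⟨W, hWo, hxW, fun z hzW hz => ?_⟩
  suffices ∃ h, g h z ≠ 0 by
    obtain ⟨h, hh⟩ := this
    exact ⟨g h, hvan h, hh⟩
  obtain ⟨ε, hε, hεz⟩ := Metric.isOpen_iff.1 isClosed_closure.isOpen_compl z hz
  have hzG : (𝓝[G] z.1).NeBot := mem_closure_iff_nhdsWithin_neBot.1 (hWW₀ hzW).1.1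
  have hsec : Tendsto (fun w => (w, z.2)) (𝓝[G] z.1) (𝓝 z) := by
    have : ContinuousAt (fun w : E => (w, z.2)) z.1 := by fun_prop
    exact this.tendsto.mono_left nhdsWithin_le_nhds
  have hbase : ∀ᶠ w in 𝓝[G] z.1, w ∈ G ∧ w ∈ ball z.1 ε ∧ (w, z.2) ∈ W := by
    filter_upwards [eventually_mem_nhdsWithin, mem_nhdsWithin_of_mem_nhds (ball_mem_nhds z.1 hε),
      hsec.eventually (hWo.mem_nhds hzW)] with w h1 h2 h3 using ⟨h1, h2, h3⟩
  have hlim : ∀ h, Tendsto (fun w => g h (w, z.2)) (𝓝[G] z.1) (𝓝 (g h z)) := fun h =>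
    (hg h z hzW).continuousAt.tendsto.comp hsec
  by_cases hempty : ∃ᶠ w in 𝓝[G] z.1, {a | (w, a) ∈ Y} = ∅
  · refine ⟨0, fun h0 => ?_⟩
    have h1 := (hlim 0).eventually_ne (show g 0 z ≠ 1 by simp [h0])
    obtain ⟨w, hw, hw1, hw2, -, hw3⟩ := (hempty.and_eventually (h1.and hbase)).exists
    refine hw1 ?_
    rw [hgf 0 _ hw3 hw2]
    simp only [hw, finprod_mem_empty]
  rw [not_frequently] at hempty
  have henum : ∀ᶠ w in 𝓝[G] z.1, ∃ e : Fin N → Fin k → ℂ, {a | (w, a) ∈ Y} = range e := by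
    filter_upwards [hempty, hbase] with w hw hwW
    have hT := (hWW₀ hwW.2.2).1.2.2
    have hfin : {a | (w, a) ∈ Y}.Finite := finite_of_encard_le_coe hT
    have := hfin.fintype
    have : Nonempty {a | (w, a) ∈ Y} := (nonempty_iff_ne_empty.2 hw).to_subtype
    obtain ⟨φ⟩ := Function.Embedding.nonempty_of_card_le (α := {a | (w, a) ∈ Y}) (β := Fin N) (by
      rw [Fintype.card_fin, ← Nat.card_eq_fintype_card, Nat.card_coe_set_eq]
      rw [← hfin.cast_ncard_eq] at hT
      exact_mod_cast hT)
    refine ⟨fun i => (Function.invFun φ i : {a | (w, a) ∈ Y}), ?_⟩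
    ext a
    constructor
    · intro ha
      obtain ⟨i, hi⟩ := Function.invFun_surjective φ.injective ⟨a, ha⟩
      exact ⟨i, by simp [hi]⟩
    · rintro ⟨i, rfl⟩
      exact (Function.invFun φ i).2
  obtain ⟨e, he⟩ := henum.choice
  set U := Ultrafilter.of (𝓝[G] z.1) with hU
  have hUle : (U : Filter E) ≤ 𝓝[G] z.1 := Ultrafilter.of_le _
  replace he := he.filter_mono hUle
  have hbaseU := hbase.filter_mono hUle
  have hball : ∀ᶠ w in (U : Filter E), e w ∈ closedBall (0 : Fin N → Fin k → ℂ) (max C 0) := by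
    filter_upwards [he, hbaseU] with w hw hwW
    rw [mem_closedBall_zero_iff, pi_norm_le_iff_of_nonneg (le_max_right _ _)]
    intro i
    have : e w i ∈ {a | (w, a) ∈ Y} := hw ▸ mem_range_self i
    exact le_max_of_le_left ((hWW₀ hwW.2.2).1.2.1 _ this)
  obtain ⟨y, -, hy⟩ := (isCompact_closedBall (0 : Fin N → Fin k → ℂ) (max C 0)).ultrafilter_le_nhds'
    (U.map e) hball
  have hy : Tendsto e U (𝓝 y) := hy
  have hyi : ∀ i, Tendsto (fun w => e w i) U (𝓝 (y i)) := fun i => (tendsto_pi_nhds.1 hy) i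
  have hne : ∀ i, z.2 - y i ≠ 0 := fun i h0 => by
    have hlt : ∀ᶠ w in (U : Filter E), e w i ∈ ball z.2 ε := (hyi i).eventually
      (by rw [← sub_eq_zero.1 h0]; exact ball_mem_nhds _ hε)
    obtain ⟨w, hw, hwG, hw1⟩ := (hlt.and ((hbaseU).and (he))).exists
    refine hεz (show (w, e w i) ∈ ball z ε from ?_) (subset_closure ⟨?_, hwG.1⟩)
    · rw [← ball_prod_same]
      exact ⟨hwG.2.1, hw⟩
    · have : e w i ∈ {a | (w, a) ∈ Y} := hw1 ▸ mem_range_self i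
      exact this
  obtain ⟨h, hh⟩ := exists_clm_forall_ne_zero hne
  refine ⟨h, fun h0 => ?_⟩
  obtain ⟨c, hc, hc1, hcy⟩ : ∃ c : ℝ, 0 < c ∧ c ≤ 1 ∧ ∀ i, c < ‖h (z.2 - y i)‖ := by
    have : ∀ᶠ c in 𝓝[>] (0 : ℝ), ∀ i, c < ‖h (z.2 - y i)‖ := eventually_all.2 fun i =>
      mem_nhdsWithin_of_mem_nhds (Iio_mem_nhds (norm_pos_iff.2 (hh i)))
    obtain ⟨c, h1, h2⟩ := (this.and (Ioc_mem_nhdsGT (zero_lt_one' ℝ))).exists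
    exact ⟨c, h2.1, h2.2, h1⟩
  have hev : ∀ᶠ w in (U : Filter E), ∀ i, c < ‖h (z.2 - e w i)‖ := eventually_all.2 fun i => by
    have : Tendsto (fun w => ‖h (z.2 - e w i)‖) U (𝓝 ‖h (z.2 - y i)‖) :=
      ((h.continuous.tendsto _).comp (tendsto_const_nhds.sub (hyi i))).norm
    exact this.eventually_const_lt (hcy i)
  have hsmall : ∀ᶠ w in (U : Filter E), ‖g h (w, z.2)‖ < c ^ N :=
    ((hlim h).norm.mono_left hUle).eventually_lt_const (by rw [h0, norm_zero]; positivity)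
  obtain ⟨w, hw1, hw2, hw3, hw4⟩ := (hev.and (hsmall.and ((he).and (hbaseU)))).exists
  rw [hgf h _ hw4.2.2 hw4.1] at hw2
  refine absurd (le_norm_finprod_mem hc hc1 (hWW₀ hw4.2.2).1.2.2 ?_) (not_le.2 hw2)
  intro l hl
  have hl' : l ∈ range (e w) := hw3 ▸ hl
  obtain ⟨i, rfl⟩ := hl'
  exact (hw1 i).le

end Removable

section Closure

variable {E V : Type*} [NormedAddCommGroup E] [NormedSpace ℂ E]
  [NormedAddCommGroup V] [NormedSpace ℂ V]

theorem HolAt.exists_line_ne {γ : E → ℂ} {w₀ : E} (hγ : HolAt γ w₀) (h0 : ∃ᶠ w in 𝓝 w₀, γ w ≠ 0) :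
    ∃ v, ∀ᶠ s in 𝓝[≠] (0 : ℂ), γ (w₀ + s • v) ≠ 0 := by
  obtain ⟨r, hr, hball⟩ := hγ.exists_ball
  obtain ⟨w, hw, hwr⟩ := (h0.and_eventually (ball_mem_nhds w₀ hr)).exists
  refine ⟨w - w₀, ?_⟩
  set U : Set ℂ := {s | w₀ + s • (w - w₀) ∈ ball w₀ r}
  have hU : U = (ContinuousLinearMap.toSpanSingleton ℂ (w - w₀)).toLinearMap ⁻¹' ball 0 r := by
    ext s
    simp [U]
  have hconv : Convex ℝ U := by
    rw [hU]
    exact (convex_ball (0 : E) r).linear_preimage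
      ((ContinuousLinearMap.toSpanSingleton ℂ (w - w₀)).toLinearMap.restrictScalars ℝ)
  have hhol : ∀ s ∈ U, HolAt (fun t : ℂ => γ (w₀ + t • (w - w₀))) s := fun s hs =>
    HolAt.line (hball _ hs)
  have h0U : (0 : ℂ) ∈ U := by simp [U, hr]
  have h1U : (1 : ℂ) ∈ U := by simpa [U, dist_eq_norm] using hwr
  refine (hhol 0 h0U).analyticAt.eventually_eq_zero_or_eventually_ne_zero.resolve_left fun h => ?_
  exact hw (by simpa using eq_zero_of_convex_of_eventuallyEq hconv hhol h0U h 1 h1U)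

/-- Near a point isolated in its fibre, the difference of two analytic sets is contained in an
analytic subset of its closure, up to points over a thin subset of the base. -/
theorem exists_locAnalyticAt_subset_closure_sdiff [ProperSpace E] {k : ℕ}
    {Z X : Set (E × (Fin k → ℂ))} {w₀ : E}
    {l₀ : Fin k → ℂ} (hZ : LocAnalyticAt Z (w₀, l₀)) (hX : LocAnalyticAt X (w₀, l₀))
    (hiso : ∀ᶠ l in 𝓝 l₀, (w₀, l) ∈ Z → l = l₀) :
    ∃ X' ⊆ closure (Z \ X), IsClosed X' ∧ LocAnalyticAt X' (w₀, l₀) ∧ ∃ γ : E → ℂ, HolAt γ w₀ ∧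
      (∃ᶠ w in 𝓝 w₀, γ w ≠ 0) ∧
      ∀ᶠ q in 𝓝 (w₀, l₀), q ∈ Z \ X → q ∈ X' ∨ γ q.1 = 0 := by
  have hcont : ContinuousAt (fun l : Fin k → ℂ => (w₀, l)) l₀ := by fun_prop
  obtain ⟨ε, hε, hεb⟩ := Metric.eventually_nhds_iff_ball.1
    (hiso.and (hcont.eventually hZ.eventually))
  set Z' : Set (E × (Fin k → ℂ)) := {q | q ∈ Z ∧ q.2 ∈ closedBall l₀ (ε / 2)} with hZ'
  have hl₀ : ∀ l, (w₀, l) ∈ Z' → l = l₀ := fun l hl =>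
    (hεb l (closedBall_subset_ball (by linarith) hl.2)).1 hl.1
  have hsnd : ∀ l : Fin k → ℂ, Tendsto Prod.snd (𝓝 (w₀, l)) (𝓝 l) := fun l => continuousAt_snd
  have hnear : ∀ᶠ q in 𝓝 (w₀, l₀), q.2 ∈ closedBall l₀ (ε / 2) :=
    (hsnd l₀).eventually (closedBall_mem_nhds l₀ (by positivity))
  have hprop : ProperAt Z' w₀ := by
    refine ⟨fun l => ?_, ‖l₀‖ + ε / 2, Eventually.of_forall fun w l hl => ?_⟩
    · by_cases hl : l = l₀
      · subst hl
        refine hZ.congr ?_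
        filter_upwards [hnear] with q hq
        exact ⟨fun h => ⟨h, hq⟩, fun h => h.1⟩
      · by_cases hlr : l ∈ closedBall l₀ (ε / 2)
        · obtain ⟨h1, h2⟩ := hεb l (closedBall_subset_ball (by linarith) hlr)
          refine .of_eventually_notMem ?_
          filter_upwards [h2.eventually_notMem.self_of_nhds fun h => hl (h1 h)] with q hq hq'
          exact hq hq'.1
        · refine .of_eventually_notMem ?_
          filter_upwards [(hsnd l).eventually (isClosed_closedBall.isOpen_compl.mem_nhds hlr)]
            with q hq hq'
          exact hq hq'.2
    · have h1 := norm_le_norm_add_norm_sub' l l₀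
      have h2 := hl.2
      rw [mem_closedBall, dist_eq_norm] at h2
      linarith
  obtain ⟨hthin, hN⟩ := hprop.thinAt_not_sheetedAt (X := X) fun l hl => by rwa [hl₀ l hl]
  set G := {w | SheetedAt (Z' \ X) w} with hG
  have hthin : ThinAt Gᶜ w₀ := hthin
  refine ⟨closure {q | q ∈ Z' \ X ∧ q.1 ∈ G}, closure_mono fun q hq => ⟨hq.1.1.1, hq.1.2⟩,
    isClosed_closure, locAnalyticAt_closure_of_removableAt (fun w hw => hw) ?_
      (ThinAt.fst (p := (w₀, l₀)) hthin).removableAt ?_ ?_, ?_⟩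
  · filter_upwards [hthin.eventually] with w hw
    exact mem_closure_iff_frequently.2 (hw.frequently_notMem.mono fun _ h => not_not.1 h)
  · obtain ⟨C, hC⟩ := hprop.bounded
    exact ⟨C, hC.mono fun w hw l hl => hw l hl.1⟩
  · obtain ⟨N, hN⟩ := hN
    exact ⟨N, hN.mono fun w hw => (encard_le_encard fun l hl => hl.1).trans hw⟩
  · obtain ⟨γ, h1, h2, h3⟩ := hthin
    refine ⟨γ, h1, h2, ?_⟩
    filter_upwards [hnear, eventually_nhds_fst l₀ h3] with q hq hq3 hqZ
    by_cases hqG : q.1 ∈ G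
    · exact .inl (subset_closure ⟨⟨⟨hqZ.1, hq⟩, hqZ.2⟩, hqG⟩)
    · exact .inr (hq3 hqG)

/-- Coordinates adapted to a subspace. -/
theorem exists_clm_equiv_prod [FiniteDimensional ℂ V] (L : Submodule ℂ V) :
    ∃ (M : Submodule ℂ V) (k : ℕ) (ψ : (M × (Fin k → ℂ)) ≃L[ℂ] V),
      ∀ w l, ψ (w, l) ∈ L ↔ w = 0 := by
  obtain ⟨M, hM⟩ := L.exists_isCompl
  have e := (Module.finBasis ℂ L).equivFun.symm
  refine ⟨M, _, ((LinearEquiv.refl ℂ M).prodCongr e ≪≫ₗ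
    Submodule.prodEquivOfIsCompl M L hM.symm).toContinuousLinearEquiv, fun w l => ?_⟩
  have : (w : V) + e l ∈ L ↔ w = 0 := by
    rw [Submodule.add_mem_iff_left _ (e l).2]
    constructor
    · intro h
      exact Subtype.ext ((Submodule.disjoint_def.1 hM.disjoint) _ h w.2)
    · rintro rfl
      simp
  simpa using this

theorem mem_sup_span_iff {E F : Type*} [NormedAddCommGroup E] [NormedSpace ℂ E]
    [NormedAddCommGroup F] [NormedSpace ℂ F] {L : Submodule ℂ V} (ψ : (E × F) ≃L[ℂ] V)
    (hψ : ∀ w l, ψ (w, l) ∈ L ↔ w = 0) {v w : E} {l : F}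
    (h : ψ (w, l) ∈ L ⊔ Submodule.span ℂ {ψ (v, 0)}) : ∃ s : ℂ, w = s • v := by
  obtain ⟨y, hy, z, hz, hyz⟩ := Submodule.mem_sup.1 h
  obtain ⟨s, rfl⟩ := Submodule.mem_span_singleton.1 hz
  refine ⟨s, ?_⟩
  have : ψ (w - s • v, l) = y := by
    rw [eq_sub_of_add_eq hyz, ← map_smul, ← map_sub]
    simp
  exact sub_eq_zero.1 ((hψ _ l).1 (this ▸ hy))

/-- The closure of a difference of analytic sets is analytic. -/
theorem LocAnalyticAt.closure_sdiff_of_isolated [FiniteDimensional ℂ V] {X : Set V} {p : V}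
    (hX : LocAnalyticAt X p) : ∀ (d : ℕ) (L : Submodule ℂ V) (Z : Set V),
    Module.finrank ℂ V < Module.finrank ℂ L + d →
    LocAnalyticAt Z p → (∀ᶠ x in 𝓝 p, x ∈ Z → x - p ∈ L → x = p) →
    LocAnalyticAt (closure (Z \ X)) p := by
  intro d
  induction d with
  | zero => exact fun L _ h => absurd h (not_lt.2 L.finrank_le)
  | succ d ih =>
    intro L Z hd hZ hiso
    obtain ⟨M, k, ψ, hψ⟩ := exists_clm_equiv_prod L
    obtain ⟨⟨w₀, l₀⟩, rfl⟩ := ψ.surjective p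
    have hψs : ψ.symm (ψ (w₀, l₀)) = (w₀, l₀) := ψ.symm_apply_apply _
    have hpull : ∀ {A : Set V}, LocAnalyticAt A (ψ (w₀, l₀)) → LocAnalyticAt (ψ ⁻¹' A) (w₀, l₀) :=
      fun h => h.preimage (.of_clm ψ.toContinuousLinearMap _)
    have hpush : ∀ {A : Set (M × (Fin k → ℂ))}, LocAnalyticAt A (w₀, l₀) →
        LocAnalyticAt (ψ.symm ⁻¹' A) (ψ (w₀, l₀)) :=
      fun h => LocAnalyticAt.preimage (by rwa [hψs]) (.of_clm ψ.symm.toContinuousLinearMap _)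
    obtain ⟨X', hX'sub, hX'cl, hX', γ, hγ, hγ0, hcov⟩ :=
      exists_locAnalyticAt_subset_closure_sdiff (hpull hZ) (hpull hX) (by
        have : ContinuousAt (fun l : Fin k → ℂ => ψ (w₀, l)) l₀ := by fun_prop
        filter_upwards [this.eventually hiso] with l hl hlZ
        have := hl hlZ (by rw [← map_sub, Prod.mk_sub_mk, hψ, sub_self])
        simpa using ψ.injective this)
    set Z₂ : Set V := Z ∩ ψ.symm ⁻¹' {q | γ q.1 = 0} with hZ₂
    have hγ' : HolAt (fun q : M × (Fin k → ℂ) => γ q.1) (w₀, l₀) :=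
      HolAt.comp (u := Prod.fst) hγ (.of_differentiable differentiable_fst)
    have hZ₂an : LocAnalyticAt Z₂ (ψ (w₀, l₀)) := hZ.inter (hpush (.zeroSet hγ'))
    have hψt : Tendsto ψ.symm (𝓝 (ψ (w₀, l₀))) (𝓝 (w₀, l₀)) := by
      have := ψ.symm.continuous.tendsto (ψ (w₀, l₀))
      rwa [hψs] at this
    have hX'V : ψ.symm ⁻¹' X' ⊆ closure (Z \ X) := by
      intro x hx
      have := hX'sub hx
      rw [← preimage_sdiff] at this
      have h2 := (ψ.continuous.closure_preimage_subset _) this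
      simpa using h2
    have key : LocAnalyticAt (closure (Z₂ \ X)) (ψ (w₀, l₀)) := by
      by_cases hw₀ : γ w₀ = 0
      · obtain ⟨v, hv⟩ := hγ.exists_line_ne hγ0
        have hv0 : v ≠ 0 := by
          rintro rfl
          obtain ⟨s, hs⟩ := hv.exists
          simp [hw₀] at hs
        refine ih (L ⊔ Submodule.span ℂ {ψ (v, 0)}) Z₂ ?_ hZ₂an ?_
        · have : L < L ⊔ Submodule.span ℂ {ψ (v, 0)} := by
            rw [left_lt_sup, Submodule.span_singleton_le_iff_mem, hψ]
            exact hv0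
          have := Submodule.finrank_lt_finrank_of_lt this
          omega
        · rw [eventually_nhdsWithin_iff] at hv
          obtain ⟨δ, hδ, hδv⟩ := Metric.eventually_nhds_iff_ball.1 hv
          have hvn : 0 < ‖v‖ := norm_pos_iff.2 hv0
          filter_upwards [hiso, hψt.eventually (eventually_nhds_fst l₀
            (ball_mem_nhds w₀ (mul_pos hδ hvn)))] with x hx hxδ hxZ hxL
          obtain ⟨⟨w, l⟩, rfl⟩ := ψ.surjective x
          rw [← map_sub, Prod.mk_sub_mk] at hxL
          obtain ⟨s, hs⟩ := mem_sup_span_iff ψ hψ hxL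
          have hw : w = w₀ + s • v := by rw [← hs]; abel
          have hsδ : s ∈ ball (0 : ℂ) δ := by
            rw [ContinuousLinearEquiv.symm_apply_apply, dist_eq_norm, hs, norm_smul] at hxδ
            rw [mem_ball_zero_iff]
            exact lt_of_mul_lt_mul_right hxδ hvn.le
          have hs0 : s = 0 := by
            by_contra hs0
            refine hδv s hsδ hs0 ?_
            have := hxZ.2
            simpa [← hw] using this
          refine hx hxZ.1 ?_
          rw [← map_sub, Prod.mk_sub_mk, hψ, hs, hs0, zero_smul]
      · refine .of_eventually_notMem ?_
        have := hψt.eventually (hγ'.continuousAt.eventually_ne hw₀)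
        filter_upwards [this.eventually_nhds] with x hx hxc
        obtain ⟨y, hy, hy'⟩ := ((mem_closure_iff_frequently.1 hxc).and_eventually hx).exists
        exact hy' hy.1.2
    refine ((hpush hX').union key).congr ?_
    filter_upwards [(hψt.eventually hcov).eventually_nhds] with x hx
    refine ⟨fun h => h.elim (fun h => hX'V h) fun h =>
      closure_mono (sdiff_subset_sdiff_left inter_subset_left) h, fun h => ?_⟩
    have h1 : x ∈ closure (ψ.symm ⁻¹' X' ∪ (Z₂ \ X)) := by
      refine mem_closure_iff_frequently.2 (((mem_closure_iff_frequently.1 h).and_eventually hx).mono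
        fun y hy => ?_)
      rcases hy.2 (by simpa using hy.1) with h | h
      · exact .inl h
      · exact .inr ⟨⟨hy.1.1, h⟩, hy.1.2⟩
    rw [closure_union, (hX'cl.preimage ψ.symm.continuous).closure_eq] at h1
    exact h1

theorem LocAnalyticAt.closure_sdiff [FiniteDimensional ℂ V] {Z X : Set V} {p : V}
    (hZ : LocAnalyticAt Z p) (hX : LocAnalyticAt X p) : LocAnalyticAt (closure (Z \ X)) p :=
  hX.closure_sdiff_of_isolated (Module.finrank ℂ V + 1) ⊥ Z (by simp) hZ
    (Eventually.of_forall fun x _ h => by simpa [sub_eq_zero] using h)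

end Closure

section Cone

variable {E F V : Type*} [NormedAddCommGroup E] [NormedSpace ℂ E]
  [NormedAddCommGroup F] [NormedSpace ℂ F] [NormedAddCommGroup V] [NormedSpace ℂ V]

/-- Invariance under multiplication by nonzero scalars. -/
def IsConic (A : Set V) : Prop := ∀ c : ℂ, c ≠ 0 → ∀ a ∈ A, c • a ∈ A

theorem IsConic.smul_mem_iff {A : Set V} (h : IsConic A) {c : ℂ} (hc : c ≠ 0) {a : V} :
    c • a ∈ A ↔ a ∈ A :=
  ⟨fun h1 => by simpa [smul_smul, hc] using h c⁻¹ (inv_ne_zero hc) _ h1, h c hc a⟩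

theorem isConic_closure {A : Set V} (h : IsConic A) : IsConic (closure A) := fun c hc _ ha =>
  map_mem_closure (continuous_const_smul c) ha (h c hc)

theorem IsConic.exists_norm_le {k : ℕ} {Z : Set (E × (Fin k → ℂ))} (hZ : IsConic Z)
    (han : ∀ l, l ≠ 0 → LocAnalyticAt Z (0, l)) (h0 : ∀ l, (0, l) ∉ Z) :
    ∃ C : ℝ, 0 ≤ C ∧ ∀ w l, (w, l) ∈ Z → ‖l‖ ≤ C * ‖w‖ := by
  have hev : ∀ᶠ w in 𝓝 (0 : E), ∀ l ∈ sphere (0 : Fin k → ℂ) 1, (w, l) ∉ Z :=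
    (isCompact_sphere _ _).eventually_forall_of_forall_eventually fun l hl =>
      (han l (ne_zero_of_mem_unit_sphere ⟨l, hl⟩)).eventually_notMem.self_of_nhds (h0 l)
  obtain ⟨δ, hδ, hδZ⟩ := Metric.eventually_nhds_iff_ball.1 hev
  refine ⟨δ⁻¹, by positivity, fun w l hl => ?_⟩
  by_contra! hlt
  have hl0 : 0 < ‖l‖ := lt_of_le_of_lt (by positivity) hlt
  have hl0' : (‖l‖ : ℂ) ≠ 0 := by exact_mod_cast hl0.ne'
  refine hδZ ((‖l‖ : ℂ)⁻¹ • w) ?_ ((‖l‖ : ℂ)⁻¹ • l) ?_ (hZ _ (inv_ne_zero hl0') _ hl)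
  · rw [mem_ball_zero_iff, norm_smul, norm_inv, Complex.norm_real, norm_norm,
      inv_mul_lt_iff₀ hl0, mul_comm]
    rwa [inv_mul_lt_iff₀ hδ] at hlt
  · rw [mem_sphere_zero_iff_norm, norm_smul, norm_inv, Complex.norm_real, norm_norm,
      inv_mul_cancel₀ hl0.ne']

theorem IsConic.sheetedAt_smul {Z : Set (E × F)} (hZ : IsConic Z) {w : E} (h : SheetedAt Z w)
    {c : ℂ} (hc : c ≠ 0) : SheetedAt Z (c • w) := by
  obtain ⟨ι, hι, s, hs⟩ := h
  have ht : Tendsto (fun x => c⁻¹ • x) (𝓝 (c • w)) (𝓝 w) := by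
    have := (continuous_const_smul (T := E) c⁻¹).tendsto (c • w)
    rwa [inv_smul_smul₀ hc] at this
  refine ⟨ι, hι, fun i x => c • s i (c⁻¹ • x), fun i => ?_, ?_, ?_⟩
  · have h1 : HolAt (s i) (c⁻¹ • c • w) := by
      rw [inv_smul_smul₀ hc]
      exact hs.holAt i
    exact HolAt.comp (f := fun y : F => c • y) (.of_differentiable (by fun_prop))
      (HolAt.comp (u := fun x => c⁻¹ • x) h1 (.of_differentiable (by fun_prop)))
  · filter_upwards [ht.eventually hs.injective] with x hx i j hij
    exact hx (smul_right_injective F hc hij)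
  · filter_upwards [ht.eventually hs.mem_iff] with x hx l
    have h1 : (x, l) ∈ Z ↔ (c⁻¹ • x, c⁻¹ • l) ∈ Z := (hZ.smul_mem_iff (inv_ne_zero hc)).symm
    rw [h1, hx]
    refine exists_congr fun i => ?_
    rw [eq_inv_smul_iff₀ hc]

theorem thinAt_singleton_zero [Nontrivial E] : ThinAt ({0} : Set E) 0 := by
  obtain ⟨v, hv⟩ := exists_ne (0 : E)
  obtain ⟨f, -, hf⟩ := exists_dual_vector ℂ v (norm_ne_zero_iff.2 hv)
  refine ⟨f, .of_clm f 0, fun h0 => ?_, Eventually.of_forall fun w hw => ?_⟩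
  · have := eq_zero_of_convex_of_eventuallyEq (f := f) (convex_univ)
      (fun x _ => .of_clm f x) (mem_univ 0) (h0.mono fun _ h => not_not.1 h) v trivial
    rw [hf] at this
    simp [hv] at this
  · rw [mem_singleton_iff.1 hw, map_zero]

theorem IsConic.exists_encard_le [ProperSpace E] {Z : Set (E × F)} (hZ : IsConic Z)
    (h0 : ∀ l, (0, l) ∉ Z)
    (hloc : ∀ w ≠ 0, ∃ N : ℕ, ∀ᶠ x in 𝓝 w, {l | (x, l) ∈ Z}.encard ≤ N) :
    ∃ N : ℕ, ∀ w, {l | (w, l) ∈ Z}.encard ≤ N := by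
  have hsph : ∃ N : ℕ, ∀ w ∈ sphere (0 : E) 1, {l | (w, l) ∈ Z}.encard ≤ N := by
    refine (isCompact_sphere (0 : E) 1).induction_on
      (p := fun s => ∃ N : ℕ, ∀ w ∈ s, {l | (w, l) ∈ Z}.encard ≤ N) ⟨0, by simp⟩ ?_ ?_ ?_
    · rintro s t hst ⟨N, hN⟩
      exact ⟨N, fun w hw => hN w (hst hw)⟩
    · rintro s t ⟨N, hN⟩ ⟨N', hN'⟩
      refine ⟨max N N', fun w hw => hw.elim (fun h => (hN w h).trans ?_)
        fun h => (hN' w h).trans ?_⟩ <;> simp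
    · intro w hw
      obtain ⟨N, hN⟩ := hloc w (ne_zero_of_mem_unit_sphere ⟨w, hw⟩)
      exact ⟨_, mem_nhdsWithin_of_mem_nhds hN, N, fun x hx => hx⟩
  obtain ⟨N, hN⟩ := hsph
  refine ⟨N, fun w => ?_⟩
  by_cases hw : w = 0
  · simp [hw, h0]
  have hw' : (‖w‖ : ℂ)⁻¹ ≠ 0 := by simp [hw]
  have hsub : {l | (w, l) ∈ Z} ⊆ (fun l => (‖w‖ : ℂ) • l) '' {l | ((‖w‖ : ℂ)⁻¹ • w, l) ∈ Z} :=
    fun l hl => ⟨(‖w‖ : ℂ)⁻¹ • l, hZ _ hw' _ hl, by simp [smul_smul, hw]⟩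
  refine (encard_le_encard hsub).trans ((encard_image_le _ _).trans (hN _ ?_))
  rw [mem_sphere_zero_iff_norm, norm_smul, norm_inv, Complex.norm_real, norm_norm,
    inv_mul_cancel₀ (norm_ne_zero_iff.2 hw)]

/-- An analytic cone disjoint from the fibre over `0` contains, up to its boundary, an analytic cone
which agrees with it over a punctured line in the base. -/
theorem IsConic.exists_locAnalyticAt [ProperSpace E] [Nontrivial E] {k : ℕ}
    {Z : Set (E × (Fin k → ℂ))}
    (hZ : IsConic Z) (han : ∀ q ≠ 0, LocAnalyticAt Z q) (h0 : ∀ l, (0, l) ∉ Z) :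
    ∃ X' ⊆ closure Z, IsConic X' ∧ (∀ q, LocAnalyticAt X' q) ∧ ∃ v : E, v ≠ 0 ∧
      ∀ s : ℂ, s ≠ 0 → ∀ l, ∀ᶠ q in 𝓝 (s • v, l), q ∈ Z → q ∈ X' := by
  obtain ⟨C, hC0, hC⟩ := hZ.exists_norm_le (fun l hl => han _ (by simpa using hl)) h0
  have hbdd : ∀ w₀ : E, ∃ C' : ℝ, ∀ᶠ w in 𝓝 w₀, ∀ l, (w, l) ∈ Z → ‖l‖ ≤ C' := by
    refine fun w₀ => ⟨C * (‖w₀‖ + 1), ?_⟩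
    have : ∀ᶠ w in 𝓝 w₀, ‖w‖ < ‖w₀‖ + 1 := continuous_norm.continuousAt.eventually_lt_const
      (lt_add_one _)
    filter_upwards [this] with w hw l hl
    exact (hC w l hl).trans (by gcongr)
  have hprop : ∀ w ≠ 0, ProperAt Z w := fun w hw =>
    ⟨fun l => han _ (by simp [hw]), hbdd w⟩
  have hT : ∀ w ≠ 0, ThinAt {w | ¬ SheetedAt Z w} w ∧
      ∃ N : ℕ, ∀ᶠ x in 𝓝 w, {l | (x, l) ∈ Z}.encard ≤ N := fun w hw => by
    have := (hprop w hw).thinAt_not_sheetedAt (X := ∅)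
      fun l _ => .of_eventually_notMem (by simp)
    simpa using this
  obtain ⟨N, hN⟩ := hZ.exists_encard_le h0 fun w hw => (hT w hw).2
  set G : Set E := {w | SheetedAt Z w ∧ w ≠ 0} with hG
  have hGs : ∀ w ∈ G, ∀ c : ℂ, c ≠ 0 → c • w ∈ G := fun w hw c hc =>
    ⟨hZ.sheetedAt_smul hw.1 hc, smul_ne_zero hc hw.2⟩
  have hthin : ∀ w ≠ 0, ThinAt Gᶜ w := fun w hw => (hT w hw).1.mono' (by
    filter_upwards [eventually_ne_nhds hw] with x hx hxG hxs
    exact hxG ⟨hxs, hx⟩)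
  have hdense : Dense G := by
    have h1 : ({0}ᶜ : Set E) ⊆ closure G := fun w hw => mem_closure_iff_frequently.2
      ((hthin w hw).frequently_notMem.mono fun _ h => not_not.1 h)
    have : (𝓝[≠] (0 : E)).NeBot := Module.punctured_nhds_neBot ℂ E 0
    exact fun w => closure_minimal h1 isClosed_closure (dense_compl_singleton (0 : E) w)
  refine ⟨closure {q | q ∈ Z ∧ q.1 ∈ G}, closure_mono fun q hq => hq.1, ?_, ?_, ?_⟩
  · exact isConic_closure fun c hc q hq => ⟨hZ c hc q hq.1, hGs _ hq.2 c hc⟩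
  · rintro ⟨w, l⟩
    refine locAnalyticAt_closure_of_removableAt (fun w hw => hw.1)
      (Eventually.of_forall hdense) ?_ (hbdd w) ⟨N, Eventually.of_forall hN⟩
    by_cases hw : w = 0
    · subst hw
      refine .of_thinAt (T := Prod.fst ⁻¹' {0}) (isClosed_singleton.preimage continuous_fst) ?_
        (ThinAt.fst (p := (0, l)) thinAt_singleton_zero) (Eventually.of_forall fun q hq =>
          (hthin q.1 hq).fst)
      intro q hq hqG
      exact hqG.2 hq
    · exact (ThinAt.fst (p := (w, l)) (hthin w hw)).removableAt
  · obtain ⟨v, hv⟩ := hdense.nonempty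
    refine ⟨v, hv.2, fun s hs l => ?_⟩
    have h1 : ∀ᶠ w in 𝓝 (s • v), w ∈ G :=
      (hZ.sheetedAt_smul hv.1 hs).eventually.and (eventually_ne_nhds (smul_ne_zero hs hv.2))
    filter_upwards [eventually_nhds_fst l h1] with q hq hqZ
    exact subset_closure ⟨hqZ, hq⟩

theorem LocAnalyticAt.singleton [FiniteDimensional ℂ V] (x : V) :
    LocAnalyticAt ({0} : Set V) x := by
  have e := (Module.finBasis ℂ V).equivFun.toContinuousLinearEquiv
  refine ((LocAnalyticAt.singleton_zero (e x)).preimage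
    (.of_clm e.toContinuousLinearMap x)).congr (Eventually.of_forall fun y => ?_)
  simp

theorem locAnalyticAt_zero_of_disjoint [FiniteDimensional ℂ V] : ∀ (d : ℕ) (L : Submodule ℂ V)
    (A : Set V), Module.finrank ℂ V < Module.finrank ℂ L + d → IsConic A →
    (∀ x ≠ 0, LocAnalyticAt A x) → (∀ x ∈ A, x ∉ L) → LocAnalyticAt (A ∪ {0}) 0 := by
  intro d
  induction d with
  | zero => exact fun L _ h => absurd h (not_lt.2 L.finrank_le)
  | succ d ih =>
    intro L A hd hA han hAL
    obtain ⟨M, k, ψ, hψ⟩ := exists_clm_equiv_prod L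
    rcases subsingleton_or_nontrivial M with hM | hM
    · have : A = ∅ := by
        refine eq_empty_of_forall_notMem fun x hx => hAL x hx ?_
        obtain ⟨⟨w, l⟩, rfl⟩ := ψ.surjective x
        rw [hψ]
        exact Subsingleton.elim _ _
      rw [this, empty_union]
      exact .singleton 0
    obtain ⟨X', hX'sub, hX'c, hX', v, hv, hvX⟩ := IsConic.exists_locAnalyticAt (Z := ψ ⁻¹' A)
      (fun c hc q hq => by simpa using hA c hc _ hq)
      (fun q hq => (han (ψ q) (by simpa using hq)).preimage (.of_clm ψ.toContinuousLinearMap _))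
      (fun l hl => hAL _ hl ((hψ _ _).2 rfl))
    have hX'V : ψ.symm ⁻¹' X' ⊆ closure A := by
      intro x hx
      have h2 := (ψ.continuous.closure_preimage_subset _) (hX'sub hx)
      simpa using h2
    have hcl : ∀ x ∈ closure A, x ≠ 0 → x ∈ A := fun x hx hx0 =>
      (han x hx0).mem_of_frequently (mem_closure_iff_frequently.1 hx)
    have hXan : ∀ x, LocAnalyticAt (ψ.symm ⁻¹' X') x := fun x =>
      (hX' _).preimage (.of_clm ψ.symm.toContinuousLinearMap _)
    set A₂ : Set V := closure (A \ ψ.symm ⁻¹' X') \ {0} with hA₂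
    have hA₂c : IsConic A₂ := by
      have h1 : IsConic (A \ ψ.symm ⁻¹' X') := fun c hc a ha =>
        ⟨hA c hc a ha.1, fun h => ha.2 ((hX'c.smul_mem_iff hc).1 (by simpa using h))⟩
      exact fun c hc a ha => ⟨isConic_closure h1 c hc a ha.1, by simpa [hc] using ha.2⟩
    have hIH : LocAnalyticAt (A₂ ∪ {0}) 0 := by
      refine ih (L ⊔ Submodule.span ℂ {ψ (v, 0)}) A₂ ?_ hA₂c (fun x hx => ?_) fun x hx hxL => ?_
      · have : L < L ⊔ Submodule.span ℂ {ψ (v, 0)} := by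
          rw [left_lt_sup, Submodule.span_singleton_le_iff_mem, hψ]
          exact hv
        have := Submodule.finrank_lt_finrank_of_lt this
        omega
      · refine ((han x hx).closure_sdiff (hXan x)).congr ?_
        filter_upwards [eventually_ne_nhds hx] with y hy
        simp [hA₂, hy]
      · have hxA : x ∈ A := hcl x (closure_mono sdiff_subset hx.1) hx.2
        obtain ⟨⟨w, l⟩, rfl⟩ := ψ.surjective x
        obtain ⟨s, rfl⟩ := mem_sup_span_iff ψ hψ hxL
        have hs : s ≠ 0 := by
          rintro rfl
          exact hAL _ hxA ((hψ _ _).2 (zero_smul _ _))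
        have ht : Tendsto ψ.symm (𝓝 (ψ (s • v, l))) (𝓝 (s • v, l)) := by
          have := ψ.symm.continuous.tendsto (ψ (s • v, l))
          rwa [ψ.symm_apply_apply] at this
        obtain ⟨y, hy, hy'⟩ := ((mem_closure_iff_frequently.1 hx.1).and_eventually
          (ht.eventually (hvX s hs l))).exists
        exact hy.2 (hy' (by simpa using hy.1))
    refine ((hXan 0).union hIH).congr (Eventually.of_forall fun x => ?_)
    constructor
    · rintro (h | h | h)
      · by_cases hx : x = 0
        · exact .inr hx
        · exact .inl (hcl x (hX'V h) hx)
      · exact .inl (hcl x (closure_mono sdiff_subset h.1) h.2)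
      · exact .inr h
    · rintro (h | h)
      · by_cases hx : x ∈ ψ.symm ⁻¹' X'
        · exact .inl hx
        · refine .inr (.inl ⟨subset_closure ⟨h, hx⟩, ?_⟩)
          rintro rfl
          exact hAL 0 h L.zero_mem
      · exact .inr (.inr h)

/-- **Remmert–Stein theorem for cones**, local form. -/
theorem IsConic.locAnalyticAt_zero [FiniteDimensional ℂ V] {A : Set V} (hA : IsConic A)
    (h0 : (0 : V) ∉ A) (han : ∀ x ≠ 0, LocAnalyticAt A x) : LocAnalyticAt (A ∪ {0}) 0 := by
  refine locAnalyticAt_zero_of_disjoint (Module.finrank ℂ V + 1) ⊥ A (by simp) hA han ?_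
  intro x hx hx0
  rw [Submodule.mem_bot] at hx0
  exact h0 (hx0 ▸ hx)

end Cone

section Main

theorem IsAnalyticSubset.locAnalyticAt {n : ℕ} {U A : Set (EuclideanSpace ℂ (Fin n))}
    (hA : IsAnalyticSubset U A) {x : EuclideanSpace ℂ (Fin n)} (hx : x ∈ U) :
    LocAnalyticAt A x := by
  by_cases hxA : x ∈ A
  · obtain ⟨W, hWo, hxW, -, k, f, hf, hAW⟩ := hA.2.2 x hxA
    refine ⟨W, hWo, hxW, fun z hz hzA => ?_⟩
    have hz' : z ∉ {z ∈ W | ∀ i, f i z = 0} := fun h => hzA (hAW ▸ h : z ∈ A ∩ W).1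
    obtain ⟨i, hi⟩ : ∃ i, f i z ≠ 0 := by
      by_contra! h
      exact hz' ⟨hz, h⟩
    refine ⟨f i, ⟨fun y hy => HolAt.of_differentiableOn (hf i) hWo hy, fun y hy => ?_⟩, hi⟩
    rw [hAW] at hy
    exact hy.2 i
  · have h : x ∉ closure A := fun h => hxA (hA.2.1 x hx h)
    refine .of_eventually_notMem ?_
    filter_upwards [isClosed_closure.isOpen_compl.mem_nhds h] with y hy hyA
    exact hy (subset_closure hyA)

theorem tendsto_smul_const_nhds_zero {V : Type*} [NormedAddCommGroup V] [NormedSpace ℂ V] (a : V) :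
    Tendsto (fun s : ℂ => s • a) (𝓝 0) (𝓝 0) := by
  have h : Continuous fun s : ℂ => s • a := by fun_prop
  simpa using h.tendsto 0

/-- The homogeneous Taylor polynomials of a holomorphic function at the origin. -/
theorem HolAt.exists_isHomogeneous_iteratedDeriv {n : ℕ} (d : ℕ) :
    ∀ {f : EuclideanSpace ℂ (Fin n) → ℂ}, HolAt f 0 → ∃ p : MvPolynomial (Fin n) ℂ,
      p.IsHomogeneous d ∧ ∀ z : EuclideanSpace ℂ (Fin n),
        iteratedDeriv d (fun s : ℂ => f (s • z)) 0 = MvPolynomial.eval (fun j => z j) p := by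
  induction d with
  | zero =>
    exact fun {f} _ => ⟨MvPolynomial.C (f 0), MvPolynomial.isHomogeneous_C _ _, fun z => by simp⟩
  | succ d ih =>
    intro f hf
    set e : Fin n → EuclideanSpace ℂ (Fin n) := fun j => EuclideanSpace.single j 1
    have hfe := fun j => hf.fderiv_apply (e j)
    choose p hp hpz using fun j => ih (hfe j)
    refine ⟨∑ j, MvPolynomial.X j * p j, MvPolynomial.IsHomogeneous.sum _ _ _ fun j _ => ?_,
      fun z => ?_⟩
    · rw [add_comm]
      exact (MvPolynomial.isHomogeneous_X ℂ j).mul (hp j)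
    have hline : ∀ {g : EuclideanSpace ℂ (Fin n) → ℂ}, HolAt g 0 →
        HolAt (fun s : ℂ => g (s • z)) 0 := fun {g} hg =>
      HolAt.comp (u := fun s : ℂ => s • z) (by simpa using hg) (.of_differentiable (by fun_prop))
    have hz : z = ∑ j, z j • e j := by
      ext i
      simp [e, Finset.sum_apply, Pi.single_apply]
    have hderiv : deriv (fun s : ℂ => f (s • z)) =ᶠ[𝓝 0]
        fun s => ∑ j, z j * fderiv ℂ f (s • z) (e j) := by
      filter_upwards [(tendsto_smul_const_nhds_zero z).eventually hf] with s hs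
      have h1 : HasDerivAt (fun s : ℂ => s • z) z s := by
        simpa using (hasDerivAt_id s).smul_const z
      refine (hs.hasFDerivAt.comp_hasDerivAt s h1).deriv.trans ?_
      conv_lhs => rw [hz]
      simp only [map_sum, map_smul, smul_eq_mul]
      rw [← hz]
    rw [iteratedDeriv_succ', hderiv.iteratedDeriv_eq, iteratedDeriv_fun_sum]
    · simp only [iteratedDeriv_const_mul_field, hpz, map_sum, map_mul, MvPolynomial.eval_X]
    · intro j _
      exact ((HolAt.const (z j)).mul (hline (hfe j))).analyticAt.contDiffAt

theorem AnalyticAt.eventually_eq_zero_of_iteratedDeriv {g : ℂ → ℂ} {x : ℂ}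
    (hg : AnalyticAt ℂ g x) (h : ∀ d, iteratedDeriv d g x = 0) : ∀ᶠ s in 𝓝 x, g s = 0 := by
  have h1 := hg.hasFPowerSeriesAt
  have h0 : FormalMultilinearSeries.ofScalars ℂ
      (fun n ↦ iteratedDeriv n g x / (n.factorial : ℂ)) = 0 := by
    ext n
    simp [h, FormalMultilinearSeries.ofScalars]
  rw [h0] at h1
  exact h1.eventually_eq_zero

variable {n : ℕ} {A : Set (EuclideanSpace ℂ (Fin n))}

/-- A cone analytic at its vertex is separated from the points outside it by homogeneous
polynomials. -/
theorem IsConic.exists_isHomogeneous_eval_ne_zero (hA : IsConic A) (h0 : (0 : _) ∈ A)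
    (han : LocAnalyticAt A 0) {z : EuclideanSpace ℂ (Fin n)} (hz : z ∉ A) :
    ∃ p : MvPolynomial (Fin n) ℂ, (∃ d, p.IsHomogeneous d) ∧
      (∀ a ∈ A, MvPolynomial.eval (fun j => a j) p = 0) ∧
      MvPolynomial.eval (fun j => z j) p ≠ 0 := by
  obtain ⟨R, hR, hRA⟩ := han.exists_radius
  have hsm : ∀ a : EuclideanSpace ℂ (Fin n), ∀ᶠ s : ℂ in 𝓝 0, s • a ∈ ball 0 R := fun a =>
    (tendsto_smul_const_nhds_zero a).eventually (ball_mem_nhds _ hR)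
  obtain ⟨t, ht0, ht⟩ : ∃ t : ℂ, t ≠ 0 ∧ t • z ∈ ball 0 R :=
    ((eventually_mem_nhdsWithin (s := {0}ᶜ)).and
      (eventually_nhdsWithin_of_eventually_nhds (hsm z))).exists
  obtain ⟨f, hf, hfz⟩ := hRA R le_rfl _ ht fun h => hz ((hA.smul_mem_iff ht0).1 h)
  have hf0 : HolAt f 0 := hf.1 0 (mem_ball_self hR)
  have hline : ∀ a, ∀ s : ℂ, s • a ∈ ball 0 R → HolAt (fun s : ℂ => f (s • a)) s :=
    fun a s hs => HolAt.comp (u := fun s : ℂ => s • a) (hf.1 _ hs)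
      (.of_differentiable (by fun_prop))
  set U : Set ℂ := {s | s • z ∈ ball 0 R}
  have hconv : Convex ℝ U := (convex_ball (0 : EuclideanSpace ℂ (Fin n)) R).linear_preimage
    ((ContinuousLinearMap.toSpanSingleton ℂ z).toLinearMap.restrictScalars ℝ)
  have h0U : (0 : ℂ) ∈ U := by simp [U, hR]
  obtain ⟨d, hd⟩ : ∃ d, iteratedDeriv d (fun s : ℂ => f (s • z)) 0 ≠ 0 := by
    by_contra! h
    exact hfz (eq_zero_of_convex_of_eventuallyEq hconv (hline z) h0U
      ((hline z 0 h0U).analyticAt.eventually_eq_zero_of_iteratedDeriv h) t ht)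
  obtain ⟨p, hp, hpz⟩ := hf0.exists_isHomogeneous_iteratedDeriv d
  refine ⟨p, ⟨d, hp⟩, fun a ha => ?_, by rwa [← hpz]⟩
  have h1 : (fun s : ℂ => f (s • a)) =ᶠ[𝓝 0] fun _ => 0 := by
    filter_upwards [hsm a] with s hs
    refine hf.2 _ ⟨?_, hs⟩
    rcases eq_or_ne s 0 with rfl | hs0
    · simpa using h0
    · exact hA s hs0 a ha
  rw [← hpz, h1.iteratedDeriv_eq]
  simp

theorem IsConic.exists_fin_isHomogeneous (hA : IsConic A) (h0 : (0 : _) ∈ A)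
    (han : LocAnalyticAt A 0) : ∃ (k : ℕ) (p : Fin k → MvPolynomial (Fin n) ℂ),
      (∀ i, ∃ d : ℕ, (p i).IsHomogeneous d) ∧
      A = {z | ∀ i, MvPolynomial.eval (fun j => z j) (p i) = 0} := by
  set P : Set (MvPolynomial (Fin n) ℂ) := {p | (∃ d, p.IsHomogeneous d) ∧
    ∀ a ∈ A, MvPolynomial.eval (fun j => a j) p = 0}
  obtain ⟨t, htP, ht⟩ := Submodule.fg_span_iff_fg_span_finset_subset P |>.1
    (IsNoetherian.noetherian (Ideal.span P))
  refine ⟨t.card, fun i => t.equivFin.symm i, fun i => (htP (t.equivFin.symm i).2).1, ?_⟩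
  ext z
  refine ⟨fun hz i => (htP (t.equivFin.symm i).2).2 z hz, fun hz => ?_⟩
  by_contra hzA
  obtain ⟨p, hp, hpA, hpz⟩ := hA.exists_isHomogeneous_eval_ne_zero h0 han hzA
  have hle : Ideal.span (t : Set (MvPolynomial (Fin n) ℂ)) ≤
      RingHom.ker (MvPolynomial.eval fun j => z j) := by
    refine Ideal.span_le.2 fun q hq => ?_
    simpa [RingHom.mem_ker] using hz (t.equivFin ⟨q, hq⟩)
  have hpm : p ∈ Submodule.span (MvPolynomial (Fin n) ℂ) P := Submodule.subset_span ⟨hp, hpA⟩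
  rw [ht] at hpm
  exact hpz (hle hpm)

theorem IsConic.zero_mem_closure {V : Type*} [NormedAddCommGroup V] [NormedSpace ℂ V] {A : Set V}
    (hA : IsConic A) (hne : A.Nonempty) : (0 : V) ∈ closure A := by
  obtain ⟨a, ha⟩ := hne
  refine mem_closure_of_tendsto
    ((tendsto_smul_const_nhds_zero a).mono_left (nhdsWithin_le_nhds (s := {0}ᶜ))) ?_
  filter_upwards [self_mem_nhdsWithin] with s hs using hA s hs a ha

theorem isAnalyticSubset_univ_of_eval {k : ℕ} {p : Fin k → MvPolynomial (Fin n) ℂ}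
    (hA : A = {z | ∀ i, MvPolynomial.eval (fun j => z j) (p i) = 0}) :
    IsAnalyticSubset univ A := by
  have hd : ∀ i, Differentiable ℂ fun z : EuclideanSpace ℂ (Fin n) =>
      MvPolynomial.eval (fun j => z j) (p i) := fun i z =>
    (AnalyticOnNhd.eval_continuousLinearMap' (𝕜 := ℂ)
      (fun j => (EuclideanSpace.proj j : EuclideanSpace ℂ (Fin n) →L[ℂ] ℂ)) (p i) z
      (mem_univ z)).differentiableAt
  have hc : IsClosed A := by
    rw [hA, ofPred_forall]
    exact isClosed_iInter fun i => isClosed_eq (hd i).continuous continuous_const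
  refine ⟨subset_univ _, fun z _ hz => hc.closure_subset hz, fun a _ => ⟨univ, isOpen_univ,
    mem_univ a, subset_rfl, k, _, fun i => (hd i).differentiableOn, ?_⟩⟩
  simp [hA]

end Main

end RemmertStein

/-- **Remmert–Stein extension for cones.** If `A` is a nonempty analytic subset of `ℂⁿ \ {0}`
invariant under multiplication by nonzero scalars, then `A ∪ {0}` is an analytic subset of
`ℂⁿ`, and in fact `A ∪ {0}` is the common zero set of finitely many homogeneous polynomials. -/
theorem remmert_stein_cone (n : ℕ) (A : Set (EuclideanSpace ℂ (Fin n)))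
    (hne : A.Nonempty)
    (hA : IsAnalyticSubset {(0 : EuclideanSpace ℂ (Fin n))}ᶜ A)
    (hinv : ∀ (lam : ℂ), lam ≠ 0 → ∀ a ∈ A, lam • a ∈ A) :
    IsAnalyticSubset (Set.univ : Set (EuclideanSpace ℂ (Fin n)))
        (A ∪ {(0 : EuclideanSpace ℂ (Fin n))}) ∧
      closure A = A ∪ {(0 : EuclideanSpace ℂ (Fin n))} ∧
      ∃ (k : ℕ) (p : Fin k → MvPolynomial (Fin n) ℂ),
        (∀ i, ∃ d : ℕ, (p i).IsHomogeneous d) ∧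
        A ∪ {(0 : EuclideanSpace ℂ (Fin n))} =
          {z : EuclideanSpace ℂ (Fin n) | ∀ i, MvPolynomial.eval (fun j => z j) (p i) = 0} := by
  have hcone : IsConic A := hinv
  have hcl : closure A = A ∪ {(0 : EuclideanSpace ℂ (Fin n))} := by
    refine Set.Subset.antisymm (fun z hz => ?_) (Set.union_subset subset_closure
      (Set.singleton_subset_iff.2 (hcone.zero_mem_closure hne)))
    by_cases h : z = 0
    · exact Or.inr h
    · exact Or.inl (hA.2.1 z h hz)
  have hcone' : IsConic (A ∪ {(0 : EuclideanSpace ℂ (Fin n))}) := hcl ▸ isConic_closure hcone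
  obtain ⟨k, p, hp, hAp⟩ := hcone'.exists_fin_isHomogeneous (Or.inr rfl)
    (hcone.locAnalyticAt_zero (fun h => hA.1 h rfl) fun x hx => hA.locAnalyticAt hx)
  exact ⟨isAnalyticSubset_univ_of_eval hAp, hcl, k, p, hp, hAp⟩
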